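/- Let 2.3542 ≤ p < 5. Every smooth solution φ of the defocusing semilinear wave equation with E_{1,p−1}[φ] < ∞ is bounded in the mixed spacetime norm L^p_t L^{2p}_x, i.e. ∫₀^∞ ( ∫_{ℝ³} |φ(t,x)|^{2p} dx )^{1/2} dt < ∞. -/

import Mathlib

open MeasureTheory Real
open scoped ENNReal InnerProductSpace

noncomputable section

/-- Three-dimensional Euclidean space. -/
abbrev E3 : Type := EuclideanSpace ℝ (Fin 3)

/-- Second derivative of `f` at `x` in the direction `v`. -/
def der2 (f : E3 → ℝ) (x v : E3) : ℝ := fderiv ℝ (fun y => fderiv ℝ f y v) x v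

/-- The (spatial) Laplacian on `ℝ³`. -/
def lap3 (f : E3 → ℝ) (x : E3) : ℝ :=
  ∑ i : Fin 3, der2 f x (EuclideanSpace.single i 1)

/-- First time derivative `∂_t φ`. -/
def dt1 (φ : ℝ → E3 → ℝ) (t : ℝ) (x : E3) : ℝ := deriv (fun s => φ s x) t

/-- Second time derivative `∂_t² φ`. -/
def dtt (φ : ℝ → E3 → ℝ) (t : ℝ) (x : E3) : ℝ := deriv (fun s => dt1 φ s x) t

/-- `φ` is a smooth solution of the defocusing semilinear wave equation
`∂_t²φ − Δφ + |φ|^{p−1}φ = 0` on `[0,∞) × ℝ³`. -/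
def IsNLWSolution (p : ℝ) (φ : ℝ → E3 → ℝ) : Prop :=
  ContDiff ℝ (⊤ : ℕ∞) (fun q : ℝ × E3 => φ q.1 q.2) ∧
    ∀ t : ℝ, 0 ≤ t → ∀ x : E3,
      dtt φ t x - lap3 (φ t) x + |φ t x| ^ (p - 1) * φ t x = 0

/-- The weighted initial energy `E_{k,γ₀}[φ]`. -/
def wEnergy (p : ℝ) (k : ℕ) (γ₀ : ℝ) (φ : ℝ → E3 → ℝ) : ℝ≥0∞ :=
  (∑ l ∈ Finset.range (k + 1),
    ∫⁻ x : E3, ENNReal.ofReal ((1 + ‖x‖) ^ (γ₀ + 2 * (l : ℝ)) *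
      (‖iteratedFDeriv ℝ (l + 1) (φ 0) x‖ ^ 2 + ‖iteratedFDeriv ℝ l (dt1 φ 0) x‖ ^ 2))) +
  ∫⁻ x : E3, ENNReal.ofReal ((1 + ‖x‖) ^ γ₀ * |φ 0 x| ^ (p + 1))

/-- `u₊ = √(1+((t−r)/2)²)`. -/
def uplus (t r : ℝ) : ℝ := Real.sqrt (1 + ((t - r) / 2) ^ 2)

/-- `v₊ = √(1+((t+r)/2)²)`. -/
def vplus (t r : ℝ) : ℝ := Real.sqrt (1 + ((t + r) / 2) ^ 2)

/-- Surface measure on the unit sphere `S² ⊂ ℝ³` (total mass `4π`). -/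
def sphereMeasure : Measure (Metric.sphere (0 : E3) 1) := (volume : Measure E3).toSphere

/-- The surface measure of the unit sphere, seen as a measure on the ambient space. -/
def sig : Measure E3 := sphereMeasure.map Subtype.val

instance : IsFiniteMeasure sphereMeasure :=
  inferInstanceAs (IsFiniteMeasure (Measure.toSphere volume))

instance : IsFiniteMeasure sig := by unfold sig; infer_instance

lemma isCompact_unitSphere : IsCompact (Metric.sphere (0 : E3) 1) := isCompact_sphere 0 1

lemma sig_restrict : sig.restrict (Metric.sphere (0 : E3) 1) = sig := by
  refine Measure.restrict_eq_self_of_ae_mem ?_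
  unfold sig
  refine (ae_map_iff (p := fun x => x ∈ Metric.sphere (0 : E3) 1)
    measurable_subtype_coe.aemeasurable Metric.isClosed_sphere.measurableSet).2 ?_
  exact Filter.Eventually.of_forall fun x => x.2

lemma ae_sig : ∀ᵐ ω ∂sig, ‖ω‖ = 1 := by
  rw [← sig_restrict]
  filter_upwards [ae_restrict_mem Metric.isClosed_sphere.measurableSet] with ω hω
  simpa using hω

lemma Continuous.integrable_sig {F : Type*} [NormedAddCommGroup F] {f : E3 → F}
    (hf : Continuous f) : Integrable f sig := by
  rw [← sig_restrict]
  exact hf.continuousOn.integrableOn_compact isCompact_unitSphere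

lemma lintegral_sig {F : E3 → ℝ≥0∞} (hF : Measurable F) :
    ∫⁻ ω, F ω ∂sig = ∫⁻ ω : Metric.sphere (0 : E3) 1, F ω ∂sphereMeasure := by
  unfold sig
  rw [lintegral_map hF measurable_subtype_coe]

lemma lintegral_polar {F : E3 → ℝ≥0∞} (hF : Measurable F) :
    ∫⁻ x, F x = ∫⁻ r in Set.Ioi (0 : ℝ), ENNReal.ofReal (r ^ 2) * ∫⁻ ω, F (r • ω) ∂sig := by
  have h0 : ∫⁻ x, F x = ∫⁻ x : ({0}ᶜ : Set E3), F x ∂(Measure.comap Subtype.val volume) := by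
    rw [lintegral_subtype_comap (measurableSet_singleton _).compl, restrict_compl_singleton]
  have hmp := Measure.measurePreserving_homeomorphUnitSphereProd (volume : Measure E3)
  have h1 : ∫⁻ x : ({0}ᶜ : Set E3), F x ∂(Measure.comap Subtype.val volume)
      = ∫⁻ z, F (z.2.1 • z.1.1) ∂((volume : Measure E3).toSphere.prod
          (Measure.volumeIoiPow (Module.finrank ℝ E3 - 1))) := by
    rw [← hmp.lintegral_comp_emb (Homeomorph.measurableEmbedding _)]
    refine lintegral_congr fun x => ?_
    have := homeomorphUnitSphereProd_symm_apply_coe E3 (homeomorphUnitSphereProd E3 x)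
    rw [Homeomorph.symm_apply_apply] at this
    rw [← this]
  have hm : Measurable fun z : Metric.sphere (0 : E3) 1 × Set.Ioi (0 : ℝ) =>
      F (z.2.1 • z.1.1) := hF.comp (by fun_prop)
  rw [h0, h1, lintegral_prod_symm _ hm.aemeasurable]
  have hd : Module.finrank ℝ E3 - 1 = 2 := by simp
  rw [hd]
  unfold Measure.volumeIoiPow
  rw [lintegral_withDensity_eq_lintegral_mul _ (by fun_prop) hm.lintegral_prod_left']
  have := lintegral_subtype_comap (μ := (volume : Measure ℝ)) (measurableSet_Ioi (a := (0 : ℝ)))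
    (fun r => ENNReal.ofReal (r ^ 2) * ∫⁻ ω, F (r • ω) ∂sig)
  rw [← this]
  refine lintegral_congr fun r => ?_
  simp only [Pi.mul_apply]
  rw [lintegral_sig (F := fun ω => F (r.1 • ω)) (hF.comp (by fun_prop))]
  rfl

lemma lintegral_sig_eq_ball {F : E3 → ℝ≥0∞} (hF : Measurable F) :
    ∫⁻ ω, F ω ∂sig = 3 * ∫⁻ x in Metric.ball (0 : E3) 1, F (‖x‖⁻¹ • x) := by
  have hFm : Measurable fun x : E3 => F (‖x‖⁻¹ • x) := hF.comp (by fun_prop)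
  rw [← lintegral_indicator Metric.isOpen_ball.measurableSet,
    lintegral_polar (hFm.indicator Metric.isOpen_ball.measurableSet)]
  have : ∀ r ∈ Set.Ioi (0 : ℝ), ENNReal.ofReal (r ^ 2) *
      ∫⁻ ω, (Metric.ball (0 : E3) 1).indicator (fun x => F (‖x‖⁻¹ • x)) (r • ω) ∂sig
      = (Set.Ioo (0 : ℝ) 1).indicator (fun r => ENNReal.ofReal (r ^ 2)) r * ∫⁻ ω, F ω ∂sig := by
    intro r hr
    have hr' : 0 < r := hr
    by_cases h1 : r < 1
    · rw [Set.indicator_of_mem (show r ∈ Set.Ioo (0 : ℝ) 1 from ⟨hr', h1⟩)]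
      congr 1
      refine lintegral_congr_ae ?_
      filter_upwards [ae_sig] with ω hω
      rw [Set.indicator_of_mem (by simp [norm_smul, hω, abs_of_pos hr', h1])]
      simp [norm_smul, hω, abs_of_pos hr', smul_smul, hr'.ne']
    · rw [Set.indicator_of_notMem (by simp [h1]), zero_mul]
      rw [lintegral_congr_ae (g := fun _ => 0)]
      · simp
      · filter_upwards [ae_sig] with ω hω
        rw [Set.indicator_of_notMem (by simpa [norm_smul, hω, abs_of_pos hr'] using h1)]
  rw [setLIntegral_congr_fun measurableSet_Ioi this,
    lintegral_mul_const _ (by measurability), lintegral_indicator measurableSet_Ioo,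
    Measure.restrict_restrict measurableSet_Ioo]
  have h3 : ∫⁻ r in Set.Ioo (0 : ℝ) 1 ∩ Set.Ioi 0, ENNReal.ofReal (r ^ 2) = ENNReal.ofReal (1 / 3) := by
    rw [Set.inter_eq_left.2 (fun x hx => hx.1), Measure.restrict_congr_set Ioo_ae_eq_Ioc,
      ← ofReal_integral_eq_lintegral_ofReal ((intervalIntegral.intervalIntegrable_pow _).1)
        (Filter.Eventually.of_forall fun x => sq_nonneg x),
      ← intervalIntegral.integral_of_le zero_le_one]
    norm_num
  rw [h3, ← mul_assoc, show (3 : ℝ≥0∞) = ENNReal.ofReal 3 by simp, ← ENNReal.ofReal_mul (by norm_num)]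
  norm_num

lemma measurePreserving_sig (Q : E3 ≃ₗᵢ[ℝ] E3) : MeasurePreserving Q sig sig := by
  refine ⟨Q.continuous.measurable, ?_⟩
  refine Measure.ext fun s hs => ?_
  rw [← lintegral_indicator_one hs, lintegral_map (measurable_one.indicator hs)
    Q.continuous.measurable, ← lintegral_indicator_one hs,
    lintegral_sig_eq_ball (F := fun a => s.indicator 1 (Q a))
      ((measurable_one.indicator hs).comp Q.continuous.measurable),
    lintegral_sig_eq_ball (measurable_one.indicator hs)]
  congr 1
  have hb : Q ⁻¹' Metric.ball (0 : E3) 1 = Metric.ball 0 1 := by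
    ext x; simp
  have := Q.measurePreserving.setLIntegral_comp_preimage_emb Q.toHomeomorph.measurableEmbedding
    (fun x => s.indicator (1 : E3 → ℝ≥0∞) (‖x‖⁻¹ • x)) (Metric.ball (0 : E3) 1)
  rw [hb] at this
  rw [← this]
  simp

lemma ContDiff.hasDerivAt_curve {V W : Type*} [NormedAddCommGroup V] [NormedSpace ℝ V]
    [NormedAddCommGroup W] [NormedSpace ℝ W]
    {G : V → W} (hG : ContDiff ℝ 1 G) {c : ℝ → V} {c' : V} {s : ℝ} (h : HasDerivAt c c' s) :
    HasDerivAt (fun s => G (c s)) (fderiv ℝ G (c s) c') s :=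
  (hG.differentiable (by norm_num) (c s)).hasFDerivAt.comp_hasDerivAt s h

section SphereParam
variable {E : Type*} [NormedAddCommGroup E] [NormedSpace ℝ E] [FiniteDimensional ℝ E]

lemma continuous_integral_sig {X F : Type*} [TopologicalSpace X] [FirstCountableTopology X]
    [LocallyCompactSpace X]
    [NormedAddCommGroup F] [NormedSpace ℝ F] {f : X × E3 → F} (hf : Continuous f) :
    Continuous fun x => ∫ ω, f (x, ω) ∂sig := by
  rw [← sig_restrict]
  exact continuous_parametric_integral_of_continuous (f := fun x ω => f (x, ω)) hf
    isCompact_unitSphere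

lemma hasFDerivAt_integral_sig {F : E × E3 → ℝ} (hF : ContDiff ℝ 1 F) (x : E) :
    HasFDerivAt (fun x => ∫ ω, F (x, ω) ∂sig)
      (∫ ω, (fderiv ℝ F (x, ω)).comp (ContinuousLinearMap.inl ℝ E E3) ∂sig) x := by
  have hc : Continuous fun z : E × E3 => (fderiv ℝ F z).comp (ContinuousLinearMap.inl ℝ E E3) :=
    (hF.continuous_fderiv (by norm_num)).clm_comp continuous_const
  obtain ⟨C, hC⟩ := ((isCompact_closedBall x 1).prod isCompact_unitSphere).exists_bound_of_continuousOn
    hc.continuousOn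
  refine hasFDerivAt_integral_of_dominated_of_fderiv_le (bound := fun _ => C)
    (F' := fun x ω => (fderiv ℝ F (x, ω)).comp (ContinuousLinearMap.inl ℝ E E3))
    (Metric.closedBall_mem_nhds x one_pos) ?_ ?_ ?_ ?_ (integrable_const _) ?_
  · exact Filter.Eventually.of_forall fun y =>
      (Continuous.integrable_sig (hF.continuous.comp (by fun_prop))).aestronglyMeasurable
  · exact Continuous.integrable_sig (hF.continuous.comp (by fun_prop))
  · exact (Continuous.integrable_sig (hc.comp (by fun_prop))).aestronglyMeasurable
  · filter_upwards [ae_sig] with ω hω y hy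
    exact hC (y, ω) ⟨hy, by simpa using hω⟩
  · refine Filter.Eventually.of_forall fun ω y _ => ?_
    have h1 := ((hF.differentiable (by norm_num)) (y, ω)).hasFDerivAt
    have h2 : HasFDerivAt (fun y : E => (y, ω)) (ContinuousLinearMap.inl ℝ E E3) y :=
      (hasFDerivAt_id (𝕜 := ℝ) y).prodMk (hasFDerivAt_const ω y)
    exact h1.comp y h2

lemma fderiv_integral_sig {F : E × E3 → ℝ} (hF : ContDiff ℝ 1 F) (x v : E) :
    fderiv ℝ (fun x => ∫ ω, F (x, ω) ∂sig) x v = ∫ ω, fderiv ℝ F (x, ω) (v, 0) ∂sig := by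
  rw [(hasFDerivAt_integral_sig hF x).fderiv, ContinuousLinearMap.integral_apply]
  · simp
  · exact Continuous.integrable_sig
      (((hF.continuous_fderiv (by norm_num)).comp (by fun_prop)).clm_comp continuous_const)

lemma contDiff_integral_sig {F : E × E3 → ℝ} (hF : ContDiff ℝ 1 F) :
    ContDiff ℝ 1 fun x => ∫ ω, F (x, ω) ∂sig := by
  rw [contDiff_one_iff_fderiv]
  refine ⟨fun x => (hasFDerivAt_integral_sig hF x).differentiableAt, ?_⟩
  have : fderiv ℝ (fun x => ∫ ω, F (x, ω) ∂sig) = fun x =>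
      ∫ ω, (fderiv ℝ F (x, ω)).comp (ContinuousLinearMap.inl ℝ E E3) ∂sig :=
    funext fun x => (hasFDerivAt_integral_sig hF x).fderiv
  rw [this]
  exact continuous_integral_sig (X := E)
    (f := fun z => (fderiv ℝ F z).comp (ContinuousLinearMap.inl ℝ E E3))
    ((hF.continuous_fderiv (by norm_num)).clm_comp continuous_const)

end SphereParam

/-- The infinitesimal rotation `x ↦ e_k × x`. -/
def rotGen (k : Fin 3) : E3 →L[ℝ] E3 :=
  (EuclideanSpace.proj (k + 1) : E3 →L[ℝ] ℝ).smulRight (EuclideanSpace.single (k + 2) 1) -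
    (EuclideanSpace.proj (k + 2) : E3 →L[ℝ] ℝ).smulRight (EuclideanSpace.single (k + 1) 1)

lemma rotGen_apply (k : Fin 3) (x : E3) :
    rotGen k x = x (k + 1) • EuclideanSpace.single (k + 2) 1
      - x (k + 2) • EuclideanSpace.single (k + 1) 1 := by
  simp [rotGen]

/-- Rotation by the angle `θ` about the `k`-th axis (Rodrigues' formula). -/
def rotLin (k : Fin 3) (θ : ℝ) : E3 →L[ℝ] E3 :=
  ContinuousLinearMap.id ℝ E3 + sin θ • rotGen k + (1 - cos θ) • (rotGen k).comp (rotGen k)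

lemma norm_rotLin (k : Fin 3) (θ : ℝ) (x : E3) : ‖rotLin k θ x‖ = ‖x‖ := by
  have h := Real.sin_sq_add_cos_sq θ
  have : ‖rotLin k θ x‖ ^ 2 = ‖x‖ ^ 2 := by
    simp only [EuclideanSpace.norm_sq_eq, Fin.sum_univ_three, Real.norm_eq_abs, sq_abs]
    fin_cases k <;> simp [rotLin, rotGen_apply]
    · linear_combination (x 1 ^ 2 + x 2 ^ 2) * h
    · linear_combination (x 0 ^ 2 + x 2 ^ 2) * h
    · linear_combination (x 0 ^ 2 + x 1 ^ 2) * h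
  exact (pow_left_inj₀ (norm_nonneg _) (norm_nonneg _) two_ne_zero).1 this

/-- Rotation about the `k`-th axis as a linear isometry equivalence. -/
def rotEquiv (k : Fin 3) (θ : ℝ) : E3 ≃ₗᵢ[ℝ] E3 :=
  (LinearIsometry.mk (rotLin k θ : E3 →ₗ[ℝ] E3) (norm_rotLin k θ)).toLinearIsometryEquiv rfl

lemma integral_fderiv_rotGen {g : E3 → ℝ} (hg : ContDiff ℝ 1 g) (k : Fin 3) :
    ∫ ω, fderiv ℝ g ω (rotGen k ω) ∂sig = 0 := by
  set F : ℝ × E3 → ℝ := fun z => g (rotLin k z.1 z.2) with hFdef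
  have hrot : ContDiff ℝ 1 fun z : ℝ × E3 => rotLin k z.1 z.2 := by
    simp only [rotLin, add_apply, smul_apply,
      ContinuousLinearMap.coe_comp, Function.comp_apply, ContinuousLinearMap.id_apply]
    fun_prop
  have hF : ContDiff ℝ 1 F := hg.comp hrot
  have hconst : (fun θ => ∫ ω, F (θ, ω) ∂sig) = fun _ => ∫ ω, g ω ∂sig := by
    funext θ
    exact (measurePreserving_sig (rotEquiv k θ)).integral_comp
      (rotEquiv k θ).toHomeomorph.measurableEmbedding g
  have h := fderiv_integral_sig hF (0 : ℝ) 1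
  rw [hconst] at h
  simp only [fderiv_fun_const, Pi.zero_apply, zero_apply] at h
  rw [h]
  refine integral_congr_ae (Filter.Eventually.of_forall fun ω => ?_)
  have h1 : HasDerivAt (fun θ : ℝ => F (θ, ω)) (fderiv ℝ F (0, ω) (1, 0)) 0 :=
    hF.hasDerivAt_curve ((hasDerivAt_id (0 : ℝ)).prodMk (hasDerivAt_const (0 : ℝ) ω))
  have h2 : HasDerivAt (fun θ : ℝ => rotLin k θ ω) (rotGen k ω) 0 := by
    have hs : HasDerivAt (fun θ : ℝ => ω + sin θ • rotGen k ω + (1 - cos θ) • rotGen k (rotGen k ω))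
        (0 + cos 0 • rotGen k ω + (0 - -sin 0) • rotGen k (rotGen k ω)) 0 :=
      (((hasDerivAt_const _ _).add ((hasDerivAt_sin 0).smul_const _))).add
        (((hasDerivAt_const _ _).sub (hasDerivAt_cos 0)).smul_const _)
    simpa [rotLin] using hs
  have h0 : rotLin k 0 ω = ω := by simp [rotLin]
  have h3 : HasDerivAt (fun θ : ℝ => F (θ, ω)) (fderiv ℝ g ω (rotGen k ω)) 0 := by
    have := hg.hasDerivAt_curve h2
    rwa [h0] at this
  exact h3.unique h1

lemma sq_le_mul_of_quadratic_nonneg {a b c : ℝ} (h : ∀ x : ℝ, 0 ≤ a + 2 * b * x + c * x ^ 2) :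
    b ^ 2 ≤ a * c := by
  have := discrim_le_zero (a := c) (b := 2 * b) (c := a) (fun x => by have := h x; nlinarith)
  unfold discrim at this
  nlinarith

lemma sq_integral_mul_le {α : Type*} [MeasurableSpace α] {μ : Measure α} {f g : α → ℝ}
    (hf : Integrable (fun x => f x ^ 2) μ) (hg : Integrable (fun x => g x ^ 2) μ)
    (hfg : Integrable (fun x => f x * g x) μ) :
    (∫ x, f x * g x ∂μ) ^ 2 ≤ (∫ x, f x ^ 2 ∂μ) * ∫ x, g x ^ 2 ∂μ := by
  refine sq_le_mul_of_quadratic_nonneg fun x => ?_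
  have h0 : 0 ≤ ∫ a, (f a + x * g a) ^ 2 ∂μ := integral_nonneg fun a => sq_nonneg _
  have h1 : ∫ a, (f a + x * g a) ^ 2 ∂μ
      = ∫ a, (f a ^ 2 + (2 * x) * (f a * g a) + x ^ 2 * g a ^ 2) ∂μ := by
    congr 1; ext a; ring
  rw [h1, integral_add (f := fun a => f a ^ 2 + (2 * x) * (f a * g a))
      (hf.add (hfg.const_mul _)) (hg.const_mul _),
    integral_add hf (hfg.const_mul _), integral_const_mul, integral_const_mul] at h0
  nlinarith

lemma sq_integral_sig_mul_le {f g : E3 → ℝ} (hf : Continuous f) (hg : Continuous g) :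
    (∫ ω, f ω * g ω ∂sig) ^ 2 ≤ (∫ ω, f ω ^ 2 ∂sig) * ∫ ω, g ω ^ 2 ∂sig :=
  sq_integral_mul_le (hf.pow 2).integrable_sig (hg.pow 2).integrable_sig (hf.mul hg).integrable_sig

lemma integral_sig_mono {f g : E3 → ℝ} (hf : Continuous f) (hg : Continuous g)
    (h : ∀ ω, ‖ω‖ = 1 → f ω ≤ g ω) : ∫ ω, f ω ∂sig ≤ ∫ ω, g ω ∂sig := by
  refine integral_mono_ae hf.integrable_sig hg.integrable_sig ?_
  filter_upwards [ae_sig] with ω hω using h ω hω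

lemma integral_sig_nonneg {f : E3 → ℝ} (h : ∀ ω, ‖ω‖ = 1 → 0 ≤ f ω) : 0 ≤ ∫ ω, f ω ∂sig := by
  refine integral_nonneg_of_ae ?_
  filter_upwards [ae_sig] with ω hω using h ω hω

/-- The integral of `F` over `[a, b] × S²`. -/
def shell (a b : ℝ) (F : ℝ × E3 → ℝ) : ℝ := ∫ r in a..b, ∫ ω, F (r, ω) ∂sig

section shell
variable {a b : ℝ} {F G : ℝ × E3 → ℝ}

lemma continuous_sphere (hF : Continuous F) : Continuous fun r => ∫ ω, F (r, ω) ∂sig :=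
  continuous_integral_sig hF

lemma shell_add (hF : Continuous F) (hG : Continuous G) :
    shell a b (fun z => F z + G z) = shell a b F + shell a b G := by
  unfold shell
  rw [← intervalIntegral.integral_add ((continuous_sphere hF).intervalIntegrable _ _)
    ((continuous_sphere hG).intervalIntegrable _ _)]
  congr 1; ext r
  exact integral_add (Continuous.integrable_sig (by fun_prop)) (Continuous.integrable_sig (by fun_prop))

lemma shell_const_mul (c : ℝ) : shell a b (fun z => c * F z) = c * shell a b F := by
  unfold shell
  simp only [integral_const_mul, intervalIntegral.integral_const_mul]

lemma shell_mono (hab : a ≤ b) (hF : Continuous F) (hG : Continuous G)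
    (h : ∀ r ∈ Set.Icc a b, ∀ ω, ‖ω‖ = 1 → F (r, ω) ≤ G (r, ω)) : shell a b F ≤ shell a b G :=
  intervalIntegral.integral_mono_on hab ((continuous_sphere hF).intervalIntegrable _ _)
    ((continuous_sphere hG).intervalIntegrable _ _) fun r hr =>
    integral_sig_mono (by fun_prop) (by fun_prop) (h r hr)

lemma shell_nonneg (hab : a ≤ b) (h : ∀ r ∈ Set.Icc a b, ∀ ω, ‖ω‖ = 1 → 0 ≤ F (r, ω)) :
    0 ≤ shell a b F :=
  intervalIntegral.integral_nonneg hab fun r hr => integral_sig_nonneg (h r hr)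

lemma shell_add_adjacent {c : ℝ} (hF : Continuous F) : shell a b F + shell b c F = shell a c F :=
  intervalIntegral.integral_add_adjacent_intervals ((continuous_sphere hF).intervalIntegrable _ _)
    ((continuous_sphere hF).intervalIntegrable _ _)

lemma shell_mono_right {c : ℝ} (hbc : b ≤ c) (hF : Continuous F)
    (h : ∀ r ∈ Set.Icc b c, ∀ ω, ‖ω‖ = 1 → 0 ≤ F (r, ω)) : shell a b F ≤ shell a c F := by
  rw [← shell_add_adjacent (a := a) (b := b) (c := c) hF]
  linarith [shell_nonneg hbc h]

lemma shell_mono_left {c : ℝ} (hab : a ≤ b) (hF : Continuous F)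
    (h : ∀ r ∈ Set.Icc a b, ∀ ω, ‖ω‖ = 1 → 0 ≤ F (r, ω)) : shell b c F ≤ shell a c F := by
  rw [← shell_add_adjacent (a := a) (b := b) (c := c) hF]
  linarith [shell_nonneg hab h]

lemma sq_shell_mul_le (hab : a ≤ b) (hF : Continuous F) (hG : Continuous G) :
    shell a b (fun z => F z * G z) ^ 2
      ≤ shell a b (fun z => F z ^ 2) * shell a b (fun z => G z ^ 2) := by
  refine sq_le_mul_of_quadratic_nonneg fun x => ?_
  have h0 : 0 ≤ shell a b fun z => (F z + x * G z) ^ 2 := shell_nonneg hab fun r _ ω _ => sq_nonneg _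
  have h1 : (fun z => (F z + x * G z) ^ 2)
      = fun z => (F z ^ 2 + (2 * x) * (F z * G z)) + x ^ 2 * G z ^ 2 := by
    ext z; ring
  rw [h1, shell_add (by fun_prop) (by fun_prop), shell_add (by fun_prop) (by fun_prop),
    shell_const_mul, shell_const_mul] at h0
  nlinarith

end shell

lemma hasDerivAt_intervalIntegral {F : ℝ × ℝ → ℝ} (hF : ContDiff ℝ 1 F) (t : ℝ) :
    HasDerivAt (fun t => ∫ s in (0 : ℝ)..1, F (t, s)) (∫ s in (0 : ℝ)..1, fderiv ℝ F (t, s) (1, 0)) t := by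
  have hc : Continuous fun z : ℝ × ℝ => fderiv ℝ F z (1, 0) :=
    (hF.continuous_fderiv (by norm_num)).clm_apply continuous_const
  obtain ⟨C, hC⟩ := ((isCompact_closedBall t 1).prod (isCompact_Icc (a := (0 : ℝ)) (b := 1))).exists_bound_of_continuousOn
    hc.continuousOn
  refine (intervalIntegral.hasDerivAt_integral_of_dominated_loc_of_deriv_le (bound := fun _ => C)
    (F' := fun t s => fderiv ℝ F (t, s) (1, 0)) (F := fun t s => F (t, s))
    (Metric.closedBall_mem_nhds t one_pos) ?_ ?_ ?_ ?_ ?_ ?_).2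
  · exact Filter.Eventually.of_forall fun y =>
      (hF.continuous.comp (by fun_prop : Continuous fun s : ℝ => (y, s))).aestronglyMeasurable
  · exact (hF.continuous.comp (by fun_prop : Continuous fun s : ℝ => (t, s))).intervalIntegrable _ _
  · exact (hc.comp (by fun_prop : Continuous fun s : ℝ => (t, s))).aestronglyMeasurable
  · refine Filter.Eventually.of_forall fun s hs y hy => ?_
    rw [Set.uIoc_of_le zero_le_one] at hs
    exact hC (y, s) ⟨hy, hs.1.le, hs.2⟩
  · exact intervalIntegrable_const
  · exact Filter.Eventually.of_forall fun s _ y _ =>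
      hF.hasDerivAt_curve ((hasDerivAt_id (y : ℝ)).prodMk (hasDerivAt_const (y : ℝ) s))

/-- The energy inequality on a truncated backward light triangle. -/
lemma integral_triangle_le {D J : ℝ × ℝ → ℝ} (hD : ContDiff ℝ 1 D) (hJ : ContDiff ℝ 1 J)
    (hdiv : ∀ t r : ℝ, 0 ≤ t → 0 < r → fderiv ℝ D (t, r) (1, 0) + fderiv ℝ J (t, r) (0, 1) ≤ 0)
    (hJ0 : ∀ t, 0 ≤ t → J (t, 0) ≤ 0) {R t₁ : ℝ} (ht : 0 ≤ t₁) (htR : t₁ ≤ R) :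
    (∫ t in (0 : ℝ)..t₁, (D (t, R - t) + J (t, R - t))) + ∫ r in (0 : ℝ)..(R - t₁), D (t₁, r)
      ≤ ∫ r in (0 : ℝ)..R, D (0, r) := by
  set F : ℝ × ℝ → ℝ := fun z => (R - z.1) * D (z.1, (R - z.1) * z.2) with hFdef
  have hF : ContDiff ℝ 1 F := by
    have : ContDiff ℝ 1 fun z : ℝ × ℝ => (z.1, (R - z.1) * z.2) := by fun_prop
    exact (contDiff_const.sub contDiff_fst).mul (hD.comp this)
  have hG : ∀ t, (∫ s in (0 : ℝ)..1, F (t, s)) = ∫ r in (0 : ℝ)..(R - t), D (t, r) := by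
    intro t
    simp only [hFdef]
    rw [intervalIntegral.integral_const_mul,
      intervalIntegral.mul_integral_comp_mul_left (f := fun r => D (t, r))]
    simp
  have hcf : Continuous fun t => D (t, R - t) + J (t, R - t) := by
    have h1 := hD.continuous
    have h2 := hJ.continuous
    fun_prop
  set H : ℝ → ℝ := fun t => (∫ s in (0 : ℝ)..1, F (t, s))
    + ∫ t in (0 : ℝ)..t, (D (t, R - t) + J (t, R - t)) with hH
  have hderiv : ∀ t, HasDerivAt H ((∫ s in (0 : ℝ)..1, fderiv ℝ F (t, s) (1, 0))
      + (D (t, R - t) + J (t, R - t))) t := fun t =>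
    (hasDerivAt_intervalIntegral hF t).add
      (intervalIntegral.integral_hasDerivAt_right (hcf.intervalIntegrable _ _)
        (hcf.stronglyMeasurableAtFilter _ _) hcf.continuousAt)
  have hFt : ∀ t s, fderiv ℝ F (t, s) (1, 0) = -D (t, (R - t) * s)
      + (R - t) * fderiv ℝ D (t, (R - t) * s) (1, -s) := by
    intro t s
    have h1 : HasDerivAt (fun t => F (t, s)) (fderiv ℝ F (t, s) (1, 0)) t :=
      hF.hasDerivAt_curve ((hasDerivAt_id (t : ℝ)).prodMk (hasDerivAt_const (t : ℝ) s))
    have h2 : HasDerivAt (fun t => (t, (R - t) * s)) ((1 : ℝ), -s) t := by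
      have := (hasDerivAt_id (t : ℝ)).prodMk (((hasDerivAt_id (t : ℝ)).const_sub R).mul_const s)
      rw [neg_one_mul] at this
      exact this
    have h3 := ((hasDerivAt_id (t : ℝ)).const_sub R).mul (hD.hasDerivAt_curve h2)
    rw [h1.unique h3]
    simp only [id, neg_one_mul]
  have hK : ∀ t s, HasDerivAt (fun s => s * D (t, (R - t) * s) + J (t, (R - t) * s))
      (D (t, (R - t) * s) + s * fderiv ℝ D (t, (R - t) * s) (0, R - t)
        + fderiv ℝ J (t, (R - t) * s) (0, R - t)) s := by
    intro t s
    have h2 : HasDerivAt (fun s => (t, (R - t) * s)) ((0 : ℝ), R - t) s := by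
      have := (hasDerivAt_const (s : ℝ) t).prodMk ((hasDerivAt_id (s : ℝ)).const_mul (R - t))
      rw [mul_one] at this
      exact this
    have := ((hasDerivAt_id (s : ℝ)).mul (hD.hasDerivAt_curve h2)).add (hJ.hasDerivAt_curve h2)
    rw [one_mul] at this
    exact this
  have hdc : Continuous (fderiv ℝ D) := hD.continuous_fderiv (by norm_num)
  have hjc : Continuous (fderiv ℝ J) := hJ.continuous_fderiv (by norm_num)
  have hDc := hD.continuous
  have hKi : ∀ t, ∫ s in (0 : ℝ)..1, (D (t, (R - t) * s) + s * fderiv ℝ D (t, (R - t) * s) (0, R - t)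
        + fderiv ℝ J (t, (R - t) * s) (0, R - t)) = D (t, R - t) + J (t, R - t) - J (t, 0) := by
    intro t
    rw [intervalIntegral.integral_eq_sub_of_hasDerivAt (fun s _ => hK t s)]
    · simp
    · apply Continuous.intervalIntegrable
      fun_prop
  have hle : ∀ t ∈ Set.Icc 0 R, (∫ s in (0 : ℝ)..1, fderiv ℝ F (t, s) (1, 0))
      + (D (t, R - t) + J (t, R - t)) ≤ 0 := by
    intro t ht
    have h1 : (∫ s in (0 : ℝ)..1, fderiv ℝ F (t, s) (1, 0))
        ≤ ∫ s in (0 : ℝ)..1, -(D (t, (R - t) * s) + s * fderiv ℝ D (t, (R - t) * s) (0, R - t)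
        + fderiv ℝ J (t, (R - t) * s) (0, R - t)) := by
      refine intervalIntegral.integral_mono_on_of_le_Ioo zero_le_one ?_ ?_ ?_
      · apply Continuous.intervalIntegrable
        simp only [hFt]
        fun_prop
      · apply Continuous.intervalIntegrable
        fun_prop
      · intro s hs
        rw [hFt]
        rcases eq_or_lt_of_le ht.2 with h | h
        · have z : ((0 : ℝ), R - t) = 0 := by rw [h, sub_self]; rfl
          rw [z, h]; simp
        · have hd := hdiv t ((R - t) * s) ht.1 (mul_pos (by linarith) hs.1)
          have e1 : fderiv ℝ D (t, (R - t) * s) (1, -s) = fderiv ℝ D (t, (R - t) * s) (1, 0)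
              - s * fderiv ℝ D (t, (R - t) * s) (0, 1) := by
            rw [← smul_eq_mul s, ← map_smul, ← map_sub]; simp
          have e2 : ∀ G : ℝ × ℝ →L[ℝ] ℝ, G (0, R - t) = (R - t) * G (0, 1) := by
            intro G
            rw [← smul_eq_mul (R - t), ← map_smul]; simp
          rw [e1, e2, e2]
          nlinarith [mul_nonneg (sub_nonneg.2 ht.2) (neg_nonneg.2 hd)]
    rw [intervalIntegral.integral_neg, hKi] at h1
    linarith [hJ0 t ht.1]
  have hanti : AntitoneOn H (Set.Icc 0 R) := by
    refine antitoneOn_of_deriv_nonpos (convex_Icc _ _)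
      (fun t _ => (hderiv t).continuousAt.continuousWithinAt)
      (fun t _ => (hderiv t).differentiableAt.differentiableWithinAt) fun t ht => ?_
    rw [(hderiv t).deriv]
    exact hle t (interior_subset ht)
  have := hanti (Set.left_mem_Icc.2 (ht.trans htR)) ⟨ht, htR⟩ ht
  simp only [hH, hG] at this
  simp at this
  linarith

lemma sum_rotGen_rotGen (x : E3) : ∑ k, rotGen k (rotGen k x) = (-2 : ℝ) • x := by
  ext i
  fin_cases i <;> simp [Fin.sum_univ_three, rotGen_apply] <;> ring

lemma trace_eq_radial_add_rotGen (b : E3 →L[ℝ] E3 →L[ℝ] ℝ) (hb : ∀ x y, b x y = b y x)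
    {ω : E3} (hω : ‖ω‖ = 1) :
    ∑ i, b (EuclideanSpace.single i 1) (EuclideanSpace.single i 1)
      = b ω ω + ∑ k, b (rotGen k ω) (rotGen k ω) := by
  have h1 : ω 0 ^ 2 + ω 1 ^ 2 + ω 2 ^ 2 = 1 := by
    have := EuclideanSpace.norm_sq_eq ω
    rw [hω, Fin.sum_univ_three] at this
    simpa using this.symm
  have h2 : ω = ω 0 • EuclideanSpace.single 0 1 + ω 1 • EuclideanSpace.single 1 1
      + ω 2 • EuclideanSpace.single 2 1 := by
    ext i
    fin_cases i <;> simp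
  have h01 := hb (EuclideanSpace.single 0 1) (EuclideanSpace.single 1 1)
  have h02 := hb (EuclideanSpace.single 0 1) (EuclideanSpace.single 2 1)
  have h12 := hb (EuclideanSpace.single 1 1) (EuclideanSpace.single 2 1)
  have h3 : b ω ω = b (ω 0 • EuclideanSpace.single 0 1 + ω 1 • EuclideanSpace.single 1 1
      + ω 2 • EuclideanSpace.single 2 1) (ω 0 • EuclideanSpace.single 0 1
      + ω 1 • EuclideanSpace.single 1 1 + ω 2 • EuclideanSpace.single 2 1) := by rw [← h2]
  rw [h3]
  simp only [Fin.sum_univ_three, rotGen_apply, map_sub, map_smul, map_add, add_apply,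
    _root_.sub_apply, smul_apply, smul_eq_mul, Fin.isValue, Fin.reduceAdd, zero_add]
  rw [← h01, ← h02, ← h12]
  linear_combination (-(b (EuclideanSpace.single 0 1) (EuclideanSpace.single 0 1)
    + b (EuclideanSpace.single 1 1) (EuclideanSpace.single 1 1)
    + b (EuclideanSpace.single 2 1) (EuclideanSpace.single 2 1))) * h1

/-- Smooth solutions on `[0, ∞) × ℝ³`, written through the full second derivative. -/
structure IsSol (p : ℝ) (Φ : ℝ × E3 → ℝ) : Prop where
  smooth : ContDiff ℝ (⊤ : ℕ∞) Φ
  eq : ∀ t : ℝ, 0 ≤ t → ∀ x : E3, fderiv ℝ (fderiv ℝ Φ) (t, x) (1, 0) (1, 0)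
    - ∑ i, fderiv ℝ (fderiv ℝ Φ) (t, x) (0, EuclideanSpace.single i 1)
        (0, EuclideanSpace.single i 1) + |Φ (t, x)| ^ (p - 1) * Φ (t, x) = 0

/-- The point `(t, rω)`. -/
def pt (z : (ℝ × ℝ) × E3) : ℝ × E3 := (z.1.1, z.1.2 • z.2)

/-- Time derivative at `(t, rω)`. -/
def fT (Φ : ℝ × E3 → ℝ) (z : (ℝ × ℝ) × E3) : ℝ := fderiv ℝ Φ (pt z) (1, 0)

/-- Radial derivative at `(t, rω)`. -/
def fR (Φ : ℝ × E3 → ℝ) (z : (ℝ × ℝ) × E3) : ℝ := fderiv ℝ Φ (pt z) (0, z.2)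

/-- Angular derivatives at `(t, rω)`. -/
def fJ (k : Fin 3) (Φ : ℝ × E3 → ℝ) (z : (ℝ × ℝ) × E3) : ℝ :=
  fderiv ℝ Φ (pt z) (0, rotGen k z.2)

/-- Time derivative of `rφ`. -/
def psiT (Φ : ℝ × E3 → ℝ) (z : (ℝ × ℝ) × E3) : ℝ := z.1.2 * fT Φ z

/-- Radial derivative of `rφ`. -/
def psiR (Φ : ℝ × E3 → ℝ) (z : (ℝ × ℝ) × E3) : ℝ := Φ (pt z) + z.1.2 * fR Φ z

/-- The angular and potential part of the energy density. -/
def pot (p : ℝ) (Φ : ℝ × E3 → ℝ) (z : (ℝ × ℝ) × E3) : ℝ :=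
  z.1.2 ^ 2 * (∑ k, fJ k Φ z ^ 2 / 2 + |Φ (pt z)| ^ (p + 1) / (p + 1))

/-- Energy density of the multiplier with null weights `A`, `B`. -/
def dens (p : ℝ) (A B : ℝ × ℝ → ℝ) (Φ : ℝ × E3 → ℝ) (z : (ℝ × ℝ) × E3) : ℝ :=
  A z.1 * (psiT Φ z + psiR Φ z) ^ 2 / 2 + B z.1 * (psiT Φ z - psiR Φ z) ^ 2 / 2
    + (A z.1 + B z.1) * pot p Φ z

/-- Radial flux of the multiplier with null weights `A`, `B`. -/
def flux (p : ℝ) (A B : ℝ × ℝ → ℝ) (Φ : ℝ × E3 → ℝ) (z : (ℝ × ℝ) × E3) : ℝ :=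
  -(A z.1 * (psiT Φ z + psiR Φ z) ^ 2 / 2) + B z.1 * (psiT Φ z - psiR Φ z) ^ 2 / 2
    + (A z.1 - B z.1) * pot p Φ z

lemma contDiff_pt : ContDiff ℝ 1 pt := by unfold pt; fun_prop

section smoothness
variable {Φ : ℝ × E3 → ℝ} (hΦ : ContDiff ℝ (⊤ : ℕ∞) Φ)
include hΦ

lemma contDiff_fderiv_one : ContDiff ℝ 1 (fderiv ℝ Φ) :=
  hΦ.fderiv_right (m := 1) (WithTop.coe_le_coe.2 (le_top : (1 + 1 : ℕ∞) ≤ ⊤))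

lemma contDiff_comp_pt : ContDiff ℝ 1 fun z => Φ (pt z) :=
  (hΦ.of_le (by exact_mod_cast (le_top : (1 : ℕ∞) ≤ ⊤))).comp contDiff_pt

lemma contDiff_fT : ContDiff ℝ 1 (fT Φ) :=
  ((contDiff_fderiv_one hΦ).comp contDiff_pt).clm_apply contDiff_const

lemma contDiff_fR : ContDiff ℝ 1 (fR Φ) :=
  ((contDiff_fderiv_one hΦ).comp contDiff_pt).clm_apply (by fun_prop)

lemma contDiff_fJ (k : Fin 3) : ContDiff ℝ 1 (fJ k Φ) :=
  ((contDiff_fderiv_one hΦ).comp contDiff_pt).clm_apply (by fun_prop)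

lemma contDiff_psiT : ContDiff ℝ 1 (psiT Φ) := by
  have := contDiff_fT hΦ
  unfold psiT; fun_prop

lemma contDiff_psiR : ContDiff ℝ 1 (psiR Φ) := by
  have := contDiff_fR hΦ
  exact (contDiff_comp_pt hΦ).add (by fun_prop)

lemma contDiff_pot {p : ℝ} (hp : 1 < p) : ContDiff ℝ 1 (pot p Φ) := by
  have h1 := fun k => contDiff_fJ hΦ k
  have h2 := contDiff_comp_pt hΦ
  have h3 : ContDiff ℝ 1 fun z => |Φ (pt z)| ^ (p + 1) :=
    (contDiff_norm_rpow (E := ℝ) (p := p + 1) (by linarith)).comp h2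
  have h4 : ContDiff ℝ 1 fun z => ∑ k, fJ k Φ z ^ 2 / 2 + |Φ (pt z)| ^ (p + 1) / (p + 1) :=
    (by fun_prop : ContDiff ℝ 1 fun z => ∑ k, fJ k Φ z ^ 2 / 2).add (h3.div_const _)
  exact (by fun_prop : ContDiff ℝ 1 fun z : (ℝ × ℝ) × E3 => z.1.2 ^ 2).mul h4

lemma contDiff_dens {p : ℝ} (hp : 1 < p) {A B : ℝ × ℝ → ℝ} (hA : ContDiff ℝ 1 A)
    (hB : ContDiff ℝ 1 B) : ContDiff ℝ 1 (dens p A B Φ) := by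
  have := contDiff_psiT hΦ
  have := contDiff_psiR hΦ
  have := contDiff_pot hΦ hp
  unfold dens; fun_prop

lemma contDiff_flux {p : ℝ} (hp : 1 < p) {A B : ℝ × ℝ → ℝ} (hA : ContDiff ℝ 1 A)
    (hB : ContDiff ℝ 1 B) : ContDiff ℝ 1 (flux p A B Φ) := by
  have := contDiff_psiT hΦ
  have := contDiff_psiR hΦ
  have := contDiff_pot hΦ hp
  unfold flux; fun_prop

lemma hasDerivAt_fderiv_apply {c v : ℝ → ℝ × E3} {c' v' : ℝ × E3} {s : ℝ}
    (hc : HasDerivAt c c' s) (hv : HasDerivAt v v' s) :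
    HasDerivAt (fun s => fderiv ℝ Φ (c s) (v s))
      (fderiv ℝ (fderiv ℝ Φ) (c s) c' (v s) + fderiv ℝ Φ (c s) v') s :=
  ((contDiff_fderiv_one hΦ).hasDerivAt_curve hc).clm_apply hv

end smoothness

lemma multiplier_algebra {p r A B At Ar Bt Br f ft fr Htt Htr Hrr P Q : ℝ}
    {j ht hr h l : Fin 3 → ℝ} (hpde : Htt - (Hrr + ∑ k, h k) + P * f = 0)
    (hl : ∑ k, l k = -2 * fr) (hQ : P * f ^ 2 = (p + 1) * Q) (hQ0 : 0 ≤ Q) (hr0 : 0 < r)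
    (hA : At - Ar ≤ 0) (hB : Bt + Br ≤ 0)
    (h2 : r * (At + Ar + Bt - Br) ≤ 2 * (A - B))
    (hp : r * (At + Ar + Bt - Br) ≤ (p - 1) * (A - B)) :
    (At * (r * ft + (f + r * fr)) ^ 2 / 2
      + A * (r * ft + (f + r * fr)) * (r * Htt + (ft + r * Htr))
      + (Bt * (r * ft - (f + r * fr)) ^ 2 / 2
      + B * (r * ft - (f + r * fr)) * (r * Htt - (ft + r * Htr)))
      + ((At + Bt) * (r ^ 2 * (∑ k, j k ^ 2 / 2 + Q))
      + (A + B) * (r ^ 2 * (∑ k, j k * ht k + P * f * ft))))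
    + (-(Ar * (r * ft + (f + r * fr)) ^ 2 / 2
      + A * (r * ft + (f + r * fr)) * ((ft + r * Htr) + (2 * fr + r * Hrr)))
      + (Br * (r * ft - (f + r * fr)) ^ 2 / 2
      + B * (r * ft - (f + r * fr)) * ((ft + r * Htr) - (2 * fr + r * Hrr)))
      + ((Ar - Br) * (r ^ 2 * (∑ k, j k ^ 2 / 2 + Q))
      + (A - B) * (2 * r * (∑ k, j k ^ 2 / 2 + Q) + r ^ 2 * (∑ k, j k * hr k + P * f * fr))))
    ≤ ∑ k, (((A + B) * (r * (r * ht k)) + (A - B) * (r * j k + r * (r * hr k + j k))) * j k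
      + ((A + B) * (r * ft) + (A - B) * (f + r * fr)) * (r * h k + l k)) := by
  simp only [Fin.sum_univ_three] at *
  have e1 : 0 ≤ -(At - Ar) * (r * ft + (f + r * fr)) ^ 2 := by
    have := neg_nonneg.2 hA; positivity
  have e2 : 0 ≤ -(Bt + Br) * (r * ft - (f + r * fr)) ^ 2 := by
    have := neg_nonneg.2 hB; positivity
  have e3 : 0 ≤ (2 * (A - B) - r * (At + Ar + Bt - Br)) * (r * (j 0 ^ 2 + j 1 ^ 2 + j 2 ^ 2)) := by
    have := sub_nonneg.2 h2; positivity
  have e4 : 0 ≤ ((p - 1) * (A - B) - r * (At + Ar + Bt - Br)) * (r * Q) := by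
    have := sub_nonneg.2 hp; positivity
  rw [← sub_nonneg]
  have key : (∀ a b : ℝ, a = b → 0 ≤ b → 0 ≤ a) := fun a b h h' => h ▸ h'
  refine key _ (-(At - Ar) * (r * ft + (f + r * fr)) ^ 2 / 2
    + -(Bt + Br) * (r * ft - (f + r * fr)) ^ 2 / 2
    + (2 * (A - B) - r * (At + Ar + Bt - Br)) * (r * (j 0 ^ 2 + j 1 ^ 2 + j 2 ^ 2)) / 2
    + ((p - 1) * (A - B) - r * (At + Ar + Bt - Br)) * (r * Q)) ?_ (by linarith)
  linear_combination (-r * ((A + B) * (r * ft) + (A - B) * (f + r * fr))) * hpde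
    + ((A + B) * (r * ft) + (A - B) * (f + r * fr)) * hl + (r * (A - B)) * hQ

section curves
variable {Φ : ℝ × E3 → ℝ} (hΦ : ContDiff ℝ (⊤ : ℕ∞) Φ) (t r : ℝ) (ω : E3)

lemma hasDerivAt_pt_time : HasDerivAt (fun s => pt ((s, r), ω)) (1, 0) t :=
  (hasDerivAt_id t).prodMk (hasDerivAt_const t (r • ω))

lemma hasDerivAt_pt_radius : HasDerivAt (fun s => pt ((t, s), ω)) (0, ω) r := by
  have := (hasDerivAt_const r t).prodMk ((hasDerivAt_id r).smul_const ω)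
  rw [one_smul] at this
  exact this

lemma hasDerivAt_rotGen_curve (k : Fin 3) :
    HasDerivAt (fun s : ℝ => ω + s • rotGen k ω) (rotGen k ω) 0 := by
  have := ((hasDerivAt_id (0 : ℝ)).smul_const (rotGen k ω)).const_add ω
  rw [one_smul] at this
  exact this

lemma hasDerivAt_pt_angle (k : Fin 3) :
    HasDerivAt (fun s : ℝ => pt ((t, r), ω + s • rotGen k ω)) (r • ((0 : ℝ), rotGen k ω)) 0 := by
  have := (hasDerivAt_const (0 : ℝ) t).prodMk ((hasDerivAt_rotGen_curve ω k).const_smul r)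
  rw [Prod.smul_mk, smul_zero]
  exact this

include hΦ

lemma hasDerivAt_phi {c : ℝ → ℝ × E3} {c' : ℝ × E3} {s : ℝ} (hc : HasDerivAt c c' s) :
    HasDerivAt (fun s => Φ (c s)) (fderiv ℝ Φ (c s) c') s :=
  (hΦ.of_le (by exact_mod_cast (le_top : (1 : ℕ∞) ≤ ⊤))).hasDerivAt_curve hc

lemma hasDerivAt_fT_time : HasDerivAt (fun s => fT Φ ((s, r), ω))
    (fderiv ℝ (fderiv ℝ Φ) (pt ((t, r), ω)) (1, 0) (1, 0)) t := by
  have := hasDerivAt_fderiv_apply hΦ (hasDerivAt_pt_time t r ω) (hasDerivAt_const t (1, 0))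
  rw [map_zero, add_zero] at this
  exact this

lemma hasDerivAt_fR_time : HasDerivAt (fun s => fR Φ ((s, r), ω))
    (fderiv ℝ (fderiv ℝ Φ) (pt ((t, r), ω)) (1, 0) (0, ω)) t := by
  have := hasDerivAt_fderiv_apply hΦ (hasDerivAt_pt_time t r ω) (hasDerivAt_const t (0, ω))
  rw [map_zero, add_zero] at this
  exact this

lemma hasDerivAt_fJ_time (k : Fin 3) : HasDerivAt (fun s => fJ k Φ ((s, r), ω))
    (fderiv ℝ (fderiv ℝ Φ) (pt ((t, r), ω)) (1, 0) (0, rotGen k ω)) t := by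
  have := hasDerivAt_fderiv_apply hΦ (hasDerivAt_pt_time t r ω)
    (hasDerivAt_const t (0, rotGen k ω))
  rw [map_zero, add_zero] at this
  exact this

lemma hasDerivAt_fT_radius : HasDerivAt (fun s => fT Φ ((t, s), ω))
    (fderiv ℝ (fderiv ℝ Φ) (pt ((t, r), ω)) (0, ω) (1, 0)) r := by
  have := hasDerivAt_fderiv_apply hΦ (hasDerivAt_pt_radius t r ω) (hasDerivAt_const r (1, 0))
  rw [map_zero, add_zero] at this
  exact this

lemma hasDerivAt_fR_radius : HasDerivAt (fun s => fR Φ ((t, s), ω))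
    (fderiv ℝ (fderiv ℝ Φ) (pt ((t, r), ω)) (0, ω) (0, ω)) r := by
  have := hasDerivAt_fderiv_apply hΦ (hasDerivAt_pt_radius t r ω) (hasDerivAt_const r (0, ω))
  rw [map_zero, add_zero] at this
  exact this

lemma hasDerivAt_fJ_radius (k : Fin 3) : HasDerivAt (fun s => fJ k Φ ((t, s), ω))
    (fderiv ℝ (fderiv ℝ Φ) (pt ((t, r), ω)) (0, ω) (0, rotGen k ω)) r := by
  have := hasDerivAt_fderiv_apply hΦ (hasDerivAt_pt_radius t r ω)
    (hasDerivAt_const r (0, rotGen k ω))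
  rw [map_zero, add_zero] at this
  exact this

lemma hasDerivAt_fT_angle (k : Fin 3) :
    HasDerivAt (fun s : ℝ => fT Φ ((t, r), ω + s • rotGen k ω))
      (r * fderiv ℝ (fderiv ℝ Φ) (pt ((t, r), ω)) (0, rotGen k ω) (1, 0)) 0 := by
  have := hasDerivAt_fderiv_apply hΦ (hasDerivAt_pt_angle t r ω k) (hasDerivAt_const 0 (1, 0))
  simp only [map_smul, smul_apply, zero_smul, add_zero, smul_eq_mul, map_zero] at this
  exact this

lemma hasDerivAt_fR_angle (k : Fin 3) :
    HasDerivAt (fun s : ℝ => fR Φ ((t, r), ω + s • rotGen k ω))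
      (r * fderiv ℝ (fderiv ℝ Φ) (pt ((t, r), ω)) (0, rotGen k ω) (0, ω) + fJ k Φ ((t, r), ω)) 0 := by
  have := hasDerivAt_fderiv_apply hΦ (hasDerivAt_pt_angle t r ω k)
    ((hasDerivAt_const (0 : ℝ) (0 : ℝ)).prodMk (hasDerivAt_rotGen_curve ω k))
  simp only [map_smul, smul_apply, zero_smul, add_zero, smul_eq_mul] at this
  exact this

lemma hasDerivAt_fJ_angle (k : Fin 3) :
    HasDerivAt (fun s : ℝ => fJ k Φ ((t, r), ω + s • rotGen k ω))
      (r * fderiv ℝ (fderiv ℝ Φ) (pt ((t, r), ω)) (0, rotGen k ω) (0, rotGen k ω)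
        + fderiv ℝ Φ (pt ((t, r), ω)) (0, rotGen k (rotGen k ω))) 0 := by
  have h1 : HasDerivAt (fun s : ℝ => rotGen k (ω + s • rotGen k ω)) (rotGen k (rotGen k ω)) 0 :=
    (rotGen k).hasFDerivAt.comp_hasDerivAt (0 : ℝ) (hasDerivAt_rotGen_curve ω k)
  have := hasDerivAt_fderiv_apply hΦ (hasDerivAt_pt_angle t r ω k)
    ((hasDerivAt_const (0 : ℝ) (0 : ℝ)).prodMk h1)
  simp only [map_smul, smul_apply, zero_smul, add_zero, smul_eq_mul] at this
  exact this

end curves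

/-- The angular flux of the multiplier. -/
def angFlux (k : Fin 3) (A B : ℝ × ℝ → ℝ) (Φ : ℝ × E3 → ℝ) (z : (ℝ × ℝ) × E3) : ℝ :=
  ((A z.1 + B z.1) * psiT Φ z + (A z.1 - B z.1) * psiR Φ z) * fJ k Φ z

lemma hasDerivAt_abs_rpow_div {p : ℝ} (hp : 1 < p) {f : ℝ → ℝ} {f' s : ℝ} (hf : HasDerivAt f f' s) :
    HasDerivAt (fun s => |f s| ^ (p + 1) / (p + 1)) (|f s| ^ (p - 1) * f s * f') s := by
  have h := ((hasDerivAt_abs_rpow (f s) (by linarith : 1 < p + 1)).comp s hf).div_const (p + 1)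
  have h0 : p + 1 ≠ 0 := by linarith
  have h1 : (p + 1) * |f s| ^ (p + 1 - 2) * f s * f' / (p + 1) = |f s| ^ (p - 1) * f s * f' := by
    rw [show p + 1 - 2 = p - 1 by ring]
    field_simp
  rw [← h1]
  exact h

lemma abs_rpow_mul_sq {p : ℝ} (hp : 1 < p) (x : ℝ) : |x| ^ (p - 1) * x ^ 2 = |x| ^ (p + 1) := by
  rw [← sq_abs, ← rpow_natCast, ← rpow_add_of_nonneg (abs_nonneg x) (by linarith) (by norm_num)]
  congr 1; push_cast; ring

theorem multiplier_pointwise {p : ℝ} (hp : 1 < p) {Φ : ℝ × E3 → ℝ} (hΦ : IsSol p Φ)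
    {A B : ℝ × ℝ → ℝ} (hA : ContDiff ℝ 1 A) (hB : ContDiff ℝ 1 B) {t r : ℝ} (ht : 0 ≤ t)
    (hr : 0 < r) (hA1 : fderiv ℝ A (t, r) (1, 0) - fderiv ℝ A (t, r) (0, 1) ≤ 0)
    (hB1 : fderiv ℝ B (t, r) (1, 0) + fderiv ℝ B (t, r) (0, 1) ≤ 0)
    (h2 : r * (fderiv ℝ A (t, r) (1, 0) + fderiv ℝ A (t, r) (0, 1) + fderiv ℝ B (t, r) (1, 0)
      - fderiv ℝ B (t, r) (0, 1)) ≤ 2 * (A (t, r) - B (t, r)))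
    (h3 : r * (fderiv ℝ A (t, r) (1, 0) + fderiv ℝ A (t, r) (0, 1) + fderiv ℝ B (t, r) (1, 0)
      - fderiv ℝ B (t, r) (0, 1)) ≤ (p - 1) * (A (t, r) - B (t, r)))
    {ω : E3} (hω : ‖ω‖ = 1) :
    fderiv ℝ (dens p A B Φ) ((t, r), ω) ((1, 0), 0) + fderiv ℝ (flux p A B Φ) ((t, r), ω) ((0, 1), 0)
      ≤ ∑ k, fderiv ℝ (fun ω => angFlux k A B Φ ((t, r), ω)) ω (rotGen k ω) := by
  have hs := hΦ.smooth
  have hsymm : ∀ v w, fderiv ℝ (fderiv ℝ Φ) (pt ((t, r), ω)) v w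
      = fderiv ℝ (fderiv ℝ Φ) (pt ((t, r), ω)) w v := fun v w =>
    (hs.contDiffAt.isSymmSndFDerivAt (by
      simp only [minSmoothness_of_isRCLikeNormedField]
      exact WithTop.coe_le_coe.2 (le_top : (2 : ℕ∞) ≤ ⊤))) v w
  -- derivative in time
  have hct : HasDerivAt (fun s : ℝ => ((s, r), ω)) (((1 : ℝ), (0 : ℝ)), (0 : E3)) t :=
    ((hasDerivAt_id t).prodMk (hasDerivAt_const t r)).prodMk (hasDerivAt_const t ω)
  have hct' : HasDerivAt (fun s : ℝ => (s, r)) ((1 : ℝ), (0 : ℝ)) t :=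
    ((hasDerivAt_id t).prodMk (hasDerivAt_const t r))
  have hft := hasDerivAt_phi hs (hasDerivAt_pt_time t r ω)
  have hTt : HasDerivAt (fun s => psiT Φ ((s, r), ω)) _ t :=
    (hasDerivAt_fT_time hs t r ω).const_mul r
  have hRt : HasDerivAt (fun s => psiR Φ ((s, r), ω)) _ t :=
    hft.fun_add ((hasDerivAt_fR_time hs t r ω).const_mul r)
  have hPt : HasDerivAt (fun s => pot p Φ ((s, r), ω)) _ t :=
    ((HasDerivAt.fun_sum fun k _ => ((hasDerivAt_fJ_time hs t r ω k).fun_pow 2).div_const 2).fun_add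
      (hasDerivAt_abs_rpow_div hp hft)).const_mul (r ^ 2)
  have hAt := hA.hasDerivAt_curve hct'
  have hBt := hB.hasDerivAt_curve hct'
  have hdt : HasDerivAt (fun s => dens p A B Φ ((s, r), ω)) _ t :=
    (((hAt.fun_mul ((hTt.fun_add hRt).fun_pow 2)).div_const 2).fun_add
      ((hBt.fun_mul ((hTt.fun_sub hRt).fun_pow 2)).div_const 2)).fun_add ((hAt.fun_add hBt).fun_mul hPt)
  have e1 := ((contDiff_dens hs hp hA hB).hasDerivAt_curve hct).unique hdt
  -- derivative in radius
  have hcr : HasDerivAt (fun s : ℝ => ((t, s), ω)) (((0 : ℝ), (1 : ℝ)), (0 : E3)) r :=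
    ((hasDerivAt_const r t).prodMk (hasDerivAt_id r)).prodMk (hasDerivAt_const r ω)
  have hcr' : HasDerivAt (fun s : ℝ => (t, s)) ((0 : ℝ), (1 : ℝ)) r :=
    ((hasDerivAt_const r t).prodMk (hasDerivAt_id r))
  have hfr := hasDerivAt_phi hs (hasDerivAt_pt_radius t r ω)
  have hTr : HasDerivAt (fun s => psiT Φ ((t, s), ω)) _ r :=
    (hasDerivAt_id r).fun_mul (hasDerivAt_fT_radius hs t r ω)
  have hRr : HasDerivAt (fun s => psiR Φ ((t, s), ω)) _ r :=
    hfr.fun_add ((hasDerivAt_id r).fun_mul (hasDerivAt_fR_radius hs t r ω))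
  have hPr : HasDerivAt (fun s => pot p Φ ((t, s), ω)) _ r :=
    ((hasDerivAt_id r).fun_pow 2).fun_mul
    ((HasDerivAt.fun_sum fun k _ => ((hasDerivAt_fJ_radius hs t r ω k).fun_pow 2).div_const 2).fun_add
      (hasDerivAt_abs_rpow_div hp hfr))
  have hAr := hA.hasDerivAt_curve hcr'
  have hBr := hB.hasDerivAt_curve hcr'
  have hdr : HasDerivAt (fun s => flux p A B Φ ((t, s), ω)) _ r :=
    (((hAr.fun_mul ((hTr.fun_add hRr).fun_pow 2)).div_const 2).fun_neg.fun_add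
      ((hBr.fun_mul ((hTr.fun_sub hRr).fun_pow 2)).div_const 2)).fun_add ((hAr.fun_sub hBr).fun_mul hPr)
  have e2 := ((contDiff_flux hs hp hA hB).hasDerivAt_curve hcr).unique hdr
  -- angular derivatives
  have e3 : ∀ k, fderiv ℝ (fun ω => angFlux k A B Φ ((t, r), ω)) ω (rotGen k ω)
      = ((A (t, r) + B (t, r)) * (r * (r * fderiv ℝ (fderiv ℝ Φ) (pt ((t, r), ω)) (1, 0) (0, rotGen k ω)))
        + (A (t, r) - B (t, r)) * (r * fJ k Φ ((t, r), ω)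
          + r * (r * fderiv ℝ (fderiv ℝ Φ) (pt ((t, r), ω)) (0, ω) (0, rotGen k ω) + fJ k Φ ((t, r), ω))))
          * fJ k Φ ((t, r), ω)
        + ((A (t, r) + B (t, r)) * (r * fT Φ ((t, r), ω))
          + (A (t, r) - B (t, r)) * (Φ (pt ((t, r), ω)) + r * fR Φ ((t, r), ω)))
        * (r * fderiv ℝ (fderiv ℝ Φ) (pt ((t, r), ω)) (0, rotGen k ω) (0, rotGen k ω)
        + fderiv ℝ Φ (pt ((t, r), ω)) (0, rotGen k (rotGen k ω))) := by
    intro k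
    have hg : ContDiff ℝ 1 (fun ω => angFlux k A B Φ ((t, r), ω)) := by
      have h1 := contDiff_psiT hs
      have h2 := contDiff_psiR hs
      have h3 := contDiff_fJ hs k
      unfold angFlux
      fun_prop
    have hc0 : (fun s : ℝ => ω + s • rotGen k ω) 0 = ω := by simp
    have hfa := hasDerivAt_phi hs (hasDerivAt_pt_angle t r ω k)
    have hTa : HasDerivAt (fun s : ℝ => psiT Φ ((t, r), ω + s • rotGen k ω)) _ 0 :=
      (hasDerivAt_fT_angle hs t r ω k).const_mul r
    have hRa : HasDerivAt (fun s : ℝ => psiR Φ ((t, r), ω + s • rotGen k ω)) _ 0 :=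
      hfa.fun_add ((hasDerivAt_fR_angle hs t r ω k).const_mul r)
    have hga : HasDerivAt (fun s : ℝ => angFlux k A B Φ ((t, r), ω + s • rotGen k ω)) _ 0 :=
      ((hTa.const_mul (A (t, r) + B (t, r))).fun_add (hRa.const_mul (A (t, r) - B (t, r)))).fun_mul
        (hasDerivAt_fJ_angle hs t r ω k)
    have h1 := (hg.hasDerivAt_curve (hasDerivAt_rotGen_curve ω k)).unique hga
    simp only [zero_smul, add_zero, map_smul, smul_eq_mul] at h1
    rw [h1, hsymm (0, rotGen k ω) (1, 0), hsymm (0, rotGen k ω) (0, ω)]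
    simp only [psiT, psiR, fJ]
  -- the equation
  have hpde := hΦ.eq t ht (r • ω)
  have htr := trace_eq_radial_add_rotGen
    ((ContinuousLinearMap.compL ℝ E3 (ℝ × E3) ℝ).flip (ContinuousLinearMap.inr ℝ ℝ E3) ∘L
      ((fderiv ℝ (fderiv ℝ Φ) (pt ((t, r), ω))) ∘L ContinuousLinearMap.inr ℝ ℝ E3))
    (fun x y => by simpa using hsymm (0, x) (0, y)) hω
  simp only [ContinuousLinearMap.comp_apply, ContinuousLinearMap.flip_apply,
    ContinuousLinearMap.compL_apply, ContinuousLinearMap.inr_apply] at htr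
  have hpt : pt ((t, r), ω) = (t, r • ω) := rfl
  rw [← hpt, htr] at hpde
  have hl : ∑ k, fderiv ℝ Φ (pt ((t, r), ω)) (0, rotGen k (rotGen k ω)) = -2 * fR Φ ((t, r), ω) := by
    have h1 : ∑ k, ((0 : ℝ), rotGen k (rotGen k ω)) = (-2 : ℝ) • ((0 : ℝ), ω) := by
      rw [Prod.smul_mk, ← sum_rotGen_rotGen, smul_zero]
      exact (map_sum (ContinuousLinearMap.inr ℝ ℝ E3) (fun k => rotGen k (rotGen k ω)) _).symm
    rw [← map_sum, h1, map_smul]; rfl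
  have hQ : |Φ (pt ((t, r), ω))| ^ (p - 1) * Φ (pt ((t, r), ω)) ^ 2
      = (p + 1) * (|Φ (pt ((t, r), ω))| ^ (p + 1) / (p + 1)) := by
    rw [abs_rpow_mul_sq hp, mul_div_cancel₀ _ (by linarith)]
  have := multiplier_algebra (p := p) (A := A (t, r)) (B := B (t, r))
    (j := fun k => fJ k Φ ((t, r), ω)) (ft := fT Φ ((t, r), ω)) (fr := fR Φ ((t, r), ω))
    (Htr := fderiv ℝ (fderiv ℝ Φ) (pt ((t, r), ω)) (1, 0) (0, ω))
    (ht := fun k => fderiv ℝ (fderiv ℝ Φ) (pt ((t, r), ω)) (1, 0) (0, rotGen k ω))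
    (hr := fun k => fderiv ℝ (fderiv ℝ Φ) (pt ((t, r), ω)) (0, ω) (0, rotGen k ω))
    hpde hl hQ (by positivity) hr hA1 hB1 h2 h3
  simp only [e3]
  refine le_trans (le_of_eq ?_) this
  rw [e1, e2, hsymm (0, ω) (1, 0)]
  simp only [Fin.sum_univ_three, psiT, psiR, pot, id]
  simp only [fT, fR, fJ, Nat.add_one_sub_one, pow_one, Nat.cast_ofNat]
  ring

theorem multiplier_triangle {p : ℝ} (hp : 1 < p) {Φ : ℝ × E3 → ℝ} (hΦ : IsSol p Φ)
    {A B : ℝ × ℝ → ℝ} (hA : ContDiff ℝ 1 A) (hB : ContDiff ℝ 1 B)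
    (hA1 : ∀ t r : ℝ, 0 ≤ t → 0 < r → fderiv ℝ A (t, r) (1, 0) - fderiv ℝ A (t, r) (0, 1) ≤ 0)
    (hB1 : ∀ t r : ℝ, 0 ≤ t → 0 < r → fderiv ℝ B (t, r) (1, 0) + fderiv ℝ B (t, r) (0, 1) ≤ 0)
    (h2 : ∀ t r : ℝ, 0 ≤ t → 0 < r → r * (fderiv ℝ A (t, r) (1, 0) + fderiv ℝ A (t, r) (0, 1)
      + fderiv ℝ B (t, r) (1, 0) - fderiv ℝ B (t, r) (0, 1)) ≤ 2 * (A (t, r) - B (t, r)))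
    (h3 : ∀ t r : ℝ, 0 ≤ t → 0 < r → r * (fderiv ℝ A (t, r) (1, 0) + fderiv ℝ A (t, r) (0, 1)
      + fderiv ℝ B (t, r) (1, 0) - fderiv ℝ B (t, r) (0, 1)) ≤ (p - 1) * (A (t, r) - B (t, r)))
    (hBA : ∀ t : ℝ, 0 ≤ t → B (t, 0) ≤ A (t, 0)) {R t₁ : ℝ} (ht : 0 ≤ t₁) (htR : t₁ ≤ R) :
    shell 0 t₁ (fun z => dens p A B Φ ((z.1, R - z.1), z.2) + flux p A B Φ ((z.1, R - z.1), z.2))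
      + shell 0 (R - t₁) (fun z => dens p A B Φ ((t₁, z.1), z.2))
      ≤ shell 0 R (fun z => dens p A B Φ ((0, z.1), z.2)) := by
  have hd := contDiff_dens hΦ.smooth hp hA hB
  have hf := contDiff_flux hΦ.smooth hp hA hB
  have hdc := hd.continuous
  have hfc := hf.continuous
  have key := integral_triangle_le (contDiff_integral_sig hd) (contDiff_integral_sig hf)
    (fun t r ht hr => ?_) (fun t ht => ?_) ht htR
  · unfold shell
    convert key using 4
    rw [← integral_add (Continuous.integrable_sig (by fun_prop)) (Continuous.integrable_sig (by fun_prop))]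
  · rw [fderiv_integral_sig hd, fderiv_integral_sig hf]
    have hd' : Continuous fun ω => fderiv ℝ (dens p A B Φ) ((t, r), ω) ((1, 0), 0) := by
      have := hd.continuous_fderiv (by norm_num)
      fun_prop
    have hf' : Continuous fun ω => fderiv ℝ (flux p A B Φ) ((t, r), ω) ((0, 1), 0) := by
      have := hf.continuous_fderiv (by norm_num)
      fun_prop
    have hg : ∀ k, ContDiff ℝ 1 (fun ω => angFlux k A B Φ ((t, r), ω)) := by
      intro k
      have h1 := contDiff_psiT hΦ.smooth
      have h2 := contDiff_psiR hΦ.smooth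
      have h3 := contDiff_fJ hΦ.smooth k
      unfold angFlux
      fun_prop
    have hg' : ∀ k, Continuous fun ω =>
        fderiv ℝ (fun ω => angFlux k A B Φ ((t, r), ω)) ω (rotGen k ω) := fun k =>
      ((hg k).continuous_fderiv (by norm_num)).clm_apply (rotGen k).continuous
    rw [← integral_add hd'.integrable_sig hf'.integrable_sig]
    calc _ ≤ ∫ ω, ∑ k, fderiv ℝ (fun ω => angFlux k A B Φ ((t, r), ω)) ω (rotGen k ω) ∂sig :=
          integral_sig_mono (hd'.add hf') (continuous_finsetSum _ fun k _ => hg' k) fun ω hω =>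
            multiplier_pointwise hp hΦ hA hB ht hr (hA1 t r ht hr) (hB1 t r ht hr) (h2 t r ht hr)
              (h3 t r ht hr) hω
      _ = 0 := by
        rw [integral_finsetSum _ fun k _ => (hg' k).integrable_sig]
        exact Finset.sum_eq_zero fun k _ => integral_fderiv_rotGen (hg k) k
  · rw [← neg_nonneg, ← integral_neg]
    refine integral_sig_nonneg fun ω _ => ?_
    have := mul_nonneg (sub_nonneg.2 (hBA t ht)) (sq_nonneg (Φ (pt ((t, 0), ω))))
    simp only [flux, psiT, psiR, pot]
    nlinarith

lemma dens_add_flux (p : ℝ) (A B : ℝ × ℝ → ℝ) (Φ : ℝ × E3 → ℝ) (z : (ℝ × ℝ) × E3) :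
    dens p A B Φ z + flux p A B Φ z = B z.1 * (psiT Φ z - psiR Φ z) ^ 2 + 2 * A z.1 * pot p Φ z := by
  unfold dens flux; ring

lemma pot_nonneg {p : ℝ} (hp : 1 < p) (Φ : ℝ × E3 → ℝ) (z : (ℝ × ℝ) × E3) : 0 ≤ pot p Φ z := by
  unfold pot
  have : 0 ≤ ∑ k, fJ k Φ z ^ 2 / 2 := Finset.sum_nonneg fun k _ => by positivity
  have : 0 ≤ |Φ (pt z)| ^ (p + 1) / (p + 1) := div_nonneg (by positivity) (by linarith)
  positivity

/-- The backward cone flux is controlled by the initial energy. -/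
theorem cone_flux_le {p : ℝ} (hp : 1 < p) {Φ : ℝ × E3 → ℝ} (hΦ : IsSol p Φ) {T : ℝ} (hT : 0 ≤ T) :
    2 * shell 0 T (fun z => pot p Φ ((z.1, T - z.1), z.2))
      ≤ shell 0 T (fun z => dens p (fun _ => 1) (fun _ => 1) Φ ((0, z.1), z.2)) := by
  have h := multiplier_triangle hp hΦ (A := fun _ => 1) (B := fun _ => 1) contDiff_const
    contDiff_const (by simp) (by simp) (by simp) (by simp) (by simp) hT le_rfl
  have hps : Continuous (pot p Φ) := (contDiff_pot hΦ.smooth hp).continuous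
  have h1 : Continuous (psiT Φ) := (contDiff_psiT hΦ.smooth).continuous
  have h2 : Continuous (psiR Φ) := (contDiff_psiR hΦ.smooth).continuous
  rw [sub_self, show shell 0 0 (fun z => dens p (fun _ => 1) (fun _ => 1) Φ ((T, z.1), z.2)) = 0 by
    simp [shell], add_zero] at h
  refine le_trans ?_ h
  simp only [dens_add_flux]
  rw [← shell_const_mul]
  refine shell_mono hT (by fun_prop) (by fun_prop) fun r _ ω _ => ?_
  dsimp only
  nlinarith [sq_nonneg (psiT Φ ((r, T - r), ω) - psiR Φ ((r, T - r), ω))]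

/-- The optical weight `√(1 + (t - r)²)`. -/
def wt0 (z : ℝ × ℝ) : ℝ := √(1 + (z.1 - z.2) ^ 2)

lemma one_le_wt0 (z : ℝ × ℝ) : 1 ≤ wt0 z := by
  unfold wt0
  rw [Real.one_le_sqrt]
  nlinarith [sq_nonneg (z.1 - z.2)]

lemma abs_le_wt0 (z : ℝ × ℝ) : |z.1 - z.2| ≤ wt0 z := by
  unfold wt0
  exact abs_le_sqrt (by linarith)

lemma contDiff_wt0 : ContDiff ℝ 1 wt0 := by
  unfold wt0
  exact ContDiff.sqrt (by fun_prop) fun z => by positivity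

lemma hasDerivAt_wt0 {a b : ℝ → ℝ} {a' b' s : ℝ} (ha : HasDerivAt a a' s) (hb : HasDerivAt b b' s) :
    HasDerivAt (fun s => wt0 (a s, b s)) ((a s - b s) / wt0 (a s, b s) * (a' - b')) s := by
  have h := (((ha.fun_sub hb).fun_pow 2).const_add 1).sqrt
    (by have := sq_nonneg (a s - b s); positivity)
  unfold wt0
  convert h using 1
  dsimp only
  field_simp
  ring

/-- The weight for the outgoing derivative. -/
def wtA (γ : ℝ) (z : ℝ × ℝ) : ℝ := (2 * z.2 + wt0 z) ^ γ

/-- The weight for the incoming derivative. -/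
def wtB (c γ : ℝ) (z : ℝ × ℝ) : ℝ := c * wt0 z ^ γ

lemma contDiff_wtA {γ : ℝ} (hγ : 1 ≤ γ) : ContDiff ℝ 1 (wtA γ) := by
  have := contDiff_wt0
  exact (contDiff_rpow_const_of_le (n := 1) (by exact_mod_cast hγ)).comp (by fun_prop)

lemma contDiff_wtB (c : ℝ) {γ : ℝ} (hγ : 1 ≤ γ) : ContDiff ℝ 1 (wtB c γ) :=
  contDiff_const.mul ((contDiff_rpow_const_of_le (n := 1) (by exact_mod_cast hγ)).comp contDiff_wt0)

lemma fderiv_wtA {γ : ℝ} (hγ : 1 ≤ γ) (t r a b : ℝ) : fderiv ℝ (wtA γ) (t, r) (a, b)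
    = (2 * b + (t - r) / wt0 (t, r) * (a - b)) * γ * (2 * r + wt0 (t, r)) ^ (γ - 1) := by
  have ha : HasDerivAt (fun s : ℝ => t + s * a) a 0 := by
    simpa using ((hasDerivAt_id (0 : ℝ)).mul_const a).const_add t
  have hb : HasDerivAt (fun s : ℝ => r + s * b) b 0 := by
    simpa using ((hasDerivAt_id (0 : ℝ)).mul_const b).const_add r
  have h1 := (contDiff_wtA hγ).hasDerivAt_curve (ha.prodMk hb)
  have h2 := ((hb.const_mul 2).fun_add (hasDerivAt_wt0 ha hb)).rpow_const (p := γ) (Or.inr hγ)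
  have := h1.unique h2
  simpa using this

lemma fderiv_wtB (c : ℝ) {γ : ℝ} (hγ : 1 ≤ γ) (t r a b : ℝ) : fderiv ℝ (wtB c γ) (t, r) (a, b)
    = c * ((t - r) / wt0 (t, r) * (a - b) * γ * wt0 (t, r) ^ (γ - 1)) := by
  have ha : HasDerivAt (fun s : ℝ => t + s * a) a 0 := by
    simpa using ((hasDerivAt_id (0 : ℝ)).mul_const a).const_add t
  have hb : HasDerivAt (fun s : ℝ => r + s * b) b 0 := by
    simpa using ((hasDerivAt_id (0 : ℝ)).mul_const b).const_add r
  have h1 := (contDiff_wtB c hγ).hasDerivAt_curve (ha.prodMk hb)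
  have h2 := ((hasDerivAt_wt0 ha hb).rpow_const (p := γ) (Or.inr hγ)).const_mul c
  have := h1.unique h2
  simpa using this

lemma weights_bulk {c γ a : ℝ} (hγ : 1 ≤ γ) (hc : 0 ≤ c) (hc1 : c ≤ 1) (ha : γ * (1 + c) ≤ a)
    (t : ℝ) {r : ℝ} (hr : 0 < r) :
    r * (fderiv ℝ (wtA γ) (t, r) (1, 0) + fderiv ℝ (wtA γ) (t, r) (0, 1)
      + fderiv ℝ (wtB c γ) (t, r) (1, 0) - fderiv ℝ (wtB c γ) (t, r) (0, 1))
      ≤ a * (wtA γ (t, r) - wtB c γ (t, r)) := by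
  rw [fderiv_wtA hγ, fderiv_wtA hγ, fderiv_wtB c hγ, fderiv_wtB c hγ]
  unfold wtA wtB
  have hw := one_le_wt0 (t, r)
  set w := wt0 (t, r) with hwd
  have hu : (t - r) / w ≤ 1 := by
    rw [div_le_one (by linarith)]
    exact (le_abs_self _).trans (abs_le_wt0 (t, r))
  set u := (t - r) / w
  have hW : w ≤ 2 * r + w := by linarith
  set W := 2 * r + w with hWd
  have e1 : W ^ γ = W * W ^ (γ - 1) := by
    rw [← rpow_one_add' (by linarith) (by linarith)]; congr 1; ring
  have e2 : w ^ γ = w * w ^ (γ - 1) := by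
    rw [← rpow_one_add' (by linarith) (by linarith)]; congr 1; ring
  have e3 : w ^ (γ - 1) ≤ W ^ (γ - 1) := rpow_le_rpow (by linarith) hW (by linarith)
  have e4 : 0 < w ^ (γ - 1) := rpow_pos_of_pos (by linarith) _
  have e5 : w ^ γ ≤ W ^ γ := rpow_le_rpow (by linarith) hW (by linarith)
  have e6 : 0 < w ^ γ := rpow_pos_of_pos (by linarith) _
  set X := W ^ (γ - 1)
  set x := w ^ (γ - 1)
  have hrr : r = (W - w) / 2 := by linarith
  -- first replace `u` by `1`
  have f1 : r * ((2 * 0 + u * (1 - 0)) * γ * X + (2 * 1 + u * (0 - 1)) * γ * X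
      + c * (u * (1 - 0) * γ * x) - c * (u * (0 - 1) * γ * x)) ≤ γ * (W - w) * (X + c * x) := by
    have : 0 ≤ (1 - u) * (r * γ * c * x) := mul_nonneg (by linarith) (by positivity)
    rw [hrr] at this ⊢
    nlinarith
  have f2 : γ * (W - w) * (X + c * x) ≤ γ * ((1 + c) * (W ^ γ - w ^ γ)) := by
    rw [e1, e2, mul_assoc]
    refine mul_le_mul_of_nonneg_left ?_ (by linarith)
    have g1 : 0 ≤ c * W * (X - x) := by
      have : 0 ≤ X - x := by linarith
      have : 0 ≤ W := by linarith
      positivity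
    have g2 : 0 ≤ w * (X - x) := mul_nonneg (by linarith) (by linarith)
    nlinarith
  have f3 : γ * ((1 + c) * (W ^ γ - w ^ γ)) ≤ a * (W ^ γ - c * w ^ γ) := by
    have g1 : (γ * (1 + c)) * (W ^ γ - w ^ γ) ≤ a * (W ^ γ - w ^ γ) :=
      mul_le_mul_of_nonneg_right ha (by linarith)
    have ha0 : 0 ≤ a := by nlinarith
    have g2 : 0 ≤ a * ((1 - c) * w ^ γ) := mul_nonneg ha0 (mul_nonneg (by linarith) e6.le)
    nlinarith
  linarith

/-- Decay consequences of the weighted energy inequality. -/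
theorem weighted_decay {p γ c K : ℝ} (hp : 1 < p) (hγ : 1 ≤ γ) (hc : 0 < c) (hc1 : c ≤ 1)
    (h2 : γ * (1 + c) ≤ 2) (h3 : γ * (1 + c) ≤ p - 1) {Φ : ℝ × E3 → ℝ} (hΦ : IsSol p Φ)
    (hK : ∀ R, 0 ≤ R → shell 0 R (fun z => dens p (wtA γ) (wtB c γ) Φ ((0, z.1), z.2)) ≤ K)
    {t : ℝ} (ht : 0 ≤ t) :
    (∀ R, 0 ≤ R → ((1 + t) / 2) ^ γ * shell 0 R (fun z => pot p Φ ((t, z.1), z.2)) ≤ K) ∧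
    (∀ R, 0 ≤ R → c * shell 0 R (fun z => psiR Φ ((t, z.1), z.2) ^ 2) ≤ K) ∧
    c * ((1 + t) / 4) ^ γ * shell 0 ((1 + t) / 4) (fun z => psiR Φ ((t, z.1), z.2) ^ 2) ≤ K := by
  have hps : Continuous (pot p Φ) := (contDiff_pot hΦ.smooth hp).continuous
  have h1c : Continuous (psiT Φ) := (contDiff_psiT hΦ.smooth).continuous
  have h2c : Continuous (psiR Φ) := (contDiff_psiR hΦ.smooth).continuous
  have hwA := (contDiff_wtA hγ).continuous
  have hwB := (contDiff_wtB c hγ).continuous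
  have hdc := (contDiff_dens hΦ.smooth hp (contDiff_wtA hγ) (contDiff_wtB c hγ)).continuous
  have hfc := (contDiff_flux hΦ.smooth hp (contDiff_wtA hγ) (contDiff_wtB c hγ)).continuous
  have hBA : ∀ r : ℝ, 0 ≤ r → wtB c γ (t, r) ≤ wtA γ (t, r) := by
    intro r hr
    have h0 := one_le_wt0 (t, r)
    unfold wtA wtB
    calc c * wt0 (t, r) ^ γ ≤ 1 * wt0 (t, r) ^ γ :=
          mul_le_mul_of_nonneg_right hc1 (rpow_nonneg (by linarith) _)
      _ ≤ (2 * r + wt0 (t, r)) ^ γ := by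
          rw [one_mul]; exact rpow_le_rpow (by linarith) (by linarith) (by linarith)
  have hB0 : ∀ z, 0 ≤ wtB c γ z := fun z =>
    mul_nonneg hc.le (rpow_nonneg (by have := one_le_wt0 z; linarith) _)
  have main : ∀ R, 0 ≤ R → shell 0 R (fun z => dens p (wtA γ) (wtB c γ) Φ ((t, z.1), z.2)) ≤ K := by
    intro R hR
    have h := multiplier_triangle hp hΦ (contDiff_wtA hγ) (contDiff_wtB c hγ)
      (fun t r _ _ => ?_) (fun t r _ _ => ?_)
      (fun t r _ hr => weights_bulk hγ hc.le hc1 h2 t hr)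
      (fun t r _ hr => weights_bulk hγ hc.le hc1 h3 t hr) (fun s hs => ?_) (R := R + t) ht (by linarith)
    · rw [add_sub_cancel_right] at h
      have hpos : 0 ≤ shell 0 t (fun z => dens p (wtA γ) (wtB c γ) Φ ((z.1, R + t - z.1), z.2)
          + flux p (wtA γ) (wtB c γ) Φ ((z.1, R + t - z.1), z.2)) := by
        refine shell_nonneg ht fun r hr ω _ => ?_
        dsimp only
        rw [dens_add_flux]
        have := pot_nonneg hp Φ ((r, R + t - r), ω)
        have := hB0 (r, R + t - r)
        have : 0 ≤ wtA γ (r, R + t - r) := by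
          have := one_le_wt0 (r, R + t - r)
          have := hr.2
          exact rpow_nonneg (by simp only; linarith) _
        positivity
      linarith [hK (R + t) (by linarith)]
    · rw [fderiv_wtA hγ, fderiv_wtA hγ, ← sub_mul, ← sub_mul]
      have hw := one_le_wt0 (t, r)
      have hu : (t - r) / wt0 (t, r) ≤ 1 := by
        rw [div_le_one (by linarith)]
        exact (le_abs_self _).trans (abs_le_wt0 (t, r))
      exact mul_nonpos_of_nonpos_of_nonneg (mul_nonpos_of_nonpos_of_nonneg (by linarith)
        (by linarith)) (rpow_nonneg (by linarith) _)
    · rw [fderiv_wtB c hγ, fderiv_wtB c hγ]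
      apply le_of_eq; ring
    · have h0 := one_le_wt0 (s, 0)
      unfold wtA wtB
      simp only [mul_zero, zero_add]
      nlinarith [rpow_nonneg (by linarith : 0 ≤ wt0 (s, 0)) γ]
  have hlow : ∀ (m : ℝ) (R : ℝ), 0 ≤ R → (∀ r ∈ Set.Icc 0 R, m ≤ wtB c γ (t, r)) →
      m * shell 0 R (fun z => psiR Φ ((t, z.1), z.2) ^ 2) ≤ K := by
    intro m R hR hm
    refine le_trans ?_ (main R hR)
    rw [← shell_const_mul]
    refine shell_mono hR (by fun_prop) (by fun_prop) fun r hr ω _ => ?_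
    have hm' := hm r hr
    have hA' := hBA r hr.1
    have hp0 := pot_nonneg hp Φ ((t, r), ω)
    have hB' := hB0 (t, r)
    simp only [dens]
    have g1 : 0 ≤ (wtA γ (t, r) - wtB c γ (t, r)) * (psiT Φ ((t, r), ω) + psiR Φ ((t, r), ω)) ^ 2 :=
      mul_nonneg (by linarith) (sq_nonneg _)
    have g2 : 0 ≤ (wtB c γ (t, r) - m) * psiR Φ ((t, r), ω) ^ 2 := mul_nonneg (by linarith) (sq_nonneg _)
    have g3 : 0 ≤ wtB c γ (t, r) * psiT Φ ((t, r), ω) ^ 2 := by positivity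
    have g4 : 0 ≤ (wtA γ (t, r) + wtB c γ (t, r)) * pot p Φ ((t, r), ω) :=
      mul_nonneg (by linarith) hp0
    nlinarith
  refine ⟨fun R hR => ?_, fun R hR => hlow c R hR fun r _ => ?_,
    hlow _ _ (by positivity) fun r hr => ?_⟩
  · refine le_trans ?_ (main R hR)
    rw [← shell_const_mul]
    refine shell_mono hR (by fun_prop) (by fun_prop) fun r hr ω _ => ?_
    have hp0 := pot_nonneg hp Φ ((t, r), ω)
    have hB' := hB0 (t, r)
    have hA' := hBA r hr.1
    have h0 := one_le_wt0 (t, r)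
    have h0' := abs_le_wt0 (t, r)
    have h4 := le_abs_self (t - r)
    have hr0 := hr.1
    simp only at h0'
    have hA2 : ((1 + t) / 2) ^ γ ≤ wtA γ (t, r) :=
      rpow_le_rpow (by positivity) (by simp only; linarith) (by linarith)
    simp only [dens]
    have hA0 : 0 ≤ wtA γ (t, r) := hB'.trans hA'
    have g1 : 0 ≤ wtA γ (t, r) * (psiT Φ ((t, r), ω) + psiR Φ ((t, r), ω)) ^ 2 / 2 := by positivity
    have g2 : 0 ≤ wtB c γ (t, r) * (psiT Φ ((t, r), ω) - psiR Φ ((t, r), ω)) ^ 2 / 2 := by positivity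
    nlinarith
  · have := one_le_rpow (one_le_wt0 (t, r)) (by linarith : 0 ≤ γ)
    unfold wtB
    nlinarith
  · have h0 := one_le_wt0 (t, r)
    have h0' := abs_le_wt0 (t, r)
    have h4 := le_abs_self (t - r)
    have hr1 := hr.2
    simp only at h0'
    exact mul_le_mul_of_nonneg_left (rpow_le_rpow (by positivity) (by linarith) (by linarith)) hc.le

lemma integral_le_of_lintegral_Ioi_le {g : ℝ → ℝ} (hg : Continuous g) (h0 : ∀ r, 0 ≤ r → 0 ≤ g r)
    {K : ℝ} (hK : 0 ≤ K) (h : ∫⁻ r in Set.Ioi (0 : ℝ), ENNReal.ofReal (g r) ≤ ENNReal.ofReal K)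
    {R : ℝ} (hR : 0 ≤ R) : ∫ r in (0 : ℝ)..R, g r ≤ K := by
  rw [intervalIntegral.integral_of_le hR]
  refine (ENNReal.ofReal_le_ofReal_iff hK).1 (le_trans ?_ h)
  rw [ofReal_integral_eq_lintegral_ofReal (hg.integrableOn_Ioc)]
  · exact lintegral_mono_set Set.Ioc_subset_Ioi_self
  · exact (ae_restrict_iff' measurableSet_Ioc).2 (Filter.Eventually.of_forall fun r hr => h0 r hr.1.le)

lemma lintegral_Ioi_le_of_integral_le {g : ℝ → ℝ} (hg : Continuous g) (h0 : ∀ r, 0 ≤ r → 0 ≤ g r)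
    {K : ℝ} (h : ∀ R, 0 ≤ R → ∫ r in (0 : ℝ)..R, g r ≤ K) :
    ∫⁻ r in Set.Ioi (0 : ℝ), ENNReal.ofReal (g r) ≤ ENNReal.ofReal K := by
  have hU : Set.Ioi (0 : ℝ) = ⋃ n : ℕ, Set.Ioc (0 : ℝ) n := by
    ext r
    simp only [Set.mem_Ioi, Set.mem_iUnion, Set.mem_Ioc]
    exact ⟨fun hr => (exists_nat_ge r).imp fun n hn => ⟨hr, hn⟩, fun ⟨n, hn⟩ => hn.1⟩
  have hm : Monotone fun n : ℕ => Set.Ioc (0 : ℝ) n := fun m n hmn =>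
    Set.Ioc_subset_Ioc_right (by exact_mod_cast hmn)
  rw [hU, setLIntegral_iUnion_of_directed _ hm.directed_le]
  refine iSup_le fun n => ?_
  rw [← ofReal_integral_eq_lintegral_ofReal (hg.integrableOn_Ioc)]
  · refine ENNReal.ofReal_le_ofReal ?_
    rw [← intervalIntegral.integral_of_le n.cast_nonneg]
    exact h n n.cast_nonneg
  · exact (ae_restrict_iff' measurableSet_Ioc).2 (Filter.Eventually.of_forall fun r hr => h0 r hr.1.le)

section polar
variable {G : E3 → ℝ} (hG : Continuous G) (h0 : ∀ x, 0 ≤ G x)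
include hG h0

lemma lintegral_ofReal_polar : ∫⁻ x, ENNReal.ofReal (G x)
    = ∫⁻ r in Set.Ioi (0 : ℝ), ENNReal.ofReal (∫ ω, r ^ 2 * G (r • ω) ∂sig) := by
  rw [lintegral_polar (by fun_prop)]
  refine lintegral_congr fun r => ?_
  rw [integral_const_mul, ENNReal.ofReal_mul (sq_nonneg r), ofReal_integral_eq_lintegral_ofReal
    (Continuous.integrable_sig (by fun_prop)) (Filter.Eventually.of_forall fun ω => h0 _)]

lemma shell_le_of_lintegral_le {K : ℝ} (hK : 0 ≤ K)
    (h : ∫⁻ x, ENNReal.ofReal (G x) ≤ ENNReal.ofReal K) {R : ℝ} (hR : 0 ≤ R) :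
    shell 0 R (fun z => z.1 ^ 2 * G (z.1 • z.2)) ≤ K := by
  rw [lintegral_ofReal_polar hG h0] at h
  exact integral_le_of_lintegral_Ioi_le
    (continuous_sphere (F := fun z => z.1 ^ 2 * G (z.1 • z.2)) (by fun_prop))
    (fun r _ => integral_nonneg fun ω => mul_nonneg (sq_nonneg r) (h0 _)) hK h hR

lemma lintegral_le_of_shell_le {K : ℝ}
    (h : ∀ R, 0 ≤ R → shell 0 R (fun z => z.1 ^ 2 * G (z.1 • z.2)) ≤ K) :
    ∫⁻ x, ENNReal.ofReal (G x) ≤ ENNReal.ofReal K := by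
  rw [lintegral_ofReal_polar hG h0]
  exact lintegral_Ioi_le_of_integral_le
    (continuous_sphere (F := fun z => z.1 ^ 2 * G (z.1 • z.2)) (by fun_prop))
    (fun r _ => integral_nonneg fun ω => mul_nonneg (sq_nonneg r) (h0 _)) h

end polar

/-- The fundamental theorem of calculus for spherical integrals. -/
lemma sphere_sub_eq_shell {G G' : ℝ × E3 → ℝ} (hG : ContDiff ℝ 1 G)
    (h : ∀ r ω, HasDerivAt (fun r => G (r, ω)) (G' (r, ω)) r) (a b : ℝ) :
    (∫ ω, G (b, ω) ∂sig) - ∫ ω, G (a, ω) ∂sig = shell a b G' := by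
  have hG' : G' = fun z => fderiv ℝ G z (1, 0) := by
    ext ⟨r, ω⟩
    exact (h r ω).unique (hG.hasDerivAt_curve ((hasDerivAt_id (r : ℝ)).prodMk (hasDerivAt_const (r : ℝ) ω)))
  have hc : Continuous G' := by
    rw [hG']; exact (hG.continuous_fderiv (by norm_num)).clm_apply continuous_const
  have hd : ∀ r, HasDerivAt (fun r => ∫ ω, G (r, ω) ∂sig) (∫ ω, G' (r, ω) ∂sig) r := by
    intro r
    have h1 := ((hasFDerivAt_integral_sig hG r).differentiableAt.hasFDerivAt).hasDerivAt
    have h2 := fderiv_integral_sig hG r 1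
    rw [h2] at h1
    rw [hG']
    exact h1
  exact (intervalIntegral.integral_eq_sub_of_hasDerivAt (fun r _ => hd r)
    ((continuous_sphere hc).intervalIntegrable _ _)).symm

/-- A nonnegative function whose integrals are bounded is `o(1/s)` along a sequence. -/
lemma exists_mul_le_of_integral_le {g : ℝ → ℝ} (hg : Continuous g) {A : ℝ}
    (h0 : ∀ r, 0 ≤ r → 0 ≤ g r)
    (hA : ∀ R, 0 ≤ R → ∫ r in (0 : ℝ)..R, g r ≤ A) {S ε : ℝ} (hS : 0 < S) (hε : 0 < ε) :
    ∃ s, S ≤ s ∧ s * g s ≤ ε := by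
  by_contra! hcon
  have h1 : ∀ R, S ≤ R → ε * Real.log (R / S) ≤ A := by
    intro R hR
    have hR0 := hS.trans_le hR
    rw [← integral_one_div_of_pos hS hR0, ← intervalIntegral.integral_const_mul]
    refine le_trans ?_ (hA R hR0.le)
    rw [← intervalIntegral.integral_add_adjacent_intervals (hg.intervalIntegrable 0 S)
      (hg.intervalIntegrable S R)]
    have h2 := intervalIntegral.integral_nonneg (μ := volume) hS.le (fun r (hr : r ∈ Set.Icc 0 S) => h0 r hr.1)
    have h3 : ∫ r in S..R, ε * (1 / r) ≤ ∫ r in S..R, g r := by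
      refine intervalIntegral.integral_mono_on hR ?_ (hg.intervalIntegrable _ _) fun r hr => ?_
      · refine ContinuousOn.intervalIntegrable_of_Icc hR ?_
        refine continuousOn_const.mul (continuousOn_const.div continuousOn_id fun r hr => ?_)
        exact (hS.trans_le hr.1).ne'
      · have := hS.trans_le hr.1
        rw [mul_one_div, div_le_iff₀ this, mul_comm]
        exact (hcon r hr.1).le
    linarith
  have h2 := h1 (S * Real.exp ((|A| + 1) / ε)) (le_mul_of_one_le_right hS.le (Real.one_le_exp (by positivity)))
  rw [mul_div_cancel_left₀ _ hS.ne', Real.log_exp, mul_div_cancel₀ _ hε.ne'] at h2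
  linarith [le_abs_self A]

section trace
variable {f : E3 → ℝ} (hf : ContDiff ℝ 1 f)
include hf

lemma hasDerivAt_ray (r : ℝ) (ω : E3) :
    HasDerivAt (fun r : ℝ => f (r • ω)) (fderiv ℝ f (r • ω) ω) r := by
  have : HasDerivAt (fun r : ℝ => r • ω) ω r := by
    simpa using (hasDerivAt_id r).smul_const ω
  exact hf.hasDerivAt_curve this

lemma continuous_radial : Continuous fun z : ℝ × E3 => fderiv ℝ f (z.1 • z.2) z.2 := by
  have := hf.continuous_fderiv (by norm_num)
  fun_prop

/-- Decay of spherical means of functions with square integrable weighted gradient. -/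
lemma trace_le {q A K γ : ℝ} (hq : 2 < q) (hq6 : q ≤ 6) (hγ : 0 ≤ γ)
    (hA : ∀ R, 0 ≤ R → shell 0 R (fun z => z.1 ^ 2 * |f (z.1 • z.2)| ^ q) ≤ A)
    (hK : ∀ R, 0 ≤ R → shell 0 R (fun z => z.1 ^ 2 * (1 + z.1) ^ γ *
      (fderiv ℝ f (z.1 • z.2) z.2) ^ 2) ≤ K) {r : ℝ} (hr : 0 ≤ r) :
    r * (1 + r) ^ γ * ∫ ω, f (r • ω) ^ 2 ∂sig ≤ K := by
  have hfc := hf.continuous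
  have hrc := continuous_radial hf
  have hwc : Continuous fun z : ℝ × E3 => (1 + z.1) ^ γ :=
    (continuous_const.add continuous_fst).rpow_const fun _ => Or.inr hγ
  have hqc : Continuous fun z : ℝ × E3 => |f (z.1 • z.2)| ^ q :=
    (by fun_prop : Continuous fun z : ℝ × E3 => |f (z.1 • z.2)|).rpow_const
      fun _ => Or.inr (by linarith)
  have hmono : ∀ s, r ≤ s → r * ∫ ω, f (r • ω) ^ 2 ∂sig
      ≤ s * (∫ ω, f (s • ω) ^ 2 ∂sig) + (1 + r) ^ (-γ) * K := by
    intro s hrs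
    have h1 := sphere_sub_eq_shell (G := fun z => z.1 * f (z.1 • z.2) ^ 2)
      (G' := fun z => f (z.1 • z.2) ^ 2 + z.1 * (2 * f (z.1 • z.2) * fderiv ℝ f (z.1 • z.2) z.2))
      (contDiff_fst.mul ((hf.comp (contDiff_fst.smul contDiff_snd)).pow 2)) (fun ρ ω => by
        have := (hasDerivAt_id' ρ).fun_mul ((hasDerivAt_ray hf ρ ω).fun_pow 2)
        refine this.congr_deriv ?_
        push_cast; ring) r s
    simp only [integral_const_mul] at h1
    have h2 : shell r s (fun z => -(1 + r) ^ (-γ) * (z.1 ^ 2 * (1 + z.1) ^ γ *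
        (fderiv ℝ f (z.1 • z.2) z.2) ^ 2)) ≤ shell r s (fun z => f (z.1 • z.2) ^ 2 +
          z.1 * (2 * f (z.1 • z.2) * fderiv ℝ f (z.1 • z.2) z.2)) := by
      refine shell_mono hrs (by fun_prop) (by fun_prop) fun ρ hρ ω _ => ?_
      set a := f (ρ • ω)
      set b := fderiv ℝ f (ρ • ω) ω
      have h3 : 1 ≤ (1 + r) ^ (-γ) * (1 + ρ) ^ γ := by
        rw [Real.rpow_neg (by linarith), inv_mul_eq_div, one_le_div (by positivity)]
        exact Real.rpow_le_rpow (by linarith) (by linarith [hρ.1]) hγ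
      have h4 : 0 ≤ (ρ * b) ^ 2 := sq_nonneg _
      simp only
      nlinarith [mul_le_mul_of_nonneg_right h3 h4, sq_nonneg (a + ρ * b)]
    rw [shell_const_mul] at h2
    have h5 : shell r s (fun z => (z.1 ^ 2 * (1 + z.1) ^ γ *
        (fderiv ℝ f (z.1 • z.2) z.2) ^ 2)) ≤ K :=
      (shell_mono_left hr (by fun_prop) fun ρ hρ ω _ => by
        have : 0 ≤ 1 + ρ := by linarith [hρ.1]
        positivity).trans (hK s (hr.trans hrs))
    have h6 : 0 ≤ (1 + r) ^ (-γ) := by positivity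
    nlinarith [mul_le_mul_of_nonneg_left h5 h6]
  have hlim : r * ∫ ω, f (r • ω) ^ 2 ∂sig ≤ (1 + r) ^ (-γ) * K := by
    refine le_of_forall_pos_le_add fun δ hδ => ?_
    set V := ∫ _ω : E3, (1 : ℝ) ∂sig with hV
    have hV0 : 0 ≤ V := integral_nonneg fun _ => zero_le_one
    set η := δ / (2 * (V + 1)) with hη
    have hη0 : 0 < η := by positivity
    set C := η ^ (1 - q / 2) with hC
    have hC0 : 0 < C := by positivity
    obtain ⟨s, hs1, hs2⟩ := exists_mul_le_of_integral_le
      (g := fun s => ∫ ω, s ^ 2 * |f (s • ω)| ^ q ∂sig)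
      (continuous_sphere (F := fun z => z.1 ^ 2 * |f (z.1 • z.2)| ^ q) (by fun_prop))
      (fun s _ => integral_nonneg fun ω => by positivity) hA
      (lt_max_of_lt_right zero_lt_one : 0 < max r 1) (by positivity : 0 < δ / (2 * C))
    have hs : r ≤ s := (le_max_left _ _).trans hs1
    have hs1 : 1 ≤ s := (le_max_right _ _).trans hs1
    refine (hmono s hs).trans ?_
    suffices h : s * (∫ ω, f (s • ω) ^ 2 ∂sig) ≤ δ by linarith
    have hpt : ∀ a : ℝ, s * a ^ 2 ≤ η + C * (s * (s ^ 2 * |a| ^ q)) := by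
      intro a
      rcases le_or_gt (s * a ^ 2) η with h | h
      · have : 0 ≤ C * (s * (s ^ 2 * |a| ^ q)) := by positivity
        linarith
      · have h0 : 0 < s * a ^ 2 := hη0.trans h
        have e1 : (s * a ^ 2) ^ (q / 2) = s ^ (q / 2) * |a| ^ q := by
          rw [Real.mul_rpow (by linarith) (sq_nonneg a), ← sq_abs a, ← Real.rpow_natCast |a| 2,
            ← Real.rpow_mul (abs_nonneg a)]
          congr 2; push_cast; ring
        have e2 : s ^ (q / 2) ≤ s * s ^ 2 := by
          calc s ^ (q / 2) ≤ s ^ (3 : ℝ) := Real.rpow_le_rpow_of_exponent_le hs1 (by linarith)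
            _ = s ^ 3 := by norm_cast
            _ = _ := by ring
        have e3 : s * a ^ 2 = (s * a ^ 2) ^ (1 - q / 2) * (s * a ^ 2) ^ (q / 2) := by
          rw [← Real.rpow_add h0]; simp
        have e4 : (s * a ^ 2) ^ (1 - q / 2) ≤ C :=
          Real.rpow_le_rpow_of_nonpos hη0 h.le (by linarith)
        calc s * a ^ 2 = _ := e3
          _ ≤ C * (s * s ^ 2 * |a| ^ q) := by
              refine mul_le_mul e4 ?_ (by positivity) hC0.le
              rw [e1]; gcongr
          _ ≤ _ := by rw [mul_assoc s]; linarith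
    have h7 : ∫ ω, s * f (s • ω) ^ 2 ∂sig
        ≤ ∫ ω, (η * 1 + C * (s * (s ^ 2 * |f (s • ω)| ^ q))) ∂sig := by
      have hq' : Continuous fun ω => |f (s • ω)| ^ q :=
        (by fun_prop : Continuous fun ω : E3 => |f (s • ω)|).rpow_const
          fun _ => Or.inr (by linarith)
      exact integral_sig_mono (by fun_prop) (by fun_prop) fun ω _ => by simpa using hpt (f (s • ω))
    have hq' : Continuous fun ω => |f (s • ω)| ^ q :=
      (by fun_prop : Continuous fun ω : E3 => |f (s • ω)|).rpow_const
        fun _ => Or.inr (by linarith)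
    rw [integral_const_mul, integral_add (Continuous.integrable_sig (by fun_prop))
      (Continuous.integrable_sig (by fun_prop)), integral_const_mul, integral_const_mul, integral_const_mul, ← hV] at h7
    have h8 : η * V ≤ δ / 2 := by
      rw [hη, div_mul_eq_mul_div, div_le_div_iff₀ (by positivity) (by positivity)]
      nlinarith
    have h9 : C * (s * ∫ ω, s ^ 2 * |f (s • ω)| ^ q ∂sig) ≤ δ / 2 := by
      have := mul_le_mul_of_nonneg_left hs2 hC0.le
      refine this.trans_eq ?_
      field_simp
    linarith
  have h1r : 0 < (1 + r) ^ γ := by positivity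
  calc r * (1 + r) ^ γ * ∫ ω, f (r • ω) ^ 2 ∂sig = (1 + r) ^ γ * (r * ∫ ω, f (r • ω) ^ 2 ∂sig) := by ring
    _ ≤ (1 + r) ^ γ * ((1 + r) ^ (-γ) * K) := by gcongr
    _ = K := by rw [← mul_assoc, ← Real.rpow_add (by linarith)]; simp

/-- A weighted Hardy inequality on balls. -/
lemma weighted_hardy_le {q A K γ : ℝ} (hq : 2 < q) (hq6 : q ≤ 6) (hγ : 1 ≤ γ)
    (hA : ∀ R, 0 ≤ R → shell 0 R (fun z => z.1 ^ 2 * |f (z.1 • z.2)| ^ q) ≤ A)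
    (hK : ∀ R, 0 ≤ R → shell 0 R (fun z => z.1 ^ 2 * (1 + z.1) ^ γ *
      (fderiv ℝ f (z.1 • z.2) z.2) ^ 2) ≤ K) {R : ℝ} (hR : 0 ≤ R) :
    shell 0 R (fun z => (1 + z.1) ^ γ * f (z.1 • z.2) ^ 2) ≤ 6 * K := by
  have htr := trace_le hf hq hq6 (by linarith) hA hK hR
  have hfc := hf.continuous
  have hrc := continuous_radial hf
  have hw : ContDiff ℝ 1 fun r : ℝ => (1 + r) ^ γ :=
    (contDiff_rpow_const_of_le (n := 1) (by simpa using hγ)).comp (contDiff_const.add contDiff_id)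
  have hwc : Continuous fun z : ℝ × E3 => (1 + z.1) ^ γ :=
    (continuous_const.add continuous_fst).rpow_const fun _ => Or.inr (by linarith)
  have hwc' : Continuous fun z : ℝ × E3 => (1 + z.1) ^ (γ - 1) :=
    (continuous_const.add continuous_fst).rpow_const fun _ => Or.inr (by linarith)
  have h1 := sphere_sub_eq_shell (G := fun z => z.1 * (1 + z.1) ^ γ * f (z.1 • z.2) ^ 2)
    (G' := fun z => ((1 + z.1) ^ γ + z.1 * (γ * (1 + z.1) ^ (γ - 1))) * f (z.1 • z.2) ^ 2
      + z.1 * (1 + z.1) ^ γ * (2 * f (z.1 • z.2) * fderiv ℝ f (z.1 • z.2) z.2))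
    ((contDiff_fst.mul (hw.comp contDiff_fst)).mul
      ((hf.comp (contDiff_fst.smul contDiff_snd)).pow 2)) (fun ρ ω => by
      have hw' : HasDerivAt (fun r : ℝ => (1 + r) ^ γ) (γ * (1 + ρ) ^ (γ - 1)) ρ := by
        have := ((hasDerivAt_id' ρ).const_add (1 : ℝ)).rpow_const (p := γ) (Or.inr hγ)
        simpa using this
      have := ((hasDerivAt_id' ρ).fun_mul hw').fun_mul ((hasDerivAt_ray hf ρ ω).fun_pow 2)
      refine this.congr_deriv ?_
      push_cast; ring) 0 R
  simp only [integral_const_mul, zero_mul, integral_zero, sub_zero] at h1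
  have h2 : shell 0 R (fun z => (1 / 2) * ((1 + z.1) ^ γ * f (z.1 • z.2) ^ 2)
      + (-2) * (z.1 ^ 2 * (1 + z.1) ^ γ * (fderiv ℝ f (z.1 • z.2) z.2) ^ 2))
      ≤ shell 0 R (fun z => ((1 + z.1) ^ γ + z.1 * (γ * (1 + z.1) ^ (γ - 1))) * f (z.1 • z.2) ^ 2
      + z.1 * (1 + z.1) ^ γ * (2 * f (z.1 • z.2) * fderiv ℝ f (z.1 • z.2) z.2)) := by
    refine shell_mono hR (by fun_prop) (by fun_prop) fun ρ hρ ω _ => ?_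
    have hρ0 : 0 ≤ ρ := hρ.1
    simp only
    set a := f (ρ • ω)
    set b := fderiv ℝ f (ρ • ω) ω
    have h3 : 0 ≤ (1 + ρ) ^ γ := by positivity
    have h4 : 0 ≤ ρ * (γ * (1 + ρ) ^ (γ - 1)) * a ^ 2 := by positivity
    nlinarith [mul_nonneg h3 (sq_nonneg (a + 2 * (ρ * b)))]
  rw [← h1, shell_add (by fun_prop) (by fun_prop), shell_const_mul, shell_const_mul] at h2
  have h3 := hK R hR
  linarith

end trace

lemma fderiv_slice {Φ : ℝ × E3 → ℝ} (hΦ : ContDiff ℝ 1 Φ) (t : ℝ) (x v : E3) :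
    fderiv ℝ (fun x => Φ (t, x)) x v = fderiv ℝ Φ (t, x) (0, v) := by
  have h := (hΦ.differentiable (by norm_num) (t, x)).hasFDerivAt.comp x (hasFDerivAt_prodMk_right (𝕜 := ℝ) t x)
  rw [show (fun x => Φ (t, x)) = Φ ∘ fun x => (t, x) from rfl, h.fderiv]
  simp

lemma contDiff_slice {Φ : ℝ × E3 → ℝ} (hΦ : ContDiff ℝ 1 Φ) (t : ℝ) : ContDiff ℝ 1 fun x => Φ (t, x) :=
  hΦ.comp (contDiff_const.prodMk contDiff_id)

lemma norm_rotGen_le (k : Fin 3) (x : E3) : ‖rotGen k x‖ ≤ ‖x‖ := by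
  rw [EuclideanSpace.norm_eq, EuclideanSpace.norm_eq]
  refine Real.sqrt_le_sqrt ?_
  simp only [Real.norm_eq_abs, sq_abs, Fin.sum_univ_three, rotGen_apply]
  fin_cases k <;> simp <;> nlinarith [sq_nonneg (x 0), sq_nonneg (x 1), sq_nonneg (x 2)]

lemma sq_clm_apply_le (L : E3 →L[ℝ] ℝ) {v : E3} (hv : ‖v‖ ≤ 1) : L v ^ 2 ≤ ‖L‖ ^ 2 := by
  have h := L.le_opNorm v
  rw [Real.norm_eq_abs] at h
  rw [← sq_abs (L v)]
  have : ‖L‖ * ‖v‖ ≤ ‖L‖ := mul_le_of_le_one_right (norm_nonneg _) hv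
  exact pow_le_pow_left₀ (abs_nonneg _) (h.trans this) 2

section data
variable {p A K γ : ℝ} {Φ : ℝ × E3 → ℝ} (hp : 1 < p) (hΦ : ContDiff ℝ (⊤ : ℕ∞) Φ)
include hp hΦ

lemma pot_data_le (r : ℝ) {ω : E3} (hω : ‖ω‖ = 1) : pot p Φ ((0, r), ω) ≤
    r ^ 2 * (3 / 2 * ‖fderiv ℝ (fun x => Φ (0, x)) (r • ω)‖ ^ 2)
      + r ^ 2 * |Φ (0, r • ω)| ^ (p + 1) / 2 := by
  have h1 : ContDiff ℝ 1 Φ := hΦ.of_le (by exact_mod_cast (le_top : (1 : ℕ∞) ≤ ⊤))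
  have h2 : ∀ k, fJ k Φ ((0, r), ω) ^ 2 ≤ ‖fderiv ℝ (fun x => Φ (0, x)) (r • ω)‖ ^ 2 := by
    intro k
    have : fJ k Φ ((0, r), ω) = fderiv ℝ (fun x => Φ (0, x)) (r • ω) (rotGen k ω) :=
      (fderiv_slice h1 0 _ _).symm
    rw [this]
    exact sq_clm_apply_le _ ((norm_rotGen_le k ω).trans_eq hω)
  have h3 : |Φ (0, r • ω)| ^ (p + 1) / (p + 1) ≤ |Φ (0, r • ω)| ^ (p + 1) / 2 :=
    div_le_div_of_nonneg_left (by positivity) (by norm_num) (by linarith)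
  simp only [pot, pt, Fin.sum_univ_three] at h2 ⊢
  rw [mul_div_assoc, ← mul_add]
  refine mul_le_mul_of_nonneg_left ?_ (sq_nonneg r)
  have := h2 0
  have := h2 1
  have := h2 2
  linarith

lemma continuous_data (hγ : 0 ≤ γ) :
    (Continuous fun z : ℝ × E3 => z.1 ^ 2 * (1 + z.1) ^ γ * |Φ (0, z.1 • z.2)| ^ (p + 1)) ∧
    (Continuous fun z : ℝ × E3 => z.1 ^ 2 * (1 + z.1) ^ γ *
      ‖fderiv ℝ (fun x => Φ (0, x)) (z.1 • z.2)‖ ^ 2) ∧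
    (Continuous fun z : ℝ × E3 => z.1 ^ 2 * (1 + z.1) ^ γ *
      fderiv ℝ Φ (0, z.1 • z.2) (1, 0) ^ 2) ∧
    (Continuous fun z : ℝ × E3 => (1 + z.1) ^ γ * Φ (0, z.1 • z.2) ^ 2) ∧
    (Continuous fun z : ℝ × E3 => z.1 ^ 2 * (1 + z.1) ^ γ *
      (fderiv ℝ (fun x => Φ (0, x)) (z.1 • z.2) z.2) ^ 2) ∧
    (Continuous fun z : ℝ × E3 => z.1 ^ 2 * |Φ (0, z.1 • z.2)| ^ (p + 1)) := by
  have h1 : ContDiff ℝ 1 Φ := hΦ.of_le (by exact_mod_cast (le_top : (1 : ℕ∞) ≤ ⊤))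
  have hc := h1.continuous
  have hwc : Continuous fun z : ℝ × E3 => (1 + z.1) ^ γ :=
    (continuous_const.add continuous_fst).rpow_const fun _ => Or.inr hγ
  have hqc : Continuous fun z : ℝ × E3 => |Φ (0, z.1 • z.2)| ^ (p + 1) :=
    (by fun_prop : Continuous fun z : ℝ × E3 => |Φ (0, z.1 • z.2)|).rpow_const
      fun _ => Or.inr (by linarith)
  have hg : Continuous (fderiv ℝ Φ) := h1.continuous_fderiv (by norm_num)
  have hf : Continuous (fderiv ℝ (fun x => Φ (0, x))) :=
    (contDiff_slice h1 0).continuous_fderiv (by norm_num)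
  refine ⟨by fun_prop, by fun_prop, by fun_prop, by fun_prop, by fun_prop, by fun_prop⟩

variable (hγ : 0 ≤ γ)
include hγ

lemma data_unweighted
  (hA : ∀ R, 0 ≤ R → shell 0 R (fun z => z.1 ^ 2 * (1 + z.1) ^ γ * |Φ (0, z.1 • z.2)| ^ (p + 1)) ≤ A)
  {R : ℝ} (hR : 0 ≤ R) :
    shell 0 R (fun z => z.1 ^ 2 * |Φ (0, z.1 • z.2)| ^ (p + 1)) ≤ A := by
  obtain ⟨c1, c2, c3, c4, c5, c6⟩ := continuous_data hp hΦ hγ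
  refine (shell_mono hR c6 c1 fun r hr ω _ => ?_).trans (hA R hR)
  have : 1 ≤ (1 + r) ^ γ := Real.one_le_rpow (by linarith [hr.1]) hγ
  have h : 0 ≤ r ^ 2 * |Φ (0, r • ω)| ^ (p + 1) := by positivity
  simp only
  nlinarith

lemma data_radial
  (hK : ∀ R, 0 ≤ R → shell 0 R (fun z => z.1 ^ 2 * (1 + z.1) ^ γ *
      ‖fderiv ℝ (fun x => Φ (0, x)) (z.1 • z.2)‖ ^ 2) ≤ K)
  {R : ℝ} (hR : 0 ≤ R) :
    shell 0 R (fun z => z.1 ^ 2 * (1 + z.1) ^ γ *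
      (fderiv ℝ (fun x => Φ (0, x)) (z.1 • z.2) z.2) ^ 2) ≤ K := by
  obtain ⟨c1, c2, c3, c4, c5, c6⟩ := continuous_data hp hΦ hγ
  refine (shell_mono hR c5 c2 fun r hr ω hω => ?_).trans (hK R hR)
  have : 0 ≤ 1 + r := by linarith [hr.1]
  have h := sq_clm_apply_le (fderiv ℝ (fun x => Φ (0, x)) (r • ω)) hω.le
  simp only
  gcongr

variable (hp5 : p ≤ 5)
  (hA : ∀ R, 0 ≤ R → shell 0 R (fun z => z.1 ^ 2 * (1 + z.1) ^ γ * |Φ (0, z.1 • z.2)| ^ (p + 1)) ≤ A)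
  (hK : ∀ R, 0 ≤ R → shell 0 R (fun z => z.1 ^ 2 * (1 + z.1) ^ γ *
      ‖fderiv ℝ (fun x => Φ (0, x)) (z.1 • z.2)‖ ^ 2) ≤ K)
  (hG : ∀ R, 0 ≤ R → shell 0 R (fun z => z.1 ^ 2 * (1 + z.1) ^ γ *
      fderiv ℝ Φ (0, z.1 • z.2) (1, 0) ^ 2) ≤ K)
include hp5 hA hK hG

lemma weighted_data_le {c : ℝ} (hγ1 : 1 ≤ γ) (hc : 0 ≤ c) (hc1 : c ≤ 1) {R : ℝ} (hR : 0 ≤ R) :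
    shell 0 R (fun z => dens p (wtA γ) (wtB c γ) Φ ((0, z.1), z.2)) ≤ 2 * 3 ^ γ * (17 * K + A) := by
  obtain ⟨c1, c2, c3, c4, c5, c6⟩ := continuous_data hp hΦ hγ
  have h1 : ContDiff ℝ 1 Φ := hΦ.of_le (by exact_mod_cast (le_top : (1 : ℕ∞) ≤ ⊤))
  have hf := contDiff_slice h1 0
  have hH := weighted_hardy_le hf (by linarith : 2 < p + 1) (by linarith) hγ1
    (fun R hR => data_unweighted hp hΦ hγ hA hR)
    (fun R hR => data_radial hp hΦ hγ hK hR) hR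
  have hdens : Continuous fun z : ℝ × E3 => dens p (wtA γ) (wtB c γ) Φ ((0, z.1), z.2) :=
    (contDiff_dens hΦ hp (contDiff_wtA hγ1) (contDiff_wtB c hγ1)).continuous.comp (by fun_prop)
  have hpt : shell 0 R (fun z => dens p (wtA γ) (wtB c γ) Φ ((0, z.1), z.2)) ≤
      shell 0 R (fun z => 2 * 3 ^ γ * ((z.1 ^ 2 * (1 + z.1) ^ γ * fderiv ℝ Φ (0, z.1 • z.2) (1, 0) ^ 2
        + 2 * ((1 + z.1) ^ γ * Φ (0, z.1 • z.2) ^ 2))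
        + (4 * (z.1 ^ 2 * (1 + z.1) ^ γ * ‖fderiv ℝ (fun x => Φ (0, x)) (z.1 • z.2)‖ ^ 2)
        + z.1 ^ 2 * (1 + z.1) ^ γ * |Φ (0, z.1 • z.2)| ^ (p + 1)))) := by
    refine shell_mono hR hdens (by fun_prop) fun r hr ω hω => ?_
    have hr0 : 0 ≤ r := hr.1
    have hpot := pot_data_le hp hΦ r hω
    have hpot0 := pot_nonneg hp Φ ((0, r), ω)
    have hfr : fR Φ ((0, r), ω) = fderiv ℝ (fun x => Φ (0, x)) (r • ω) ω :=
      (fderiv_slice h1 0 _ _).symm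
    have hfr2 := sq_clm_apply_le (fderiv ℝ (fun x => Φ (0, x)) (r • ω)) hω.le
    rw [← hfr] at hfr2
    have hw0 := one_le_wt0 (0, r)
    have hw1 : wt0 (0, r) ≤ 1 + r := by
      unfold wt0
      rw [Real.sqrt_le_left (by linarith)]
      simp only
      nlinarith
    have hA1 : wtA γ (0, r) ≤ 3 ^ γ * (1 + r) ^ γ := by
      rw [← Real.mul_rpow (by norm_num) (by linarith)]
      refine Real.rpow_le_rpow ?_ ?_ hγ
      · simp only; linarith
      · simp only; linarith
    have hA0 : 0 ≤ wtA γ (0, r) := Real.rpow_nonneg (by simp only; linarith) _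
    have h3 : (1 : ℝ) ≤ 3 ^ γ := Real.one_le_rpow (by norm_num) hγ
    have hB1 : wtB c γ (0, r) ≤ 3 ^ γ * (1 + r) ^ γ := by
      unfold wtB
      refine mul_le_mul (hc1.trans h3) (Real.rpow_le_rpow (by linarith) hw1 hγ)
        (Real.rpow_nonneg (by linarith) _) (by positivity)
    have hB0 : 0 ≤ wtB c γ (0, r) := mul_nonneg hc (Real.rpow_nonneg (by linarith) _)
    set W := 3 ^ γ * (1 + r) ^ γ with hW
    have hW0 : 0 ≤ W := by positivity
    set a := psiT Φ ((0, r), ω) with ha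
    set b := psiR Φ ((0, r), ω) with hb
    set P := pot p Φ ((0, r), ω) with hP
    have e1 : dens p (wtA γ) (wtB c γ) Φ ((0, r), ω) ≤ 2 * W * (a ^ 2 + b ^ 2 + P) := by
      unfold dens
      simp only [← ha, ← hb, ← hP]
      have i1 : wtA γ (0, r) * (a + b) ^ 2 / 2 ≤ W * (a + b) ^ 2 / 2 := by gcongr
      have i2 : wtB c γ (0, r) * (a - b) ^ 2 / 2 ≤ W * (a - b) ^ 2 / 2 := by gcongr
      have i3 : (wtA γ (0, r) + wtB c γ (0, r)) * P ≤ (W + W) * P := by gcongr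
      nlinarith [mul_nonneg hW0 (add_nonneg (sq_nonneg a) (sq_nonneg b))]
    refine e1.trans ?_
    have e2 : a ^ 2 + b ^ 2 + P ≤ r ^ 2 * fderiv ℝ Φ (0, r • ω) (1, 0) ^ 2 + 2 * Φ (0, r • ω) ^ 2
        + 4 * (r ^ 2 * ‖fderiv ℝ (fun x => Φ (0, x)) (r • ω)‖ ^ 2)
        + r ^ 2 * |Φ (0, r • ω)| ^ (p + 1) := by
      have i1 : a ^ 2 = r ^ 2 * fderiv ℝ Φ (0, r • ω) (1, 0) ^ 2 := by
        rw [ha]; simp only [psiT, fT, pt]; ring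
      have i2 : b ^ 2 ≤ 2 * Φ (0, r • ω) ^ 2 + 2 * (r ^ 2 * fR Φ ((0, r), ω) ^ 2) := by
        rw [hb]; simp only [psiR, pt]
        nlinarith [sq_nonneg (Φ (0, r • ω) - r * fR Φ ((0, r), ω))]
      have i3 := mul_le_mul_of_nonneg_left hfr2 (sq_nonneg r)
      have i4 : 0 ≤ r ^ 2 * |Φ (0, r • ω)| ^ (p + 1) := by positivity
      have i5 : 0 ≤ r ^ 2 * ‖fderiv ℝ (fun x => Φ (0, x)) (r • ω)‖ ^ 2 := by positivity
      linarith
    refine (mul_le_mul_of_nonneg_left e2 (by positivity)).trans_eq ?_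
    simp only [hW]
    ring
  refine hpt.trans ?_
  rw [shell_const_mul, shell_add (by fun_prop) (by fun_prop), shell_add (by fun_prop) (by fun_prop),
    shell_add (by fun_prop) (by fun_prop), shell_const_mul, shell_const_mul]
  refine mul_le_mul_of_nonneg_left ?_ (by positivity)
  linarith [hH, hA R hR, hK R hR, hG R hR]

end data

/-- The integral of `(∂_r (r f))²` in terms of the gradient. -/
lemma shell_sq_psi_eq {f : E3 → ℝ} (hf : ContDiff ℝ 1 f) (R : ℝ) :
    shell 0 R (fun z => (f (z.1 • z.2) + z.1 * fderiv ℝ f (z.1 • z.2) z.2) ^ 2)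
      = R * (∫ ω, f (R • ω) ^ 2 ∂sig)
        + shell 0 R (fun z => z.1 ^ 2 * (fderiv ℝ f (z.1 • z.2) z.2) ^ 2) := by
  have hfc := hf.continuous
  have hrc := continuous_radial hf
  have h1 := sphere_sub_eq_shell (G := fun z => z.1 * f (z.1 • z.2) ^ 2)
    (G' := fun z => f (z.1 • z.2) ^ 2 + z.1 * (2 * f (z.1 • z.2) * fderiv ℝ f (z.1 • z.2) z.2))
    (contDiff_fst.mul ((hf.comp (contDiff_fst.smul contDiff_snd)).pow 2)) (fun ρ ω => by
      have := (hasDerivAt_id' ρ).fun_mul ((hasDerivAt_ray hf ρ ω).fun_pow 2)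
      refine this.congr_deriv ?_
      push_cast; ring) 0 R
  simp only [integral_const_mul, zero_mul, sub_zero, integral_zero] at h1
  rw [h1, ← shell_add (by fun_prop) (by fun_prop)]
  congr 1; ext z; ring

section data
variable {p A K : ℝ} {Φ : ℝ × E3 → ℝ} (hp : 1 < p) (hp5 : p ≤ 5)
  (hΦ : ContDiff ℝ (⊤ : ℕ∞) Φ)
  (hA : ∀ R, 0 ≤ R → shell 0 R (fun z => z.1 ^ 2 * |Φ (0, z.1 • z.2)| ^ (p + 1)) ≤ A)
  (hK : ∀ R, 0 ≤ R → shell 0 R (fun z => z.1 ^ 2 *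
      ‖fderiv ℝ (fun x => Φ (0, x)) (z.1 • z.2)‖ ^ 2) ≤ K)
  (hG : ∀ R, 0 ≤ R → shell 0 R (fun z => z.1 ^ 2 * fderiv ℝ Φ (0, z.1 • z.2) (1, 0) ^ 2) ≤ K)
include hp hp5 hΦ hA hK

lemma data_trace_le {R : ℝ} (hR : 0 ≤ R) : R * ∫ ω, Φ (0, R • ω) ^ 2 ∂sig ≤ K := by
  have h1 : ContDiff ℝ 1 Φ := hΦ.of_le (by exact_mod_cast (le_top : (1 : ℕ∞) ≤ ⊤))
  have := trace_le (contDiff_slice h1 0) (by linarith : 2 < p + 1) (by linarith) le_rfl hA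
    (fun R hR => data_radial (γ := 0) (K := K) hp hΦ le_rfl
      (by simpa using hK) hR) hR
  simpa using this

include hG

lemma energy_data_le {R : ℝ} (hR : 0 ≤ R) :
    shell 0 R (fun z => dens p (fun _ => 1) (fun _ => 1) Φ ((0, z.1), z.2)) ≤ 6 * K + A := by
  obtain ⟨c1, c2, c3, c4, c5, c6⟩ := continuous_data (γ := 0) hp hΦ le_rfl
  simp only [Real.rpow_zero, mul_one] at c1 c2 c3 c5
  have h1 : ContDiff ℝ 1 Φ := hΦ.of_le (by exact_mod_cast (le_top : (1 : ℕ∞) ≤ ⊤))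
  have hf := contDiff_slice h1 0
  have hdens : Continuous fun z : ℝ × E3 => dens p (fun _ => 1) (fun _ => 1) Φ ((0, z.1), z.2) :=
    (contDiff_dens hΦ hp contDiff_const contDiff_const).continuous.comp (by fun_prop)
  have hfc := hf.continuous
  have hrc := continuous_radial hf
  have hrad := data_radial (γ := 0) (K := K) hp hΦ le_rfl
      (by simpa using hK) hR
  simp only [Real.rpow_zero, mul_one] at hrad
  have hpsi := shell_sq_psi_eq hf R
  have htr := data_trace_le hp hp5 hΦ hA hK hR
  have hpt : shell 0 R (fun z => dens p (fun _ => 1) (fun _ => 1) Φ ((0, z.1), z.2)) ≤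
      shell 0 R (fun z => (z.1 ^ 2 * fderiv ℝ Φ (0, z.1 • z.2) (1, 0) ^ 2
        + (Φ (0, z.1 • z.2) + z.1 * fderiv ℝ (fun x => Φ (0, x)) (z.1 • z.2) z.2) ^ 2)
        + (3 * (z.1 ^ 2 * ‖fderiv ℝ (fun x => Φ (0, x)) (z.1 • z.2)‖ ^ 2)
        + z.1 ^ 2 * |Φ (0, z.1 • z.2)| ^ (p + 1))) := by
    refine shell_mono hR hdens (by fun_prop) fun r hr ω hω => ?_
    have hpot := pot_data_le hp hΦ r hω
    have hfr : fR Φ ((0, r), ω) = fderiv ℝ (fun x => Φ (0, x)) (r • ω) ω :=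
      (fderiv_slice h1 0 _ _).symm
    have i1 : dens p (fun _ => 1) (fun _ => 1) Φ ((0, r), ω)
        = psiT Φ ((0, r), ω) ^ 2 + psiR Φ ((0, r), ω) ^ 2 + 2 * pot p Φ ((0, r), ω) := by
      simp only [dens]; ring
    simp only
    rw [i1, ← hfr]
    simp only [psiT, psiR, fT, pt] at hpot ⊢
    nlinarith
  refine hpt.trans ?_
  have c7 : Continuous fun z : ℝ × E3 => (Φ (0, z.1 • z.2)
      + z.1 * fderiv ℝ (fun x => Φ (0, x)) (z.1 • z.2) z.2) ^ 2 := by fun_prop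
  rw [shell_add (c3.fun_add c7) ((c2.const_mul 3).fun_add c6), shell_add c3 c7,
    shell_add (c2.const_mul 3) c6, hpsi]
  have h3 := shell_const_mul (a := 0) (b := R)
    (F := fun z => z.1 ^ 2 * ‖fderiv ℝ (fun x => Φ (0, x)) (z.1 • z.2)‖ ^ 2) 3
  linarith [hA R hR, hK R hR, hG R hR]

end data

/-- Hardy's inequality on balls in terms of `∂_r (r f)`. -/
lemma hardy_le {f : E3 → ℝ} (hf : ContDiff ℝ 1 f) {R : ℝ} (hR : 0 ≤ R) :
    shell 0 R (fun z => f (z.1 • z.2) ^ 2)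
      ≤ 4 * shell 0 R (fun z => (f (z.1 • z.2) + z.1 * fderiv ℝ f (z.1 • z.2) z.2) ^ 2) := by
  have hfc := hf.continuous
  have hrc := continuous_radial hf
  have h1 := sphere_sub_eq_shell (G := fun z => z.1 * f (z.1 • z.2) ^ 2)
    (G' := fun z => f (z.1 • z.2) ^ 2 + z.1 * (2 * f (z.1 • z.2) * fderiv ℝ f (z.1 • z.2) z.2))
    (contDiff_fst.mul ((hf.comp (contDiff_fst.smul contDiff_snd)).pow 2)) (fun ρ ω => by
      have := (hasDerivAt_id' ρ).fun_mul ((hasDerivAt_ray hf ρ ω).fun_pow 2)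
      refine this.congr_deriv ?_
      push_cast; ring) 0 R
  simp only [integral_const_mul, zero_mul, sub_zero, integral_zero] at h1
  have h2 : 0 ≤ R * ∫ ω, f (R • ω) ^ 2 ∂sig := mul_nonneg hR (integral_nonneg fun _ => sq_nonneg _)
  rw [h1] at h2
  have h3 : shell 0 R (fun z => f (z.1 • z.2) ^ 2 +
      z.1 * (2 * f (z.1 • z.2) * fderiv ℝ f (z.1 • z.2) z.2)) ≤
      shell 0 R (fun z => (-1 / 2) * f (z.1 • z.2) ^ 2 +
        2 * (f (z.1 • z.2) + z.1 * fderiv ℝ f (z.1 • z.2) z.2) ^ 2) := by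
    refine shell_mono hR (by fun_prop) (by fun_prop) fun r _ ω _ => ?_
    simp only
    nlinarith [sq_nonneg (f (r • ω) - 2 * (f (r • ω) + r * fderiv ℝ f (r • ω) ω))]
  rw [shell_add (F := fun z => (-1 / 2) * f (z.1 • z.2) ^ 2) (by fun_prop) (by fun_prop),
    shell_const_mul, shell_const_mul] at h3
  linarith

/-- The point of the affine chart `x₀ = 1` with parameter `y`. -/
def gnomonicLift (y : Fin 2 → ℝ) : E3 := !₂[1, y 0, y 1]

/-- The central projection of the affine chart `x₀ = 1` to the unit sphere. -/
def gnomonic (y : Fin 2 → ℝ) : E3 := ‖gnomonicLift y‖⁻¹ • gnomonicLift y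

/-- The cone over the cube face in the direction of the first coordinate. -/
def cubeCone : Set E3 := {x | |x 1| ≤ x 0 ∧ |x 2| ≤ x 0}

lemma measurableSet_cubeCone : MeasurableSet cubeCone := by
  have h : ∀ i : Fin 3, Continuous fun x : E3 => x i := fun i => by fun_prop
  exact ((isClosed_le (h 1).abs (h 0)).inter (isClosed_le (h 2).abs (h 0))).measurableSet

lemma contDiff_gnomonicLift : ContDiff ℝ 1 gnomonicLift := by
  refine contDiff_euclidean.2 fun i => ?_
  fin_cases i <;> simp [gnomonicLift] <;> fun_prop

lemma one_le_norm_gnomonicLift (y : Fin 2 → ℝ) : 1 ≤ ‖gnomonicLift y‖ := by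
  have := PiLp.norm_apply_le (gnomonicLift y) 0
  simpa [gnomonicLift] using this

lemma contDiff_gnomonic : ContDiff ℝ 1 gnomonic := by
  have h : ∀ y, gnomonicLift y ≠ 0 := fun y => norm_pos_iff.1 (by linarith [one_le_norm_gnomonicLift y])
  exact ((contDiff_gnomonicLift.norm ℝ h).inv fun y => by
    linarith [one_le_norm_gnomonicLift y]).smul contDiff_gnomonicLift

lemma norm_gnomonic (y : Fin 2 → ℝ) : ‖gnomonic y‖ = 1 := by
  have := one_le_norm_gnomonicLift y
  rw [gnomonic, norm_smul, norm_inv, norm_norm, inv_mul_cancel₀ (by linarith)]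

lemma lintegral_slices {T : E3 → ℝ≥0∞} (hT : Measurable T) :
    ∫⁻ x, T x = ∫⁻ s : ℝ, ∫⁻ y : Fin 2 → ℝ, T !₂[s, y 0, y 1] := by
  have h1 := (PiLp.volume_preserving_ofLp (Fin 3)).symm (MeasurableEquiv.toLp 2 (Fin 3 → ℝ)).symm
  have h2 := (volume_preserving_piFinSuccAbove (fun _ : Fin 3 => ℝ) 0).symm
  have h3 := h1.comp h2
  rw [← h3.lintegral_comp hT, Measure.volume_eq_prod]
  refine (lintegral_prod _ (hT.comp h3.measurable).aemeasurable).trans ?_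
  refine lintegral_congr fun s => lintegral_congr fun y => ?_
  refine congrArg T (PiLp.ext fun i => ?_)
  fin_cases i <;> rfl

lemma lintegral_slice_scale (T : E3 → ℝ≥0∞) (hT : Measurable T) {s : ℝ} (hs : 0 < s) :
    ∫⁻ y : Fin 2 → ℝ, T !₂[s, y 0, y 1]
      = ENNReal.ofReal (s ^ 2) * ∫⁻ y, T (s • gnomonicLift y) := by
  have hm : Measurable fun y : Fin 2 → ℝ => T !₂[s, y 0, y 1] := by
    refine hT.comp (Continuous.measurable ?_)
    refine (PiLp.continuous_toLp 2 _).comp (continuous_pi fun i => ?_)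
    fin_cases i <;> simp <;> fun_prop
  have h := Measure.map_addHaar_smul (volume : Measure (Fin 2 → ℝ)) hs.ne'
  have h2 : ∫⁻ y : Fin 2 → ℝ, T (s • gnomonicLift y)
      = ∫⁻ y : Fin 2 → ℝ, T !₂[s, y 0, y 1] ∂(Measure.map (s • ·) volume) := by
    rw [lintegral_map hm (measurable_const_smul s)]
    refine lintegral_congr fun y => ?_
    congr 1
    ext i
    fin_cases i <;> simp [gnomonicLift]
  rw [h2, h, lintegral_smul_measure, smul_eq_mul, ← mul_assoc, ← ENNReal.ofReal_mul (sq_nonneg s)]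
  simp [abs_of_pos hs, hs.ne']

lemma smul_gnomonicLift_normalize {s : ℝ} (hs : 0 < s) (y : Fin 2 → ℝ) :
    ‖s • gnomonicLift y‖⁻¹ • s • gnomonicLift y = gnomonic y := by
  have := one_le_norm_gnomonicLift y
  rw [norm_smul, Real.norm_of_nonneg hs.le, smul_smul, gnomonic]
  congr 1
  field_simp

lemma lintegral_Ioo_sq {b : ℝ} (hb : 0 ≤ b) :
    ∫⁻ s in Set.Ioo 0 b, ENNReal.ofReal (s ^ 2) = ENNReal.ofReal (b ^ 3 / 3) := by
  rw [← ofReal_integral_eq_lintegral_ofReal]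
  · rw [← integral_Ioc_eq_integral_Ioo, ← intervalIntegral.integral_of_le hb, integral_pow]
    norm_num
  · exact ((continuous_pow 2).integrableOn_Icc).mono_set Set.Ioo_subset_Icc_self
  · exact Filter.Eventually.of_forall fun s => sq_nonneg s

lemma lintegral_cubeCone_le {F : E3 → ℝ≥0∞} (hF : Measurable F) :
    ∫⁻ ω, cubeCone.indicator F ω ∂sig ≤ ∫⁻ y in Metric.closedBall (0 : Fin 2 → ℝ) 1, F (gnomonic y) := by
  classical
  have hm : Measurable fun x : E3 => ‖x‖⁻¹ • x := by fun_prop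
  have hG : Measurable fun x : E3 => cubeCone.indicator F (‖x‖⁻¹ • x) :=
    (hF.indicator measurableSet_cubeCone).comp hm
  set T : E3 → ℝ≥0∞ := (Metric.ball 0 1).indicator fun x => cubeCone.indicator F (‖x‖⁻¹ • x) with hTdef
  have hT : Measurable T := hG.indicator measurableSet_ball
  set I := ∫⁻ y in Metric.closedBall (0 : Fin 2 → ℝ) 1, F (gnomonic y) with hI
  have hs : ∀ᵐ s : ℝ, ∫⁻ y : Fin 2 → ℝ, T !₂[s, y 0, y 1]
      ≤ (Set.Ioo 0 1).indicator (fun s => ENNReal.ofReal (s ^ 2) * I) s := by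
    filter_upwards [Measure.ae_ne volume (0 : ℝ)] with s hs0
    by_cases h : s ∈ Set.Ioo (0 : ℝ) 1
    · rw [Set.indicator_of_mem h, lintegral_slice_scale T hT h.1]
      gcongr
      rw [hI, ← lintegral_indicator measurableSet_closedBall]
      refine lintegral_mono fun y => ?_
      by_cases hy : s • gnomonicLift y ∈ Metric.ball (0 : E3) 1 ∧ gnomonic y ∈ cubeCone
      · have h1 : y ∈ Metric.closedBall (0 : Fin 2 → ℝ) 1 := by
          rw [mem_closedBall_zero_iff, pi_norm_le_iff_of_nonneg zero_le_one]
          have h0 : 0 < ‖gnomonicLift y‖ := by linarith [one_le_norm_gnomonicLift y]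
          obtain ⟨h2, h3⟩ := hy.2
          simp [gnomonic, gnomonicLift, abs_mul] at h2 h3
          intro i
          fin_cases i <;> simp
          · exact h2
          · exact h3
        rw [Set.indicator_of_mem h1, hTdef, Set.indicator_of_mem hy.1,
          smul_gnomonicLift_normalize h.1, Set.indicator_of_mem hy.2]
      · have : T (s • gnomonicLift y) = 0 := by
          rw [hTdef, Set.indicator_apply]
          split_ifs with h1
          · rw [smul_gnomonicLift_normalize h.1, Set.indicator_of_notMem fun h2 => hy ⟨h1, h2⟩]
          · rfl
        rw [this]; exact zero_le
    · rw [Set.indicator_of_notMem h]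
      refine le_of_eq (lintegral_eq_zero_of_ae_eq_zero (Filter.Eventually.of_forall fun y => ?_))
      rw [hTdef]
      show Set.indicator _ _ _ = 0
      rw [Set.indicator_apply]
      split_ifs with h1
      · rw [Set.indicator_of_notMem]
        intro h2
        apply h
        rw [mem_ball_zero_iff] at h1
        have h3 := PiLp.norm_apply_le (!₂[s, y 0, y 1] : E3) 0
        have h4 : |s| < 1 := by simpa using h3.trans_lt h1
        have h5 := (abs_nonneg _).trans h2.1
        refine ⟨lt_of_le_of_ne ?_ (Ne.symm hs0), (abs_lt.1 h4).2⟩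
        by_contra hneg
        have h6 : 0 < ‖(!₂[s, y 0, y 1] : E3)‖ := by
          have : 0 < |s| := abs_pos.2 hs0
          exact lt_of_lt_of_le this (by simpa using h3)
        have h7 : 0 ≤ ‖(!₂[s, y 0, y 1] : E3)‖⁻¹ * s := by simpa using h5
        have h8 := mul_neg_of_pos_of_neg (inv_pos.2 h6) (not_le.1 hneg)
        linarith
      · rfl
  calc ∫⁻ ω, cubeCone.indicator F ω ∂sig = 3 * ∫⁻ x, T x := by
        rw [lintegral_sig_eq_ball (hF.indicator measurableSet_cubeCone),
          lintegral_indicator measurableSet_ball]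
    _ = 3 * ∫⁻ s : ℝ, ∫⁻ y : Fin 2 → ℝ, T !₂[s, y 0, y 1] := by rw [lintegral_slices hT]
    _ ≤ 3 * ∫⁻ s : ℝ, (Set.Ioo 0 1).indicator (fun s => ENNReal.ofReal (s ^ 2) * I) s := by
        gcongr 3 * ?_
        exact lintegral_mono_ae hs
    _ = 3 * (ENNReal.ofReal (1 / 3) * I) := by
        rw [lintegral_indicator measurableSet_Ioo, lintegral_mul_const _ (by fun_prop),
          lintegral_Ioo_sq zero_le_one]
        norm_num
    _ = I := by
        rw [← mul_assoc, show (3 : ℝ≥0∞) = ENNReal.ofReal 3 by simp, ← ENNReal.ofReal_mul (by norm_num)]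
        norm_num

lemma lintegral_gnomonic_le {F : E3 → ℝ≥0∞} (hF : Measurable F) :
    ∫⁻ y in Metric.closedBall (0 : Fin 2 → ℝ) 2, F (gnomonic y) ≤ 27 * ∫⁻ ω, F ω ∂sig := by
  have hm : Measurable fun x : E3 => ‖x‖⁻¹ • x := by fun_prop
  set T : E3 → ℝ≥0∞ := (Metric.ball 0 1).indicator fun x => F (‖x‖⁻¹ • x) with hTdef
  have hT : Measurable T := (hF.comp hm).indicator measurableSet_ball
  set I := ∫⁻ y in Metric.closedBall (0 : Fin 2 → ℝ) 2, F (gnomonic y) with hI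
  have hs : ∀ s : ℝ, (Set.Ioo 0 (1 / 3)).indicator (fun s => ENNReal.ofReal (s ^ 2) * I) s
      ≤ ∫⁻ y : Fin 2 → ℝ, T !₂[s, y 0, y 1] := by
    intro s
    by_cases h : s ∈ Set.Ioo (0 : ℝ) (1 / 3)
    · rw [Set.indicator_of_mem h, lintegral_slice_scale T hT h.1]
      gcongr
      rw [hI, ← lintegral_indicator measurableSet_closedBall]
      refine lintegral_mono fun y => ?_
      by_cases hy : y ∈ Metric.closedBall (0 : Fin 2 → ℝ) 2
      · rw [Set.indicator_of_mem hy, hTdef, Set.indicator_of_mem, smul_gnomonicLift_normalize h.1]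
        rw [mem_closedBall_zero_iff, pi_norm_le_iff_of_nonneg zero_le_two] at hy
        have h0 := hy 0
        have h1 := hy 1
        rw [Real.norm_eq_abs] at h0 h1
        rw [mem_ball_zero_iff, norm_smul, Real.norm_of_nonneg h.1.le]
        have h3 : ‖gnomonicLift y‖ ≤ 3 := by
          rw [EuclideanSpace.norm_eq, Real.sqrt_le_left (by norm_num)]
          simp only [gnomonicLift, Fin.sum_univ_three, Real.norm_eq_abs, sq_abs]
          simp
          nlinarith [abs_nonneg (y 0), abs_nonneg (y 1), sq_abs (y 0), sq_abs (y 1)]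
        have := h.2
        nlinarith [h.1, norm_nonneg (gnomonicLift y)]
      · rw [Set.indicator_of_notMem hy]; exact zero_le
    · rw [Set.indicator_of_notMem h]; exact zero_le
  have h1 : ENNReal.ofReal (1 / 81) * I ≤ ∫⁻ x, T x := by
    rw [lintegral_slices hT]
    refine le_trans (le_of_eq ?_) (lintegral_mono hs)
    rw [lintegral_indicator measurableSet_Ioo, lintegral_mul_const _ (by fun_prop),
      lintegral_Ioo_sq (by norm_num)]
    norm_num
  calc I = 81 * (ENNReal.ofReal (1 / 81) * I) := by
        rw [← mul_assoc, show (81 : ℝ≥0∞) = ENNReal.ofReal 81 by simp, ← ENNReal.ofReal_mul (by norm_num)]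
        norm_num
    _ ≤ 81 * ∫⁻ x, T x := by gcongr
    _ = 27 * ∫⁻ ω, F ω ∂sig := by
        rw [lintegral_sig_eq_ball hF, lintegral_indicator measurableSet_ball, ← mul_assoc]
        norm_num

lemma eq_sum_inner_rotGen {ω w : E3} (hω : ‖ω‖ = 1) (hw : ⟪ω, w⟫_ℝ = 0) :
    w = ∑ k, ⟪rotGen k ω, w⟫_ℝ • rotGen k ω := by
  have h1 : ω 0 ^ 2 + ω 1 ^ 2 + ω 2 ^ 2 = 1 := by
    have := EuclideanSpace.norm_sq_eq ω
    rw [hω, Fin.sum_univ_three] at this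
    simpa using this.symm
  have h2 : ω 0 * w 0 + ω 1 * w 1 + ω 2 * w 2 = 0 := by
    rw [PiLp.inner_apply, Fin.sum_univ_three] at hw
    simp at hw
    linarith
  ext i
  simp only [PiLp.inner_apply, Fin.sum_univ_three, rotGen_apply]
  fin_cases i <;> simp
  · linear_combination (-w 0) * h1 + ω 0 * h2
  · linear_combination (-w 1) * h1 + ω 1 * h2
  · linear_combination (-w 2) * h1 + ω 2 * h2

lemma abs_apply_le_sum_rotGen (L : E3 →L[ℝ] ℝ) {ω w : E3} (hω : ‖ω‖ = 1) (hw : ⟪ω, w⟫_ℝ = 0) :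
    |L w| ≤ ‖w‖ * ∑ k, |L (rotGen k ω)| := by
  conv_lhs => rw [eq_sum_inner_rotGen hω hw]
  rw [map_sum, Finset.mul_sum]
  refine (Finset.abs_sum_le_sum_abs _ _).trans (Finset.sum_le_sum fun k _ => ?_)
  rw [map_smul, smul_eq_mul, abs_mul]
  refine mul_le_mul_of_nonneg_right ?_ (abs_nonneg _)
  refine (abs_real_inner_le_norm _ _).trans ?_
  exact mul_le_of_le_one_left (norm_nonneg _) ((norm_rotGen_le k ω).trans_eq hω)

/-- A function plus its angular derivatives. -/
def angSize (h : E3 → ℝ) (ω : E3) : ℝ := |h ω| + ∑ k, |fderiv ℝ h ω (rotGen k ω)|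

lemma angSize_nonneg (h : E3 → ℝ) (ω : E3) : 0 ≤ angSize h ω := by
  unfold angSize; positivity

lemma continuous_angSize {h : E3 → ℝ} (hh : ContDiff ℝ 1 h) : Continuous (angSize h) := by
  have h1 := hh.continuous
  have h2 := hh.continuous_fderiv (by norm_num)
  unfold angSize
  fun_prop

lemma inner_fderiv_eq_zero {V : Type*} [NormedAddCommGroup V] [NormedSpace ℝ V] {ν : V → E3}
    (hν : ContDiff ℝ 1 ν) (h1 : ∀ y, ‖ν y‖ = 1) (y v : V) : ⟪ν y, fderiv ℝ ν y v⟫_ℝ = 0 := by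
  have h2 := ((hν.differentiable (by norm_num) y).hasFDerivAt.norm_sq).fderiv
  simp only [h1] at h2
  have h3 := congrArg (fun L : V →L[ℝ] ℝ => L v) h2
  simpa using h3.symm

lemma exists_chart_sobolev : ∃ C : ℝ, 0 ≤ C ∧ ∀ h : E3 → ℝ, ContDiff ℝ 1 h →
    ∫⁻ ω, cubeCone.indicator (fun ω => ENNReal.ofReal (h ω ^ 2)) ω ∂sig
      ≤ ENNReal.ofReal C * (∫⁻ ω, ENNReal.ofReal (angSize h ω) ∂sig) ^ 2 := by
  let χ : ContDiffBump (0 : Fin 2 → ℝ) := ⟨1, 2, one_pos, one_lt_two⟩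
  have hχ : ContDiff ℝ 1 χ := χ.contDiff
  obtain ⟨B₁, hB₁⟩ := (isCompact_closedBall (0 : Fin 2 → ℝ) 2).exists_bound_of_continuousOn
    (contDiff_gnomonic.continuous_fderiv (by norm_num)).continuousOn
  obtain ⟨B₂, hB₂⟩ := (isCompact_closedBall (0 : Fin 2 → ℝ) 2).exists_bound_of_continuousOn
    (hχ.continuous_fderiv (by norm_num)).continuousOn
  set B := |B₁| + |B₂| with hB
  have hB0 : 0 ≤ B := by positivity
  refine ⟨(B * 27) ^ 2, by positivity, fun h hh => ?_⟩
  set u : (Fin 2 → ℝ) → ℝ := fun y => χ y * h (gnomonic y) with hu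
  have huC : ContDiff ℝ 1 u := hχ.mul (hh.comp contDiff_gnomonic)
  have husupp : HasCompactSupport u := χ.hasCompactSupport.mul_right
  have hgns := lintegral_pow_le_pow_lintegral_fderiv_aux (ι := Fin 2) (p := 2)
    (by norm_num; exact Real.HolderConjugate.two_two) huC husupp
  have hpt : ∀ y, ‖fderiv ℝ u y‖ₑ ≤ (Metric.closedBall (0 : Fin 2 → ℝ) 2).indicator
      (fun y => ENNReal.ofReal (B * angSize h (gnomonic y))) y := by
    intro y
    by_cases hy : y ∈ Metric.closedBall (0 : Fin 2 → ℝ) 2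
    · rw [Set.indicator_of_mem hy, ← ofReal_norm]
      refine ENNReal.ofReal_le_ofReal ?_
      have hS := angSize_nonneg h (gnomonic y)
      refine ContinuousLinearMap.opNorm_le_bound _ (by positivity) fun v => ?_
      have hk : HasFDerivAt (fun y => h (gnomonic y))
          ((fderiv ℝ h (gnomonic y)).comp (fderiv ℝ gnomonic y)) y :=
        (hh.differentiable (by norm_num) _).hasFDerivAt.comp y
          (contDiff_gnomonic.differentiable (by norm_num) y).hasFDerivAt
      have hd := ((hχ.differentiable (by norm_num) y).hasFDerivAt.mul hk).fderiv
      have hd' : fderiv ℝ u y = _ := hd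
      rw [hd']
      simp only [add_apply, smul_apply, smul_eq_mul,
        ContinuousLinearMap.comp_apply, Real.norm_eq_abs]
      have e1 := abs_apply_le_sum_rotGen (fderiv ℝ h (gnomonic y)) (norm_gnomonic y)
        (inner_fderiv_eq_zero contDiff_gnomonic norm_gnomonic y v)
      have e2 : ‖fderiv ℝ gnomonic y v‖ ≤ |B₁| * ‖v‖ :=
        ((fderiv ℝ gnomonic y).le_opNorm v).trans (by gcongr; exact (hB₁ y hy).trans (le_abs_self _))
      have e3 : |fderiv ℝ χ y v| ≤ |B₂| * ‖v‖ :=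
        ((fderiv ℝ χ y).le_opNorm v).trans (by gcongr; exact (hB₂ y hy).trans (le_abs_self _))
      have e4 : |χ y| ≤ 1 := by rw [abs_of_nonneg χ.nonneg]; exact χ.le_one
      set S := ∑ k, |fderiv ℝ h (gnomonic y) (rotGen k (gnomonic y))| with hSdef
      have hS0 : 0 ≤ S := Finset.sum_nonneg fun _ _ => abs_nonneg _
      have e5 : angSize h (gnomonic y) = |h (gnomonic y)| + S := rfl
      rw [e5]
      refine (abs_add_le _ _).trans ?_
      rw [abs_mul, abs_mul]
      have f1 : |χ y| * |fderiv ℝ h (gnomonic y) (fderiv ℝ gnomonic y v)| ≤ 1 * (|B₁| * ‖v‖ * S) :=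
        mul_le_mul e4 (e1.trans (mul_le_mul_of_nonneg_right e2 hS0)) (abs_nonneg _) zero_le_one
      have f2 : |h (gnomonic y)| * |fderiv ℝ χ y v| ≤ |h (gnomonic y)| * (|B₂| * ‖v‖) :=
        mul_le_mul_of_nonneg_left e3 (abs_nonneg _)
      have g1 : 0 ≤ |B₂| * ‖v‖ * S := by positivity
      have g2 : 0 ≤ |B₁| * ‖v‖ * |h (gnomonic y)| := by positivity
      rw [hB]
      nlinarith
    · rw [Set.indicator_of_notMem hy]
      have : y ∉ tsupport u := fun h1 => hy (by
        have h2 := closure_mono (Function.support_mul_subset_left χ fun y => h (gnomonic y)) h1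
        have h3 : tsupport χ = Metric.closedBall 0 2 := χ.tsupport_eq
        rw [← h3]; exact h2)
      have h0 : fderiv ℝ u y = 0 := by
        by_contra hne
        exact this (support_fderiv_subset ℝ hne)
      rw [h0]; exact (enorm_zero (E := (Fin 2 → ℝ) →L[ℝ] ℝ)).le
  have hm1 : Measurable fun ω => ENNReal.ofReal (h ω ^ 2) := by
    have := hh.continuous.measurable
    fun_prop
  have hm2 : Measurable fun ω => ENNReal.ofReal (angSize h ω) :=
    (continuous_angSize hh).measurable.ennreal_ofReal
  calc ∫⁻ ω, cubeCone.indicator (fun ω => ENNReal.ofReal (h ω ^ 2)) ω ∂sig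
      ≤ ∫⁻ y in Metric.closedBall (0 : Fin 2 → ℝ) 1, ENNReal.ofReal (h (gnomonic y) ^ 2) :=
        lintegral_cubeCone_le hm1
    _ ≤ ∫⁻ y, ‖u y‖ₑ ^ (2 : ℝ) := by
        rw [← lintegral_indicator measurableSet_closedBall]
        refine lintegral_mono fun y => ?_
        by_cases hy : y ∈ Metric.closedBall (0 : Fin 2 → ℝ) 1
        · rw [Set.indicator_of_mem hy]
          simp only [hu]
          rw [χ.one_of_mem_closedBall hy, one_mul, ← ofReal_norm,
            ENNReal.ofReal_rpow_of_nonneg (norm_nonneg _) zero_le_two]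
          simp
        · rw [Set.indicator_of_notMem hy]; exact zero_le
    _ ≤ (∫⁻ y, ‖fderiv ℝ u y‖ₑ) ^ (2 : ℝ) := hgns
    _ ≤ (∫⁻ y in Metric.closedBall (0 : Fin 2 → ℝ) 2, ENNReal.ofReal (B * angSize h (gnomonic y))) ^ (2 : ℝ) := by
        rw [← lintegral_indicator measurableSet_closedBall]
        gcongr with y
        exact hpt y
    _ ≤ (ENNReal.ofReal B * (27 * ∫⁻ ω, ENNReal.ofReal (angSize h ω) ∂sig)) ^ (2 : ℝ) := by
        have hm4 : Measurable fun y => ENNReal.ofReal (angSize h (gnomonic y)) :=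
          hm2.comp contDiff_gnomonic.continuous.measurable
        simp only [ENNReal.ofReal_mul hB0]
        rw [lintegral_const_mul _ hm4]
        gcongr
        exact lintegral_gnomonic_le hm2
    _ = ENNReal.ofReal ((B * 27) ^ 2) * (∫⁻ ω, ENNReal.ofReal (angSize h ω) ∂sig) ^ 2 := by
        rw [← mul_assoc, ENNReal.rpow_two, mul_pow, ENNReal.ofReal_pow (by positivity), ENNReal.ofReal_mul hB0]
        norm_num

lemma angSize_comp_le {h : E3 → ℝ} (hh : ContDiff ℝ 1 h) (Q : E3 ≃ₗᵢ[ℝ] E3) {ω : E3} (hω : ‖ω‖ = 1) :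
    angSize (fun x => h (Q x)) ω ≤ 3 * angSize h (Q ω) := by
  have hd : fderiv ℝ (fun x => h (Q x)) ω
      = (fderiv ℝ h (Q ω)).comp (Q.toContinuousLinearEquiv : E3 →L[ℝ] E3) :=
    ((hh.differentiable (by norm_num) _).hasFDerivAt.comp ω
      (Q.toContinuousLinearEquiv : E3 →L[ℝ] E3).hasFDerivAt).fderiv
  have hQ : ‖Q ω‖ = 1 := by rw [Q.norm_map, hω]
  have hk : ∀ k, |fderiv ℝ h (Q ω) (Q (rotGen k ω))| ≤ ∑ j, |fderiv ℝ h (Q ω) (rotGen j (Q ω))| := by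
    intro k
    have h1 : ⟪Q ω, Q (rotGen k ω)⟫_ℝ = 0 := by
      rw [Q.inner_map_map, PiLp.inner_apply, Fin.sum_univ_three]
      simp only [rotGen_apply]
      fin_cases k <;> simp <;> ring
    refine (abs_apply_le_sum_rotGen _ hQ h1).trans ?_
    refine mul_le_of_le_one_left (Finset.sum_nonneg fun _ _ => abs_nonneg _) ?_
    rw [Q.norm_map]
    exact (norm_rotGen_le k ω).trans_eq hω
  unfold angSize
  rw [hd]
  have h3 := Finset.sum_le_sum fun k (_ : k ∈ Finset.univ) => hk k
  have h4 : ∀ k, (((fderiv ℝ h (Q ω)).comp (Q.toContinuousLinearEquiv : E3 →L[ℝ] E3)) (rotGen k ω))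
    = fderiv ℝ h (Q ω) (Q (rotGen k ω)) := fun k => rfl
  simp only [h4]
  simp only [Finset.sum_const, Finset.card_univ, Fintype.card_fin, nsmul_eq_mul] at h3
  push_cast at h3
  linarith [abs_nonneg (h (Q ω))]

/-- The isometry exchanging the `i`-th coordinate with the first one. -/
def swapCoord (i : Fin 3) : E3 ≃ₗᵢ[ℝ] E3 :=
  LinearIsometryEquiv.piLpCongrLeft 2 ℝ ℝ (Equiv.swap 0 i)

/-- The Sobolev inequality `W^{1,1} ⊂ L²` on the unit sphere. -/
lemma exists_sphere_sobolev : ∃ C : ℝ, 0 ≤ C ∧ ∀ h : E3 → ℝ, ContDiff ℝ 1 h →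
    ∫ ω, h ω ^ 2 ∂sig ≤ C * (∫ ω, angSize h ω ∂sig) ^ 2 := by
  obtain ⟨C, hC0, hC⟩ := exists_chart_sobolev
  refine ⟨54 * C, by positivity, fun h hh => ?_⟩
  set J := ∫⁻ ω, ENNReal.ofReal (angSize h ω) ∂sig with hJ
  have hm1 : Measurable fun ω => ENNReal.ofReal (h ω ^ 2) := by
    have := hh.continuous.measurable
    fun_prop
  have hm2 : Measurable fun ω => ENNReal.ofReal (angSize h ω) :=
    (continuous_angSize hh).measurable.ennreal_ofReal
  have hQ : ∀ Q : E3 ≃ₗᵢ[ℝ] E3, ∫⁻ ω, (Q.symm ⁻¹' cubeCone).indicator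
      (fun ω => ENNReal.ofReal (h ω ^ 2)) ω ∂sig ≤ ENNReal.ofReal C * (9 * J ^ 2) := by
    intro Q
    have hm3 : Measurable ((Q.symm ⁻¹' cubeCone).indicator (fun ω => ENNReal.ofReal (h ω ^ 2))) :=
      hm1.indicator (measurableSet_cubeCone.preimage Q.symm.continuous.measurable)
    rw [← (measurePreserving_sig Q).lintegral_comp hm3]
    have h1 : ∀ ω, (Q.symm ⁻¹' cubeCone).indicator (fun ω => ENNReal.ofReal (h ω ^ 2)) (Q ω)
        = cubeCone.indicator (fun ω => ENNReal.ofReal (h (Q ω) ^ 2)) ω := by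
      intro ω
      by_cases hω : ω ∈ cubeCone
      · rw [Set.indicator_of_mem hω, Set.indicator_of_mem (by simpa using hω)]
      · rw [Set.indicator_of_notMem hω, Set.indicator_of_notMem (by simpa using hω)]
    simp only [h1]
    refine (hC (fun x => h (Q x)) (hh.comp Q.contDiff)).trans ?_
    gcongr
    have h2 : ∫⁻ ω, ENNReal.ofReal (angSize (fun x => h (Q x)) ω) ∂sig ≤ 3 * J := by
      rw [hJ, ← (measurePreserving_sig Q).lintegral_comp hm2, ← lintegral_const_mul]
      · refine lintegral_mono_ae ?_
        filter_upwards [ae_sig] with ω hω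
        rw [show (3 : ℝ≥0∞) = ENNReal.ofReal 3 by simp, ← ENNReal.ofReal_mul (by norm_num)]
        exact ENNReal.ofReal_le_ofReal (angSize_comp_le hh Q hω)
      · exact hm2.comp Q.continuous.measurable
    calc _ ≤ (3 * J) ^ 2 := by gcongr
      _ = 9 * J ^ 2 := by rw [mul_pow]; norm_num
  set P : Fin 3 → E3 ≃ₗᵢ[ℝ] E3 := swapCoord with hP
  have hcover : ∀ ω, ENNReal.ofReal (h ω ^ 2) ≤ ∑ i : Fin 3,
      (((P i).symm ⁻¹' cubeCone).indicator (fun ω => ENNReal.ofReal (h ω ^ 2)) ω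
      + (((P i).trans (LinearIsometryEquiv.neg ℝ)).symm ⁻¹' cubeCone).indicator
        (fun ω => ENNReal.ofReal (h ω ^ 2)) ω) := by
    intro ω
    obtain ⟨i, -, hi⟩ := Finset.exists_max_image Finset.univ (fun i => |ω i|) ⟨0, Finset.mem_univ _⟩
    refine le_trans ?_ (Finset.single_le_sum (fun _ _ => zero_le) (Finset.mem_univ i))
    have hs : ∀ (x : E3) j, (P i).symm x j = x (Equiv.swap 0 i j) := by
      intro x j
      simp [hP, swapCoord, LinearIsometryEquiv.piLpCongrLeft_apply, Equiv.piCongrLeft']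
    rcases le_total 0 (ω i) with h0 | h0
    · refine le_trans ?_ le_self_add
      rw [Set.indicator_of_mem]
      have : ∀ j, |ω j| ≤ ω i := fun j => (hi j (Finset.mem_univ j)).trans_eq (abs_of_nonneg h0)
      simp only [Set.mem_preimage, cubeCone, Set.mem_ofPred_eq, hs, Equiv.swap_apply_left]
      exact ⟨this _, this _⟩
    · refine le_trans ?_ le_add_self
      rw [Set.indicator_of_mem]
      have : ∀ j, |ω j| ≤ -ω i := fun j => (hi j (Finset.mem_univ j)).trans_eq (abs_of_nonpos h0)
      have hs' : ∀ j, ((P i).trans (LinearIsometryEquiv.neg ℝ)).symm ω j = - ω (Equiv.swap 0 i j) := by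
        intro j
        have e : ((P i).trans (LinearIsometryEquiv.neg ℝ)).symm ω = (P i).symm (-ω) := rfl
        rw [e, hs]; simp
      simp only [Set.mem_preimage, cubeCone, Set.mem_ofPred_eq, hs', Equiv.swap_apply_left, abs_neg]
      exact ⟨this _, this _⟩
  have hmi : ∀ Q : E3 ≃ₗᵢ[ℝ] E3, Measurable ((Q.symm ⁻¹' cubeCone).indicator
      (fun ω => ENNReal.ofReal (h ω ^ 2))) := fun Q =>
    hm1.indicator (measurableSet_cubeCone.preimage Q.symm.continuous.measurable)
  have hS : Integrable (angSize h) sig := (continuous_angSize hh).integrable_sig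
  have hJ' : J = ENNReal.ofReal (∫ ω, angSize h ω ∂sig) :=
    (ofReal_integral_eq_lintegral_ofReal hS (Filter.Eventually.of_forall (angSize_nonneg h))).symm
  have hI0 : 0 ≤ ∫ ω, angSize h ω ∂sig := integral_nonneg (angSize_nonneg h)
  rw [← ENNReal.ofReal_le_ofReal_iff (by positivity),
    ofReal_integral_eq_lintegral_ofReal (hh.continuous.fun_pow 2).integrable_sig
      (Filter.Eventually.of_forall fun _ => sq_nonneg _)]
  calc ∫⁻ ω, ENNReal.ofReal (h ω ^ 2) ∂sig ≤ _ := lintegral_mono hcover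
    _ ≤ ∑ i : Fin 3, (ENNReal.ofReal C * (9 * J ^ 2) + ENNReal.ofReal C * (9 * J ^ 2)) := by
        rw [lintegral_finsetSum _ fun i _ => (hmi _).fun_add (hmi _)]
        refine Finset.sum_le_sum fun i _ => ?_
        rw [lintegral_add_left (hmi _)]
        exact add_le_add (hQ _) (hQ _)
    _ = ENNReal.ofReal (54 * C * (∫ ω, angSize h ω ∂sig) ^ 2) := by
        rw [ENNReal.ofReal_mul (by positivity), ENNReal.ofReal_mul (by norm_num),
          ENNReal.ofReal_pow hI0, ← hJ']
        simp
        ring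

lemma exists_sphere_moment_six : ∃ C : ℝ, 0 < C ∧ ∀ f : E3 → ℝ, ContDiff ℝ 1 f → ∀ r : ℝ,
    ∫ ω, f (r • ω) ^ 6 ∂sig ≤ C * ((∫ ω, |f (r • ω)| ^ 3 ∂sig) ^ 2
      + (∫ ω, f (r • ω) ^ 4 ∂sig)
        * ∫ ω, ∑ k, (r * fderiv ℝ f (r • ω) (rotGen k ω)) ^ 2 ∂sig) := by
  obtain ⟨C, hC0, hC⟩ := exists_sphere_sobolev
  refine ⟨54 * (C + 1), by positivity, fun f hf r => ?_⟩
  have hc : ContDiff ℝ 1 fun x => f (r • x) := hf.comp (contDiff_const_smul r)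
  have c1 : Continuous fun x => f (r • x) := hc.continuous
  have cN : ∀ k, Continuous fun ω => r * fderiv ℝ f (r • ω) (rotGen k ω) := fun k => by
    have := hf.continuous_fderiv (by norm_num)
    fun_prop
  set N : Fin 3 → E3 → ℝ := fun k ω => r * fderiv ℝ f (r • ω) (rotGen k ω) with hN
  have hang : ∀ ω, angSize (fun x => f (r • x) ^ 3) ω
      = |f (r • ω)| ^ 3 + 3 * (f (r • ω) ^ 2 * ∑ k, |N k ω|) := by
    intro ω
    have h1 : HasFDerivAt (fun x : E3 => f (r • x)) ((fderiv ℝ f (r • ω)).comp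
        (r • ContinuousLinearMap.id ℝ E3)) ω :=
      (hf.differentiable (by norm_num) _).hasFDerivAt.comp ω ((hasFDerivAt_id ω).const_smul r)
    have h2 := (h1.pow 3).fderiv
    have h3 : fderiv ℝ (fun x => f (r • x) ^ 3) ω = _ := h2
    have h4 : ∀ k, fderiv ℝ (fun x => f (r • x) ^ 3) ω (rotGen k ω) = 3 * f (r • ω) ^ 2 * N k ω := by
      intro k
      rw [h3]
      simp [hN]
    unfold angSize
    simp only [h4, abs_pow, abs_mul, Finset.mul_sum]
    congr 1
    refine Finset.sum_congr rfl fun k _ => ?_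
    rw [sq_abs]; norm_num; ring
  have cA : Continuous fun ω => |f (r • ω)| ^ 3 := by fun_prop
  have cB : Continuous fun ω => ∑ k, |N k ω| := by
    have := fun k => (cN k).abs
    exact continuous_finsetSum _ fun k _ => this k
  have c2 : Continuous fun ω => f (r • ω) ^ 2 := by fun_prop
  have hI : ∫ ω, angSize (fun x => f (r • x) ^ 3) ω ∂sig
      = (∫ ω, |f (r • ω)| ^ 3 ∂sig) + 3 * ∫ ω, f (r • ω) ^ 2 * ∑ k, |N k ω| ∂sig := by
    simp only [hang]
    rw [integral_add cA.integrable_sig ((c2.fun_mul cB).const_mul 3).integrable_sig,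
      integral_const_mul]
  have hcs := sq_integral_sig_mul_le c2 cB
  have h6 := hC (fun x => f (r • x) ^ 3) (hc.pow 3)
  rw [hI] at h6
  have h7 : ∫ ω, (∑ k, |N k ω|) ^ 2 ∂sig ≤ 3 * ∫ ω, ∑ k, N k ω ^ 2 ∂sig := by
    rw [← integral_const_mul]
    refine integral_sig_mono (cB.fun_pow 2) ((continuous_finsetSum _ fun k _ => (cN k).fun_pow 2).const_mul 3)
      fun ω _ => ?_
    have := sq_sum_le_card_mul_sum_sq (s := Finset.univ) (f := fun k => |N k ω|)
    simpa using this
  have e6 : ∀ ω, (f (r • ω) ^ 3) ^ 2 = f (r • ω) ^ 6 := fun ω => by ring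
  have e4 : ∀ ω, (f (r • ω) ^ 2) ^ 2 = f (r • ω) ^ 4 := fun ω => by ring
  simp only [e6] at h6
  simp only [e4] at hcs
  set m3 := ∫ ω, |f (r • ω)| ^ 3 ∂sig
  set m4 := ∫ ω, f (r • ω) ^ 4 ∂sig with hm4
  set n := ∫ ω, ∑ k, N k ω ^ 2 ∂sig
  set w := ∫ ω, f (r • ω) ^ 2 * ∑ k, |N k ω| ∂sig
  have hm40 : 0 ≤ m4 := integral_nonneg fun ω => by positivity
  have h8 : w ^ 2 ≤ m4 * (3 * n) := hcs.trans (mul_le_mul_of_nonneg_left h7 hm40)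
  refine h6.trans ?_
  have h9 : (m3 + 3 * w) ^ 2 ≤ 54 * (m3 ^ 2 + m4 * n) := by
    nlinarith [sq_nonneg (m3 - 3 * w), sq_nonneg m3]
  have h10 : 0 ≤ (m3 + 3 * w) ^ 2 := sq_nonneg _
  nlinarith [mul_le_mul_of_nonneg_left h9 hC0]

lemma rpow_le_add_mul {v U b : ℝ} (hv : 0 ≤ v) (hU : 0 < U) (hb0 : 0 ≤ b) (hb1 : b ≤ 1) :
    v ^ b ≤ U ^ b + U ^ (b - 1) * v := by
  rcases le_total v U with h | h
  · have := rpow_le_rpow hv h hb0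
    have := rpow_nonneg hU.le (b - 1)
    nlinarith
  · have hv' : 0 < v := hU.trans_le h
    have h1 : v ^ (b - 1) ≤ U ^ (b - 1) := rpow_le_rpow_of_nonpos hU h (by linarith)
    have h2 : v ^ b = v ^ (b - 1) * v := by
      rw [← rpow_add_one hv'.ne']; congr 1; ring
    rw [h2]
    have := rpow_nonneg hU.le b
    nlinarith

lemma sq_sphere_moment_three_le {f : E3 → ℝ} (hf : Continuous f) (r : ℝ) :
    (∫ ω, |f (r • ω)| ^ 3 ∂sig) ^ 2 ≤ (∫ ω, f (r • ω) ^ 2 ∂sig) * ∫ ω, f (r • ω) ^ 4 ∂sig := by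
  have h := sq_integral_sig_mul_le (f := fun ω => |f (r • ω)|) (g := fun ω => f (r • ω) ^ 2)
    (by fun_prop) (by fun_prop)
  have e1 : ∀ ω, |f (r • ω)| * f (r • ω) ^ 2 = |f (r • ω)| ^ 3 := fun ω => by
    rw [← sq_abs (f (r • ω))]; ring
  have e2 : ∀ ω, (f (r • ω) ^ 2) ^ 2 = f (r • ω) ^ 4 := fun ω => by ring
  simpa only [e1, e2, sq_abs] using h

lemma sq_sphere_moment_three_le_rpow {f : E3 → ℝ} (hf : Continuous f) {p : ℝ} (hp : 1 < p)
    (hp5 : p < 5) (r : ℝ) {U : ℝ} (hU : 0 < U) (h4 : ∫ ω, f (r • ω) ^ 4 ∂sig ≤ U) :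
    (∫ ω, |f (r • ω)| ^ 3 ∂sig) ^ 2 ≤ (∫ ω, |f (r • ω)| ^ (p + 1) ∂sig)
      * ((sig.real Set.univ + 1) * U ^ ((5 - p) / 4)) := by
  have ca : Continuous fun ω => |f (r • ω)| := by fun_prop
  have h := sq_integral_sig_mul_le (f := fun ω => |f (r • ω)| ^ ((p + 1) / 2))
    (g := fun ω => |f (r • ω)| ^ ((5 - p) / 2))
    (ca.rpow_const fun _ => Or.inr (by linarith)) (ca.rpow_const fun _ => Or.inr (by linarith))
  have e1 : ∀ ω, |f (r • ω)| ^ ((p + 1) / 2) * |f (r • ω)| ^ ((5 - p) / 2) = |f (r • ω)| ^ 3 := by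
    intro ω
    rw [← rpow_add_of_nonneg (abs_nonneg _) (by linarith) (by linarith),
      show (p + 1) / 2 + (5 - p) / 2 = ((3 : ℕ) : ℝ) by norm_num; ring, rpow_natCast]
  have e2 : ∀ ω, (|f (r • ω)| ^ ((p + 1) / 2)) ^ 2 = |f (r • ω)| ^ (p + 1) := fun ω => by
    rw [← rpow_mul_natCast (abs_nonneg _)]; congr 1; push_cast; ring
  have e3 : ∀ ω, (|f (r • ω)| ^ ((5 - p) / 2)) ^ 2 = (f (r • ω) ^ 4) ^ ((5 - p) / 4) := fun ω => by
    rw [← rpow_mul_natCast (abs_nonneg _), show f (r • ω) ^ 4 = |f (r • ω)| ^ 4 by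
      rw [Even.pow_abs (by decide)], ← rpow_natCast_mul (abs_nonneg _)]
    congr 1; push_cast; ring
  simp only [e1, e2, e3] at h
  refine h.trans (mul_le_mul_of_nonneg_left ?_ (integral_nonneg fun ω => by positivity))
  have c4 : Continuous fun ω => f (r • ω) ^ 4 := by fun_prop
  calc ∫ ω, (f (r • ω) ^ 4) ^ ((5 - p) / 4) ∂sig
      ≤ ∫ ω, (U ^ ((5 - p) / 4) + U ^ ((5 - p) / 4 - 1) * f (r • ω) ^ 4) ∂sig :=
        integral_sig_mono (c4.rpow_const fun _ => Or.inr (by linarith)) (by fun_prop) fun ω _ =>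
          rpow_le_add_mul (by positivity) hU (by linarith) (by linarith)
    _ = sig.real Set.univ * U ^ ((5 - p) / 4) + U ^ ((5 - p) / 4 - 1) * ∫ ω, f (r • ω) ^ 4 ∂sig := by
        rw [integral_add (by exact continuous_const.integrable_sig) (c4.const_mul _).integrable_sig,
          integral_const_mul, integral_const, smul_eq_mul]
    _ ≤ sig.real Set.univ * U ^ ((5 - p) / 4) + U ^ ((5 - p) / 4 - 1) * U := by gcongr
    _ = (sig.real Set.univ + 1) * U ^ ((5 - p) / 4) := by
        rw [← rpow_add_one hU.ne']; ring_nf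

lemma sq_sphere_moment_four_le {f : E3 → ℝ} (hf : ContDiff ℝ 1 f) {r : ℝ} (hr : 0 ≤ r) :
    (r ^ 2 * ∫ ω, f (r • ω) ^ 4 ∂sig) ^ 2 ≤ 16 * (shell 0 r (fun z => z.1 ^ 2 * f (z.1 • z.2) ^ 6)
      * shell 0 r (fun z => (f (z.1 • z.2) + z.1 * fderiv ℝ f (z.1 • z.2) z.2) ^ 2)) := by
  have hfc := hf.continuous
  have crad := continuous_radial hf
  have c1 : ContDiff ℝ 1 fun z : ℝ × E3 => f (z.1 • z.2) := hf.comp (contDiff_fst.smul contDiff_snd)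
  have c1' := c1.continuous
  have h := sphere_sub_eq_shell (G := fun z => z.1 ^ 2 * f (z.1 • z.2) ^ 4)
    (G' := fun z => 2 * z.1 * f (z.1 • z.2) ^ 4
      + z.1 ^ 2 * (4 * f (z.1 • z.2) ^ 3 * fderiv ℝ f (z.1 • z.2) z.2))
    ((contDiff_fst.pow 2).mul (c1.pow 4)) (fun r ω => by
      have h1 := ((hasDerivAt_id r).fun_pow 2).fun_mul ((hasDerivAt_ray hf r ω).fun_pow 4)
      simpa using h1) 0 r
  simp only [ne_eq, OfNat.ofNat_ne_zero, not_false_eq_true, zero_pow, zero_mul, integral_zero,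
    sub_zero, integral_const_mul] at h
  have hcs := sq_shell_mul_le (F := fun z => z.1 * f (z.1 • z.2) ^ 3)
    (G := fun z => f (z.1 • z.2) + z.1 * fderiv ℝ f (z.1 • z.2) z.2) hr (by fun_prop) (by fun_prop)
  have e1 : (fun z : ℝ × E3 => (z.1 * f (z.1 • z.2) ^ 3) ^ 2) = fun z => z.1 ^ 2 * f (z.1 • z.2) ^ 6 := by
    funext z; ring
  rw [e1] at hcs
  have hle : r ^ 2 * ∫ ω, f (r • ω) ^ 4 ∂sig ≤ 4 * shell 0 r (fun z =>
      (z.1 * f (z.1 • z.2) ^ 3) * (f (z.1 • z.2) + z.1 * fderiv ℝ f (z.1 • z.2) z.2)) := by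
    rw [h, ← shell_const_mul]
    refine shell_mono hr (by fun_prop) (by fun_prop) fun s hs ω _ => ?_
    have : 0 ≤ s * f (s • ω) ^ 4 := mul_nonneg hs.1 (by positivity)
    simp only
    nlinarith
  have h0 : 0 ≤ r ^ 2 * ∫ ω, f (r • ω) ^ 4 ∂sig :=
    mul_nonneg (sq_nonneg r) (integral_nonneg fun ω => by positivity)
  calc _ ≤ (4 * shell 0 r (fun z =>
      (z.1 * f (z.1 • z.2) ^ 3) * (f (z.1 • z.2) + z.1 * fderiv ℝ f (z.1 • z.2) z.2))) ^ 2 :=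
        pow_le_pow_left₀ h0 hle 2
    _ ≤ _ := by rw [mul_pow]; nlinarith

lemma le_of_sq_le_rpow {A κ γ δ b τ x M : ℝ} (hτ : 1 ≤ τ) (hx : 0 ≤ x) (hA : 0 ≤ A)
    (hb1 : b ≤ 1) (hδ : δ ≤ γ) (hδb : δ * (2 - b) ≤ γ + 2 * b) (hM : 1 ≤ M)
    (hMA : 2 * A ≤ M) (hκ : κ ≤ τ ^ (-γ)) (h : x ^ 2 ≤ A * κ * (x + (x / τ ^ 2) ^ b)) :
    x ≤ M * τ ^ (-δ) := by
  have hτ0 : 0 < τ := by linarith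
  by_contra! hlt
  have hξ : 0 < M * τ ^ (-δ) := by positivity
  have hx0 : 0 < x := hξ.trans hlt
  have h1 : κ ≤ τ ^ (-δ) := hκ.trans (rpow_le_rpow_of_exponent_le hτ (by linarith))
  have e1 : κ * (x / τ ^ 2) ^ b ≤ τ ^ (-δ * (2 - b)) * x ^ b := by
    rw [div_rpow hx (by positivity), ← rpow_natCast_mul hτ0.le, div_eq_mul_inv, ← rpow_neg hτ0.le,
      mul_comm (x ^ b), ← mul_assoc]
    refine mul_le_mul_of_nonneg_right ?_ (rpow_nonneg hx _)
    calc κ * τ ^ (-(((2 : ℕ) : ℝ) * b)) ≤ τ ^ (-γ) * τ ^ (-(((2 : ℕ) : ℝ) * b)) := by gcongr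
      _ = τ ^ (-γ - 2 * b) := by rw [← rpow_add hτ0]; congr 1
      _ ≤ _ := rpow_le_rpow_of_exponent_le hτ (by linarith)
  have e2 : M * τ ^ (-δ * (2 - b)) ≤ x ^ (2 - b) := by
    calc M * τ ^ (-δ * (2 - b)) ≤ M ^ (2 - b) * τ ^ (-δ * (2 - b)) := by
          gcongr
          exact self_le_rpow_of_one_le hM (by linarith)
      _ = (M * τ ^ (-δ)) ^ (2 - b) := by
          rw [mul_rpow (by linarith) (by positivity), ← rpow_mul hτ0.le]
      _ ≤ _ := rpow_le_rpow hξ.le hlt.le (by linarith)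
  have e3 : x ^ (2 - b) * x ^ b = x ^ 2 := by
    rw [← rpow_add hx0, ← rpow_natCast]; congr 1; push_cast; ring
  have e4 : M * (κ * (x / τ ^ 2) ^ b) ≤ x ^ 2 := by
    rw [← e3]
    calc M * (κ * (x / τ ^ 2) ^ b) ≤ M * (τ ^ (-δ * (2 - b)) * x ^ b) := by gcongr
      _ = (M * τ ^ (-δ * (2 - b))) * x ^ b := by ring
      _ ≤ _ := by gcongr
  have e5 : M * (κ * x) < x ^ 2 := by
    calc M * (κ * x) ≤ (M * τ ^ (-δ)) * x := by rw [mul_assoc]; gcongr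
      _ < x * x := by gcongr
      _ = x ^ 2 := by ring
  have e6 : 0 < x ^ 2 := by positivity
  rcases hA.eq_or_lt with rfl | hA0
  · simp at h
    exact absurd h hx0.ne'
  have e7 : x ^ 2 * M < x ^ 2 * M :=
    calc x ^ 2 * M ≤ A * κ * (x + (x / τ ^ 2) ^ b) * M := by gcongr
      _ = A * (M * (κ * x) + M * (κ * (x / τ ^ 2) ^ b)) := by ring
      _ < A * (x ^ 2 + x ^ 2) := mul_lt_mul_of_pos_left (by linarith) hA0
      _ = x ^ 2 * (2 * A) := by ring
      _ ≤ x ^ 2 * M := by gcongr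
  exact lt_irrefl _ e7

lemma exists_moment_six_bound {p K γ δ : ℝ} (hp : 1 < p) (hp5 : p < 5) (hK : 0 < K)
    (hδ : δ ≤ γ) (hδb : δ * (2 - (5 - p) / 4) ≤ γ + 2 * ((5 - p) / 4)) :
    ∃ M : ℝ, 0 < M ∧ ∀ (f : E3 → ℝ) (τ : ℝ), ContDiff ℝ 1 f → 1 ≤ τ →
      (∀ R, 0 ≤ R → shell 0 R (fun z =>
        (f (z.1 • z.2) + z.1 * fderiv ℝ f (z.1 • z.2) z.2) ^ 2) ≤ K) →
      (∀ R, 0 ≤ R → shell 0 R (fun z =>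
        ∑ k, (z.1 * fderiv ℝ f (z.1 • z.2) (rotGen k z.2)) ^ 2) ≤ K * τ ^ (-γ)) →
      (∀ R, 0 ≤ R → shell 0 R (fun z => z.1 ^ 2 * |f (z.1 • z.2)| ^ (p + 1)) ≤ K * τ ^ (-γ)) →
      shell 0 (τ / 4) (fun z => f (z.1 • z.2) ^ 2) ≤ K * τ ^ (-γ) →
      ∀ R, 0 ≤ R → shell 0 R (fun z => z.1 ^ 2 * f (z.1 • z.2) ^ 6) ≤ (M * τ ^ (-δ)) ^ 2 := by
  obtain ⟨C, hC0, hC⟩ := exists_sphere_moment_six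
  set b := (5 - p) / 4 with hb
  set S := sig.real Set.univ + 1 with hS
  have hS0 : 0 < S := by positivity
  set A := K * C * (8 * √K + S * (64 * √K) ^ b) with hA
  have hA0 : 0 ≤ A := by positivity
  refine ⟨1 + 2 * A, by positivity, fun f τ hf hτ h1 h2 h3 h4 R hR => ?_⟩
  have hτ0 : 0 < τ := by linarith
  set κ := K * τ ^ (-γ) with hκ
  have hκ0 : 0 ≤ κ := by positivity
  set X := shell 0 R (fun z => z.1 ^ 2 * f (z.1 • z.2) ^ 6) with hX
  have hfc := hf.continuous
  have hX0 : 0 ≤ X := shell_nonneg hR fun r _ ω _ => by positivity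
  rcases hX0.eq_or_lt with h0 | hXpos
  · rw [← h0]; positivity
  set x := √X with hx
  have hxpos : 0 < x := sqrt_pos.2 hXpos
  have hxX : x ^ 2 = X := sq_sqrt hX0
  set Y := 4 * √K * x with hY
  have hKpos : 0 < √K := sqrt_pos.2 hK
  have hYpos : 0 < Y := by positivity
  have hY2 : Y ^ 2 = 16 * (X * K) := by
    rw [hY, mul_pow, mul_pow, sq_sqrt hK.le, hxX]; ring
  have hm40 : ∀ r : ℝ, 0 ≤ ∫ ω, f (r • ω) ^ 4 ∂sig := fun r => integral_nonneg fun ω => by positivity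
  have hm4 : ∀ r ∈ Set.Icc 0 R, r ^ 2 * ∫ ω, f (r • ω) ^ 4 ∂sig ≤ Y := by
    intro r hr
    refine abs_le_of_sq_le_sq' ?_ hYpos.le |>.2
    rw [hY2]
    refine (sq_sphere_moment_four_le hf hr.1).trans ?_
    have g1 : shell 0 r (fun z => z.1 ^ 2 * f (z.1 • z.2) ^ 6) ≤ X :=
      shell_mono_right hr.2 (by fun_prop) fun s _ ω _ => by positivity
    have g2 : 0 ≤ shell 0 r (fun z =>
        (f (z.1 • z.2) + z.1 * fderiv ℝ f (z.1 • z.2) z.2) ^ 2) :=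
      shell_nonneg hr.1 fun s _ ω _ => by positivity
    have := mul_le_mul g1 (h1 r hr.1) g2 hX0
    linarith
  have c3 : Continuous fun r : ℝ => r ^ 2 * (∫ ω, |f (r • ω)| ^ 3 ∂sig) ^ 2 := by
    have := continuous_sphere (F := fun z => |f (z.1 • z.2)| ^ 3) (by fun_prop)
    fun_prop
  have c6 : Continuous fun r : ℝ => ∫ ω, r ^ 2 * f (r • ω) ^ 6 ∂sig :=
    continuous_sphere (F := fun z => z.1 ^ 2 * f (z.1 • z.2) ^ 6) (by fun_prop)
  have cn : Continuous fun r : ℝ => ∫ ω, ∑ k, (r * fderiv ℝ f (r • ω) (rotGen k ω)) ^ 2 ∂sig := by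
    have := hf.continuous_fderiv (by norm_num)
    exact continuous_sphere (F := fun z => ∑ k, (z.1 * fderiv ℝ f (z.1 • z.2) (rotGen k z.2)) ^ 2)
      (by fun_prop)
  have c2 : Continuous fun r : ℝ => ∫ ω, f (r • ω) ^ 2 ∂sig :=
    continuous_sphere (F := fun z => f (z.1 • z.2) ^ 2) (by fun_prop)
  have cp' : Continuous fun z : ℝ × E3 => z.1 ^ 2 * |f (z.1 • z.2)| ^ (p + 1) := by
    have : Continuous fun z : ℝ × E3 => |f (z.1 • z.2)| := by fun_prop
    exact (by fun_prop : Continuous fun z : ℝ × E3 => z.1 ^ 2).mul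
      (this.rpow_const fun _ => Or.inr (by linarith))
  have cp : Continuous fun r : ℝ => ∫ ω, r ^ 2 * |f (r • ω)| ^ (p + 1) ∂sig :=
    continuous_sphere (F := fun z => z.1 ^ 2 * |f (z.1 • z.2)| ^ (p + 1)) cp'
  have hinner : ∀ ρ, 0 ≤ ρ → ρ ≤ τ / 4 → ρ ≤ R →
      ∫ r in (0 : ℝ)..ρ, r ^ 2 * (∫ ω, |f (r • ω)| ^ 3 ∂sig) ^ 2 ≤ Y * κ := by
    intro ρ hρ hρτ hρR
    calc ∫ r in (0 : ℝ)..ρ, r ^ 2 * (∫ ω, |f (r • ω)| ^ 3 ∂sig) ^ 2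
        ≤ ∫ r in (0 : ℝ)..ρ, Y * ∫ ω, f (r • ω) ^ 2 ∂sig := by
          refine intervalIntegral.integral_mono_on hρ (c3.intervalIntegrable _ _)
            ((c2.const_mul Y).intervalIntegrable _ _) fun r hr => ?_
          have g1 := sq_sphere_moment_three_le hfc r
          have g2 := hm4 r ⟨hr.1, hr.2.trans hρR⟩
          have g3 : 0 ≤ ∫ ω, f (r • ω) ^ 2 ∂sig := integral_nonneg fun ω => by positivity
          calc _ ≤ r ^ 2 * ((∫ ω, f (r • ω) ^ 2 ∂sig) * ∫ ω, f (r • ω) ^ 4 ∂sig) := by gcongr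
            _ = (r ^ 2 * ∫ ω, f (r • ω) ^ 4 ∂sig) * ∫ ω, f (r • ω) ^ 2 ∂sig := by ring
            _ ≤ _ := by gcongr
      _ = Y * shell 0 ρ (fun z => f (z.1 • z.2) ^ 2) := intervalIntegral.integral_const_mul _ _
      _ ≤ Y * κ := by
          refine mul_le_mul_of_nonneg_left (le_trans ?_ h4) hYpos.le
          exact shell_mono_right hρτ (by fun_prop) fun s _ ω _ => by positivity
  set U := 16 * Y / τ ^ 2 with hU
  have hUpos : 0 < U := by positivity
  have hW : ∫ r in (0 : ℝ)..R, r ^ 2 * (∫ ω, |f (r • ω)| ^ 3 ∂sig) ^ 2 ≤ Y * κ + S * U ^ b * κ := by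
    rcases le_total R (τ / 4) with hRτ | hRτ
    · have := hinner R hR hRτ le_rfl
      have : 0 ≤ S * U ^ b * κ := by positivity
      linarith
    · rw [← intervalIntegral.integral_add_adjacent_intervals (b := τ / 4)
        (c3.intervalIntegrable _ _) (c3.intervalIntegrable _ _)]
      refine add_le_add (hinner _ (by positivity) le_rfl hRτ) ?_
      calc ∫ r in (τ / 4)..R, r ^ 2 * (∫ ω, |f (r • ω)| ^ 3 ∂sig) ^ 2
          ≤ ∫ r in (τ / 4)..R, S * U ^ b * ∫ ω, r ^ 2 * |f (r • ω)| ^ (p + 1) ∂sig := by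
            refine intervalIntegral.integral_mono_on hRτ (c3.intervalIntegrable _ _)
              ((cp.const_mul _).intervalIntegrable _ _) fun r hr => ?_
            have hr0 : 0 < r := lt_of_lt_of_le (by positivity) hr.1
            have g2 := hm4 r ⟨hr0.le, hr.2⟩
            have g4 : ∫ ω, f (r • ω) ^ 4 ∂sig ≤ U := by
              rw [hU, le_div_iff₀ (by positivity)]
              have : τ ^ 2 ≤ 16 * r ^ 2 := by nlinarith [hr.1]
              nlinarith [hm40 r]
            have g1 := sq_sphere_moment_three_le_rpow hfc hp hp5 r hUpos g4
            rw [integral_const_mul]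
            calc _ ≤ r ^ 2 * ((∫ ω, |f (r • ω)| ^ (p + 1) ∂sig) * (S * U ^ b)) := by gcongr
              _ = _ := by ring
        _ = S * U ^ b * shell (τ / 4) R (fun z => z.1 ^ 2 * |f (z.1 • z.2)| ^ (p + 1)) :=
            intervalIntegral.integral_const_mul _ _
        _ ≤ S * U ^ b * κ := by
            refine mul_le_mul_of_nonneg_left (le_trans ?_ (h3 R hR)) (by positivity)
            exact shell_mono_left (by positivity) cp' fun s _ ω _ => by positivity
  have hmain : X ≤ C * ((Y * κ + S * U ^ b * κ) + Y * κ) := by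
    calc X ≤ ∫ r in (0 : ℝ)..R, C * (r ^ 2 * (∫ ω, |f (r • ω)| ^ 3 ∂sig) ^ 2
          + Y * ∫ ω, ∑ k, (r * fderiv ℝ f (r • ω) (rotGen k ω)) ^ 2 ∂sig) := by
          refine intervalIntegral.integral_mono_on hR (c6.intervalIntegrable _ _)
            (((c3.fun_add (cn.const_mul Y)).const_mul C).intervalIntegrable _ _) fun r hr => ?_
          simp only
          rw [integral_const_mul]
          have g3 : 0 ≤ ∫ ω, ∑ k, (r * fderiv ℝ f (r • ω) (rotGen k ω)) ^ 2 ∂sig :=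
            integral_nonneg fun ω => by positivity
          have g5 := mul_le_mul_of_nonneg_right (hm4 r hr) g3
          calc _ ≤ r ^ 2 * _ := mul_le_mul_of_nonneg_left (hC f hf r) (sq_nonneg r)
            _ = C * (r ^ 2 * (∫ ω, |f (r • ω)| ^ 3 ∂sig) ^ 2 + (r ^ 2 * ∫ ω, f (r • ω) ^ 4 ∂sig)
                * ∫ ω, ∑ k, (r * fderiv ℝ f (r • ω) (rotGen k ω)) ^ 2 ∂sig) := by ring
            _ ≤ _ := by gcongr
      _ = C * ((∫ r in (0 : ℝ)..R, r ^ 2 * (∫ ω, |f (r • ω)| ^ 3 ∂sig) ^ 2)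
          + Y * shell 0 R (fun z => ∑ k, (z.1 * fderiv ℝ f (z.1 • z.2) (rotGen k z.2)) ^ 2)) := by
          rw [intervalIntegral.integral_const_mul, intervalIntegral.integral_add
            (c3.intervalIntegrable _ _) ((cn.const_mul Y).intervalIntegrable _ _),
            intervalIntegral.integral_const_mul]
          rfl
      _ ≤ _ := by
          gcongr
          exact h2 R hR
  have hfin : x ≤ (1 + 2 * A) * τ ^ (-δ) := by
    refine le_of_sq_le_rpow (κ := τ ^ (-γ)) (A := A) hτ hxpos.le hA0
      (by simp only [hb]; linarith) hδ hδb (by linarith) (by linarith) le_rfl ?_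
    rw [hxX]
    refine hmain.trans ?_
    have hxt : 0 ≤ x / τ ^ 2 := by positivity
    have eU : U ^ b = (64 * √K) ^ b * (x / τ ^ 2) ^ b := by
      rw [← mul_rpow (by positivity) hxt]; congr 1; rw [hU, hY]; ring
    set P := (x / τ ^ 2) ^ b
    set Q := (64 * √K) ^ b
    have hP : 0 ≤ P := by positivity
    have hQ : 0 ≤ Q := by positivity
    have e1 : C * ((Y * κ + S * U ^ b * κ) + Y * κ) = K * C * τ ^ (-γ) * (8 * √K * x + S * Q * P) := by
      rw [eU, hκ, hY]; ring
    rw [e1, hA]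
    have e2 : 8 * √K * x + S * Q * P ≤ (8 * √K + S * Q) * (x + P) := by
      have : 0 ≤ 8 * √K * P := by positivity
      have : 0 ≤ S * Q * x := by positivity
      linarith
    calc _ ≤ K * C * τ ^ (-γ) * ((8 * √K + S * Q) * (x + P)) := by gcongr
      _ = _ := by ring
  rw [← hxX]
  exact pow_le_pow_left₀ hxpos.le hfin 2

section kirchhoff
variable {p : ℝ} {Φ : ℝ × E3 → ℝ}

lemma snd_fderiv_symm (hΦ : ContDiff ℝ (⊤ : ℕ∞) Φ) (q v w : ℝ × E3) :
    fderiv ℝ (fderiv ℝ Φ) q v w = fderiv ℝ (fderiv ℝ Φ) q w v :=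
  (hΦ.contDiffAt.isSymmSndFDerivAt (by
    simp only [minSmoothness_of_isRCLikeNormedField]
    exact WithTop.coe_le_coe.2 (le_top : (2 : ℕ∞) ≤ ⊤))) v w

lemma IsSol.eq_polar (hΦ : IsSol p Φ) {t : ℝ} (ht : 0 ≤ t) (r : ℝ) {ω : E3} (hω : ‖ω‖ = 1) :
    fderiv ℝ (fderiv ℝ Φ) (pt ((t, r), ω)) (1, 0) (1, 0)
      - (fderiv ℝ (fderiv ℝ Φ) (pt ((t, r), ω)) (0, ω) (0, ω)
        + ∑ k, fderiv ℝ (fderiv ℝ Φ) (pt ((t, r), ω)) (0, rotGen k ω) (0, rotGen k ω))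
      + |Φ (pt ((t, r), ω))| ^ (p - 1) * Φ (pt ((t, r), ω)) = 0 := by
  have hpde := hΦ.eq t ht (r • ω)
  have htr := trace_eq_radial_add_rotGen
    ((ContinuousLinearMap.compL ℝ E3 (ℝ × E3) ℝ).flip (ContinuousLinearMap.inr ℝ ℝ E3) ∘L
      ((fderiv ℝ (fderiv ℝ Φ) (pt ((t, r), ω))) ∘L ContinuousLinearMap.inr ℝ ℝ E3))
    (fun x y => by simpa using snd_fderiv_symm hΦ.smooth _ (0, x) (0, y)) hω
  simp only [ContinuousLinearMap.comp_apply, ContinuousLinearMap.flip_apply,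
    ContinuousLinearMap.compL_apply, ContinuousLinearMap.inr_apply] at htr
  have hpt : pt ((t, r), ω) = (t, r • ω) := rfl
  rwa [← hpt, htr] at hpde

lemma sum_fderiv_rotGen_rotGen (z : (ℝ × ℝ) × E3) :
    ∑ k, fderiv ℝ Φ (pt z) (0, rotGen k (rotGen k z.2)) = -2 * fR Φ z := by
  have h1 : ∑ k, ((0 : ℝ), rotGen k (rotGen k z.2)) = (-2 : ℝ) • ((0 : ℝ), z.2) := by
    rw [Prod.smul_mk, ← sum_rotGen_rotGen, smul_zero]
    exact (map_sum (ContinuousLinearMap.inr ℝ ℝ E3) (fun k => rotGen k (rotGen k z.2)) _).symm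
  rw [← map_sum, h1, map_smul]; rfl

lemma hasDerivAt_psi_cone (hΦ : ContDiff ℝ (⊤ : ℕ∞) Φ) (T r : ℝ) (ω : E3) :
    HasDerivAt (fun r => psiT Φ ((T - r, r), ω) + psiR Φ ((T - r, r), ω))
      (2 * fR Φ ((T - r, r), ω) + r * (fderiv ℝ (fderiv ℝ Φ) (pt ((T - r, r), ω)) (0, ω) (0, ω)
        - fderiv ℝ (fderiv ℝ Φ) (pt ((T - r, r), ω)) (1, 0) (1, 0))) r := by
  have hc : HasDerivAt (fun r => pt ((T - r, r), ω)) (-(1, 0) + (0, ω)) r := by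
    have h1 : HasDerivAt (fun r : ℝ => (T - r, r • ω)) (-1, (1 : ℝ) • ω) r :=
      ((hasDerivAt_id r).const_sub T).prodMk ((hasDerivAt_id r).smul_const ω)
    have h2 : (-(1, 0) + (0, ω) : ℝ × E3) = (-1, (1 : ℝ) • ω) := by ext <;> simp
    rw [h2]; exact h1
  have hT : HasDerivAt (fun r => fT Φ ((T - r, r), ω)) _ r :=
    hasDerivAt_fderiv_apply hΦ hc (hasDerivAt_const r (1, 0))
  have hR : HasDerivAt (fun r => fR Φ ((T - r, r), ω)) _ r :=
    hasDerivAt_fderiv_apply hΦ hc (hasDerivAt_const r (0, ω))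
  have h : HasDerivAt (fun r => psiT Φ ((T - r, r), ω) + psiR Φ ((T - r, r), ω)) _ r :=
    ((hasDerivAt_id r).fun_mul hT).fun_add
      ((hasDerivAt_phi hΦ hc).fun_add ((hasDerivAt_id r).fun_mul hR))
  refine h.congr_deriv ?_
  simp only [map_add, map_neg, map_zero, add_apply, neg_apply, id, fT, fR]
  rw [snd_fderiv_symm hΦ _ (0, ω) (1, 0)]
  ring

/-- Kirchhoff's formula along the backward cone with vertex `(T, 0)`. -/
theorem kirchhoff (hp : 1 < p) (hΦ : IsSol p Φ) {T : ℝ} (hT : 0 ≤ T) :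
    sig.real Set.univ * Φ (T, 0)
      = (∫ ω, (psiT Φ ((0, T), ω) + psiR Φ ((0, T), ω)) ∂sig)
        - shell 0 T (fun z => z.1 * (|Φ (T - z.1, z.1 • z.2)| ^ (p - 1) * Φ (T - z.1, z.1 • z.2))) := by
  have hs := hΦ.smooth
  have hpsi : ContDiff ℝ 1 fun z => psiT Φ z + psiR Φ z := (contDiff_psiT hs).add (contDiff_psiR hs)
  have h := sphere_sub_eq_shell
    (G := fun z => psiT Φ ((T - z.1, z.1), z.2) + psiR Φ ((T - z.1, z.1), z.2))
    (G' := fun z => 2 * fR Φ ((T - z.1, z.1), z.2) + z.1 *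
      (fderiv ℝ (fderiv ℝ Φ) (pt ((T - z.1, z.1), z.2)) (0, z.2) (0, z.2)
        - fderiv ℝ (fderiv ℝ Φ) (pt ((T - z.1, z.1), z.2)) (1, 0) (1, 0)))
    (hpsi.comp (g := fun z => psiT Φ z + psiR Φ z)
      (f := fun z : ℝ × E3 => ((T - z.1, z.1), z.2)) (by fun_prop))
    (fun r ω => hasDerivAt_psi_cone hs T r ω) 0 T
  simp only [sub_self, sub_zero] at h
  have h0 : ∫ ω, (psiT Φ ((T, 0), ω) + psiR Φ ((T, 0), ω)) ∂sig = sig.real Set.univ * Φ (T, 0) := by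
    simp [psiT, psiR, pt]
  rw [h0] at h
  have hJ : ∀ r k, ContDiff ℝ 1 fun ω => fJ k Φ ((T - r, r), ω) := fun r k =>
    (contDiff_fJ hs k).comp (by fun_prop)
  have hJd : ∀ r k ω, fderiv ℝ (fun ω => fJ k Φ ((T - r, r), ω)) ω (rotGen k ω)
      = r * fderiv ℝ (fderiv ℝ Φ) (pt ((T - r, r), ω)) (0, rotGen k ω) (0, rotGen k ω)
        + fderiv ℝ Φ (pt ((T - r, r), ω)) (0, rotGen k (rotGen k ω)) := by
    intro r k ω
    have h1 := ((hJ r k).hasDerivAt_curve (hasDerivAt_rotGen_curve ω k)).unique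
      (hasDerivAt_fJ_angle hs (T - r) r ω k)
    simpa only [zero_smul, add_zero] using h1
  have hN : Continuous fun z : ℝ × E3 =>
      z.1 * (|Φ (T - z.1, z.1 • z.2)| ^ (p - 1) * Φ (T - z.1, z.1 • z.2)) := by
    have h1 : Continuous fun z : ℝ × E3 => Φ (T - z.1, z.1 • z.2) :=
      hs.continuous.comp (by fun_prop)
    exact continuous_fst.mul ((h1.abs.rpow_const fun _ => Or.inr (by linarith)).mul h1)
  rw [sub_eq_iff_eq_add] at h
  rw [eq_sub_iff_add_eq, h, add_comm]
  congr 1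
  refine intervalIntegral.integral_congr fun r hr => ?_
  rw [Set.uIcc_of_le hT] at hr
  have hg' : ∀ k, Continuous fun ω =>
      fderiv ℝ (fun ω => fJ k Φ ((T - r, r), ω)) ω (rotGen k ω) := fun k =>
    ((hJ r k).continuous_fderiv (by norm_num)).clm_apply (rotGen k).continuous
  have hz : ∫ ω, ∑ k, fderiv ℝ (fun ω => fJ k Φ ((T - r, r), ω)) ω (rotGen k ω) ∂sig = 0 := by
    rw [integral_finsetSum _ fun k _ => (hg' k).integrable_sig]
    exact Finset.sum_eq_zero fun k _ => integral_fderiv_rotGen (hJ r k) k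
  have hNr : Continuous fun ω : E3 =>
      r * (|Φ (T - r, r • ω)| ^ (p - 1) * Φ (T - r, r • ω)) := hN.comp (by fun_prop : Continuous fun ω : E3 => (r, ω))
  have hsub := integral_sub hNr.integrable_sig
    (continuous_finsetSum Finset.univ fun k _ => hg' k).integrable_sig
  rw [hz, sub_zero] at hsub
  simp only
  rw [← hsub]
  refine integral_congr_ae ?_
  filter_upwards [ae_sig] with ω hω
  have h1 := hΦ.eq_polar (sub_nonneg.2 hr.2) r hω
  have h2 := sum_fderiv_rotGen_rotGen (Φ := Φ) ((T - r, r), ω)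
  have hpt : pt ((T - r, r), ω) = (T - r, r • ω) := rfl
  simp only [hJd, Finset.sum_add_distrib, ← Finset.mul_sum]
  simp only at h2
  rw [h2, ← hpt]
  linear_combination r * h1

end kirchhoff

/-- `f` is `C¹` and both `‖f‖²_{L²}` and `‖∇f‖²_{L²}` are at most `K`. -/
structure IsHOne (K : ℝ) (f : E3 → ℝ) : Prop where
  smooth : ContDiff ℝ 1 f
  sq_le : ∫⁻ x, ENNReal.ofReal (f x ^ 2) ≤ ENNReal.ofReal K
  fderiv_le : ∫⁻ x, ENNReal.ofReal (‖fderiv ℝ f x‖ ^ 2) ≤ ENNReal.ofReal K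

lemma IsHOne.translate {K : ℝ} {f : E3 → ℝ} (h : IsHOne K f) (a : E3) :
    IsHOne K fun x => f (x + a) where
  smooth := h.smooth.comp (contDiff_id.add contDiff_const)
  sq_le := (lintegral_add_right_eq_self (fun x => ENNReal.ofReal (f x ^ 2)) a).trans_le h.sq_le
  fderiv_le := by
    simp only [fderiv_comp_add_right]
    exact (lintegral_add_right_eq_self (fun x => ENNReal.ofReal (‖fderiv ℝ f x‖ ^ 2)) a).trans_le
      h.fderiv_le

lemma IsHOne.trace {K : ℝ} {f : E3 → ℝ} (h : IsHOne K f) (hK : 0 ≤ K) {T : ℝ} (hT : 0 ≤ T) :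
    T * (∫ ω, f (T • ω) ^ 2 ∂sig) ≤ K ∧ T ^ 2 * (∫ ω, f (T • ω) ^ 2 ∂sig) ≤ 2 * K := by
  have hf := h.smooth
  have hfc := hf.continuous
  have hfd := hf.continuous_fderiv (by norm_num)
  have crad := continuous_radial hf
  have c1 : ContDiff ℝ 1 fun z : ℝ × E3 => f (z.1 • z.2) := hf.comp (contDiff_fst.smul contDiff_snd)
  have c1' := c1.continuous
  have h2 : ∀ R, 0 ≤ R → shell 0 R (fun z => z.1 ^ 2 * f (z.1 • z.2) ^ 2) ≤ K := fun R hR =>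
    shell_le_of_lintegral_le (G := fun x => f x ^ 2) (by fun_prop) (fun x => sq_nonneg _) hK h.sq_le hR
  have h3 : ∀ R, 0 ≤ R → shell 0 R (fun z => z.1 ^ 2 * (fderiv ℝ f (z.1 • z.2) z.2) ^ 2) ≤ K := by
    intro R hR
    refine le_trans ?_ (shell_le_of_lintegral_le (G := fun x => ‖fderiv ℝ f x‖ ^ 2) (by fun_prop)
      (fun x => sq_nonneg _) hK h.fderiv_le hR)
    refine shell_mono hR (by fun_prop) (by fun_prop) fun r _ ω hω => ?_
    exact mul_le_mul_of_nonneg_left (sq_clm_apply_le _ hω.le) (sq_nonneg r)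
  have hcs : Continuous fun r : ℝ => ∫ ω, f (r • ω) ^ 2 ∂sig :=
    continuous_sphere (F := fun z => f (z.1 • z.2) ^ 2) (by fun_prop)
  have h0 : ∀ r : ℝ, 0 ≤ ∫ ω, f (r • ω) ^ 2 ∂sig := fun r => integral_nonneg fun ω => sq_nonneg _
  have hfar : ∀ ε, 0 < ε → ∃ s, T ≤ s ∧ 1 ≤ s ∧ s ^ 2 * (∫ ω, f (s • ω) ^ 2 ∂sig) ≤ ε := by
    intro ε hε
    obtain ⟨s, hs, hs2⟩ := exists_mul_le_of_integral_le
      (g := fun r => r ^ 2 * ∫ ω, f (r • ω) ^ 2 ∂sig) (A := K) (by fun_prop)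
      (fun r _ => mul_nonneg (sq_nonneg r) (h0 r))
      (fun R hR => by
        have := h2 R hR
        simp only [shell, integral_const_mul] at this
        exact this) (S := T + 1) (by linarith) hε
    refine ⟨s, by linarith, by linarith, le_trans ?_ hs2⟩
    exact le_mul_of_one_le_left (mul_nonneg (sq_nonneg s) (h0 s)) (by linarith)
  constructor
  · refine le_of_forall_pos_le_add fun ε hε => ?_
    obtain ⟨s, hTs, hs1, hs⟩ := hfar ε hε
    have hd := sphere_sub_eq_shell (G := fun z => z.1 * f (z.1 • z.2) ^ 2)
      (G' := fun z => f (z.1 • z.2) ^ 2 + z.1 * (2 * f (z.1 • z.2) * fderiv ℝ f (z.1 • z.2) z.2))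
      (contDiff_fst.mul (c1.pow 2)) (fun r ω => by
        simpa using (hasDerivAt_id r).fun_mul ((hasDerivAt_ray hf r ω).fun_pow 2)) T s
    simp only [integral_const_mul] at hd
    have hle : shell T s (fun z => (-1) * (z.1 ^ 2 * (fderiv ℝ f (z.1 • z.2) z.2) ^ 2)) ≤ shell T s
        (fun z => f (z.1 • z.2) ^ 2 + z.1 * (2 * f (z.1 • z.2) * fderiv ℝ f (z.1 • z.2) z.2)) := by
      refine shell_mono hTs (by fun_prop) (by fun_prop) fun r _ ω _ => ?_
      simp only
      nlinarith [sq_nonneg (f (r • ω) + r * fderiv ℝ f (r • ω) ω)]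
    rw [shell_const_mul] at hle
    have hl := shell_mono_left hT (b := T) (c := s)
      (F := fun z => z.1 ^ 2 * (fderiv ℝ f (z.1 • z.2) z.2) ^ 2) (by fun_prop)
      fun r _ ω _ => by positivity
    have := h3 s (by linarith)
    have h5 : s * (∫ ω, f (s • ω) ^ 2 ∂sig) ≤ s ^ 2 * (∫ ω, f (s • ω) ^ 2 ∂sig) :=
      mul_le_mul_of_nonneg_right (by nlinarith) (h0 s)
    linarith
  · refine le_of_forall_pos_le_add fun ε hε => ?_
    obtain ⟨s, hTs, hs1, hs⟩ := hfar ε hε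
    have hd := sphere_sub_eq_shell (G := fun z => z.1 ^ 2 * f (z.1 • z.2) ^ 2)
      (G' := fun z => 2 * z.1 * f (z.1 • z.2) ^ 2
        + z.1 ^ 2 * (2 * f (z.1 • z.2) * fderiv ℝ f (z.1 • z.2) z.2))
      ((contDiff_fst.pow 2).mul (c1.pow 2)) (fun r ω => by
        simpa using ((hasDerivAt_id r).fun_pow 2).fun_mul ((hasDerivAt_ray hf r ω).fun_pow 2)) T s
    simp only [integral_const_mul] at hd
    have hle : shell T s (fun z => (-1) * (z.1 ^ 2 * f (z.1 • z.2) ^ 2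
        + z.1 ^ 2 * (fderiv ℝ f (z.1 • z.2) z.2) ^ 2)) ≤ shell T s
        (fun z => 2 * z.1 * f (z.1 • z.2) ^ 2
        + z.1 ^ 2 * (2 * f (z.1 • z.2) * fderiv ℝ f (z.1 • z.2) z.2)) := by
      refine shell_mono hTs (by fun_prop) (by fun_prop) fun r hr ω _ => ?_
      simp only
      have : 0 ≤ r * f (r • ω) ^ 2 := mul_nonneg (hT.trans hr.1) (sq_nonneg _)
      nlinarith [mul_nonneg (sq_nonneg r) (sq_nonneg (f (r • ω) + fderiv ℝ f (r • ω) ω))]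
    rw [shell_const_mul, shell_add (F := fun z => z.1 ^ 2 * f (z.1 • z.2) ^ 2)
      (G := fun z => z.1 ^ 2 * (fderiv ℝ f (z.1 • z.2) z.2) ^ 2) (by fun_prop) (by fun_prop)] at hle
    have hl := shell_mono_left hT (b := T) (c := s)
      (F := fun z => z.1 ^ 2 * (fderiv ℝ f (z.1 • z.2) z.2) ^ 2) (by fun_prop)
      fun r _ ω _ => by positivity
    have hl2 := shell_mono_left hT (b := T) (c := s)
      (F := fun z => z.1 ^ 2 * f (z.1 • z.2) ^ 2) (by fun_prop) fun r _ ω _ => by positivity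
    have := h3 s (by linarith)
    have := h2 s (by linarith)
    linarith

lemma exists_mul_rpow_le (A : ℝ) {a ε : ℝ} (ha : 0 < a) (hε : 0 < ε) :
    ∃ δ > 0, ∀ ρ, 0 ≤ ρ → ρ ≤ δ → A * ρ ^ a ≤ ε := by
  refine ⟨(ε / (|A| + 1)) ^ (1 / a), by positivity, fun ρ h0 hρ => ?_⟩
  have h1 : ρ ^ a ≤ ε / (|A| + 1) := by
    have := rpow_le_rpow h0 hρ ha.le
    rwa [← rpow_mul (by positivity), one_div, inv_mul_cancel₀ ha.ne', rpow_one] at this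
  have h2 : (|A| + 1) * ρ ^ a ≤ ε := by
    rw [le_div_iff₀ (by positivity)] at h1
    linarith
  have := rpow_nonneg h0 a
  nlinarith [le_abs_self A]

/-- On a cone, the potential energy flux bounds the Kirchhoff source term up to a small multiple of
the supremum. -/
lemma exists_shell_mul_rpow_le {p E ε : ℝ} (hp : 3 < p) (hp5 : p < 5) (hE : 0 ≤ E) (hε : 0 < ε) :
    ∃ C, 0 ≤ C ∧ ∀ (u : ℝ × E3 → ℝ) (T M : ℝ), Continuous u → 0 ≤ T →
      (∀ r ∈ Set.Icc 0 T, ∀ ω, ‖ω‖ = 1 → |u (r, ω)| ≤ M) → 0 ≤ M →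
      shell 0 T (fun z => z.1 ^ 2 * |u z| ^ (p + 1)) ≤ E →
      shell 0 T (fun z => z.1 * |u z| ^ p) ≤ C + ε * M := by
  set S := sig.real Set.univ with hS
  have hS0 : 0 ≤ S := measureReal_nonneg
  set lam := ε / (2 * (E + 1)) with hlam
  have hlam0 : 0 < lam := by positivity
  obtain ⟨δ, hδ, hδ'⟩ := exists_mul_rpow_le (S * lam ^ (-((p - 1) / 2)) * (2 / (5 - p)))
    (a := (5 - p) / 2) (ε := ε / 2) (by linarith) (by linarith)
  refine ⟨E + S * (δ ^ (2 - p) / (p - 2)), by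
    have : 0 < p - 2 := by linarith
    positivity, fun u T M hu hT huM hM huE => ?_⟩
  have hp0 : 0 ≤ p := by linarith
  have hp1 : 0 ≤ p + 1 := by linarith
  have hg : Continuous fun r => ∫ ω, r * |u (r, ω)| ^ p ∂sig :=
    continuous_sphere (F := fun z => z.1 * |u z| ^ p) (by fun_prop)
  have hh : Continuous fun r => ∫ ω, r ^ 2 * |u (r, ω)| ^ (p + 1) ∂sig :=
    continuous_sphere (F := fun z => z.1 ^ 2 * |u z| ^ (p + 1)) (by fun_prop)
  have hconst : ∀ c : ℝ, ∫ _ω : E3, c ∂sig = S * c := fun c => by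
    rw [integral_const, smul_eq_mul]
  set ρ := min δ T with hρ
  have hρ0 : 0 ≤ ρ := le_min hδ.le hT
  have hρT : ρ ≤ T := min_le_right _ _
  have near : shell 0 ρ (fun z => z.1 * |u z| ^ p) ≤ ε * M := by
    have hpt : ∀ r ∈ Set.Icc 0 ρ, ∫ ω, r * |u (r, ω)| ^ p ∂sig
        ≤ M * (lam * (∫ ω, r ^ 2 * |u (r, ω)| ^ (p + 1) ∂sig)
          + S * lam ^ (-((p - 1) / 2)) * r ^ ((3 - p) / 2)) := by
      intro r hr
      rcases hr.1.eq_or_lt with rfl | hr0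
      · simp only [zero_mul, integral_zero, ne_eq, OfNat.ofNat_ne_zero, not_false_eq_true, zero_pow,
          mul_zero, zero_add]
        exact mul_nonneg hM (mul_nonneg (by positivity) (rpow_nonneg le_rfl _))
      have hb : M * (lam * (∫ ω, r ^ 2 * |u (r, ω)| ^ (p + 1) ∂sig)
          + S * lam ^ (-((p - 1) / 2)) * r ^ ((3 - p) / 2))
          = ∫ ω, M * (lam * (r ^ 2 * |u (r, ω)| ^ (p + 1))
            + lam ^ (-((p - 1) / 2)) * r ^ ((3 - p) / 2)) ∂sig := by
        rw [integral_const_mul M, integral_add (Continuous.integrable_sig (by fun_prop))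
          (Continuous.integrable_sig (by fun_prop)), integral_const_mul lam, hconst]
        ring
      rw [hb]
      refine integral_sig_mono (by fun_prop) (by fun_prop) fun ω hω => ?_
      have ha := huM r ⟨hr.1, hr.2.trans hρT⟩ ω hω
      have ha0 := abs_nonneg (u (r, ω))
      generalize |u (r, ω)| = a at ha ha0
      rcases ha0.eq_or_lt with rfl | ha0'
      · rw [zero_rpow (by linarith), zero_rpow (by linarith)]
        simp only [mul_zero, zero_add]
        positivity
      have e1 : a ^ p = a ^ (p - 1) * a := by
        rw [← rpow_add_one ha0'.ne']; ring_nf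
      have e2 : a ^ (p + 1) = a ^ (p - 1) * a ^ 2 := by
        rw [← rpow_natCast, ← rpow_add ha0']; congr 1; push_cast; ring
      have hq := rpow_pos_of_pos ha0' (p - 1)
      have key : r * a ^ (p - 1) ≤ lam * (r ^ 2 * a ^ (p + 1))
          + lam ^ (-((p - 1) / 2)) * r ^ ((3 - p) / 2) := by
        have hpos : 0 ≤ lam ^ (-((p - 1) / 2)) * r ^ ((3 - p) / 2) := by positivity
        rcases le_total 1 (lam * r * a ^ 2) with h | h
        · have : r * a ^ (p - 1) * 1 ≤ r * a ^ (p - 1) * (lam * r * a ^ 2) :=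
            mul_le_mul_of_nonneg_left h (by positivity)
          rw [e2]
          linarith
        · have h1 : a ^ (p - 1) ≤ (lam * r) ^ (-((p - 1) / 2)) := by
            have h2 : a ^ 2 ≤ (lam * r)⁻¹ := by
              rw [le_inv_comm₀ (by positivity) (by positivity), ← one_div,
                le_div_iff₀ (by positivity)]
              exact h
            have h3 := rpow_le_rpow (by positivity) h2 (z := (p - 1) / 2) (by linarith)
            rw [← rpow_natCast, ← rpow_mul ha0, inv_rpow (by positivity),
              ← rpow_neg (by positivity)] at h3
            convert h3 using 2
            push_cast; ring
          rw [mul_rpow hlam0.le hr0.le] at h1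
          have h4 : r * (lam ^ (-((p - 1) / 2)) * r ^ (-((p - 1) / 2)))
              = lam ^ (-((p - 1) / 2)) * r ^ ((3 - p) / 2) := by
            have : r ^ ((3 - p) / 2) = r ^ (-((p - 1) / 2)) * r := by
              rw [← rpow_add_one hr0.ne']; ring_nf
            rw [this]; ring
          have h5 := mul_le_mul_of_nonneg_left h1 hr0.le
          rw [h4] at h5
          have : 0 ≤ lam * (r ^ 2 * a ^ (p + 1)) := by positivity
          linarith
      calc r * a ^ p = (r * a ^ (p - 1)) * a := by rw [e1]; ring
        _ ≤ (r * a ^ (p - 1)) * M := mul_le_mul_of_nonneg_left ha (by positivity)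
        _ ≤ _ := by rw [mul_comm _ M]; exact mul_le_mul_of_nonneg_left key hM
    have hii : IntervalIntegrable (fun r : ℝ => r ^ ((3 - p) / 2)) volume 0 ρ :=
      intervalIntegral.intervalIntegrable_rpow' (by linarith)
    have h1 := intervalIntegral.integral_mono_on hρ0 (hg.intervalIntegrable 0 ρ)
      (((hh.intervalIntegrable 0 ρ).const_mul lam).add (hii.const_mul _) |>.const_mul M) hpt
    rw [intervalIntegral.integral_const_mul, intervalIntegral.integral_add
      ((hh.intervalIntegrable 0 ρ).const_mul lam) (hii.const_mul _),
      intervalIntegral.integral_const_mul, intervalIntegral.integral_const_mul,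
      integral_rpow (Or.inl (by linarith)), zero_rpow (by linarith)] at h1
    have h2 : ∫ r in (0 : ℝ)..ρ, ∫ ω, r ^ 2 * |u (r, ω)| ^ (p + 1) ∂sig ≤ E :=
      (shell_mono_right hρT (F := fun z => z.1 ^ 2 * |u z| ^ (p + 1)) (by fun_prop)
        fun r _ ω _ => by positivity).trans huE
    have h3 : lam * (∫ r in (0 : ℝ)..ρ, ∫ ω, r ^ 2 * |u (r, ω)| ^ (p + 1) ∂sig) ≤ ε / 2 := by
      refine (mul_le_mul_of_nonneg_left h2 hlam0.le).trans ?_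
      rw [hlam, div_mul_eq_mul_div, div_le_div_iff₀ (by positivity) (by norm_num)]
      nlinarith
    have h4 := hδ' ρ hρ0 (min_le_left _ _)
    have h5 : S * lam ^ (-((p - 1) / 2)) * ((ρ ^ ((3 - p) / 2 + 1) - 0) / ((3 - p) / 2 + 1))
        = S * lam ^ (-((p - 1) / 2)) * (2 / (5 - p)) * ρ ^ ((5 - p) / 2) := by
      have e : (3 - p) / 2 + 1 = (5 - p) / 2 := by ring
      have : 5 - p ≠ 0 := by linarith
      rw [e]
      field_simp
      ring
    rw [h5] at h1
    refine h1.trans ?_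
    rw [mul_comm ε M]
    exact mul_le_mul_of_nonneg_left (by linarith) hM
  have far : shell ρ T (fun z => z.1 * |u z| ^ p) ≤ E + S * (δ ^ (2 - p) / (p - 2)) := by
    have hp2 : 0 < p - 2 := by linarith
    rcases le_total T δ with h | h
    · have : ρ = T := min_eq_right h
      rw [this, shell, intervalIntegral.integral_same]
      positivity
    have e : ρ = δ := min_eq_left h
    rw [e] at hρT ⊢
    have hne : (0 : ℝ) ∉ Set.uIcc δ T := by
      rw [Set.uIcc_of_le hρT]
      exact fun h => absurd h.1 (by linarith)
    have hii : IntervalIntegrable (fun r : ℝ => r ^ (1 - p)) volume δ T :=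
      intervalIntegral.intervalIntegrable_rpow (Or.inr hne)
    have h1 := intervalIntegral.integral_mono_on hρT (hg.intervalIntegrable δ T)
      ((hh.intervalIntegrable δ T).add (hii.const_mul S)) fun r hr => by
        have hr0 : 0 < r := hδ.trans_le hr.1
        have hb : (∫ ω, r ^ 2 * |u (r, ω)| ^ (p + 1) ∂sig) + S * r ^ (1 - p)
            = ∫ ω, (r ^ 2 * |u (r, ω)| ^ (p + 1) + r ^ (1 - p)) ∂sig := by
          rw [integral_add (Continuous.integrable_sig (by fun_prop))
            (Continuous.integrable_sig (by fun_prop)), hconst]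
        rw [hb]
        refine integral_sig_mono (by fun_prop) (by fun_prop) fun ω hω => ?_
        have ha0 := abs_nonneg (u (r, ω))
        generalize |u (r, ω)| = a at ha0
        rcases le_total 1 (r * a) with h | h
        · have ha0' : 0 < a := by
            rcases ha0.eq_or_lt with rfl | h'
            · norm_num at h
            · exact h'
          rw [rpow_add_one ha0'.ne']
          have : r * a ^ p * 1 ≤ r * a ^ p * (r * a) := mul_le_mul_of_nonneg_left h (by positivity)
          have h0 := rpow_nonneg hr0.le (1 - p)
          nlinarith
        · have h2 : a ≤ r⁻¹ := by rwa [← one_div, le_div_iff₀ hr0, mul_comm]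
          have h3 := rpow_le_rpow ha0 h2 (z := p) (by linarith)
          rw [inv_rpow hr0.le, ← rpow_neg hr0.le] at h3
          have h4 : r * r ^ (-p) = r ^ (1 - p) := by
            rw [sub_eq_add_neg, rpow_add hr0, rpow_one]
          have h5 := mul_le_mul_of_nonneg_left h3 hr0.le
          rw [h4] at h5
          have : 0 ≤ r ^ 2 * a ^ (p + 1) := by positivity
          linarith
    rw [intervalIntegral.integral_add (hh.intervalIntegrable δ T) (hii.const_mul S),
      intervalIntegral.integral_const_mul, integral_rpow (Or.inr ⟨by linarith, hne⟩)] at h1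
    have h2 : ∫ r in δ..T, ∫ ω, r ^ 2 * |u (r, ω)| ^ (p + 1) ∂sig ≤ E :=
      (shell_mono_left hδ.le (F := fun z => z.1 ^ 2 * |u z| ^ (p + 1)) (by fun_prop)
        fun r _ ω _ => by positivity).trans huE
    have h3 : (T ^ (1 - p + 1) - δ ^ (1 - p + 1)) / (1 - p + 1) ≤ δ ^ (2 - p) / (p - 2) := by
      have e' : 1 - p + 1 = -(p - 2) := by ring
      have e'' : 2 - p = -(p - 2) := by ring
      rw [e', e'', div_neg, ← neg_div]
      have := rpow_nonneg hT (-(p - 2))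
      gcongr
      linarith
    have := mul_le_mul_of_nonneg_left h3 hS0
    exact h1.trans (by linarith)
  rw [← shell_add_adjacent (a := 0) (b := ρ) (c := T) (by fun_prop)]
  linarith

lemma clm_apply_eq_sum (L : E3 →L[ℝ] ℝ) (v : E3) :
    L v = ∑ i, v i * L (EuclideanSpace.single i 1) := by
  conv_lhs => rw [← (EuclideanSpace.basisFun (Fin 3) ℝ).sum_repr v]
  simp

lemma sq_norm_clm_le (L : E3 →L[ℝ] ℝ) : ‖L‖ ^ 2 ≤ ∑ i, L (EuclideanSpace.single i 1) ^ 2 := by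
  have h : ‖L‖ ≤ √(∑ i, L (EuclideanSpace.single i 1) ^ 2) := by
    refine L.opNorm_le_bound (sqrt_nonneg _) fun v => ?_
    rw [EuclideanSpace.norm_eq, ← sqrt_mul (Finset.sum_nonneg fun i _ => sq_nonneg _),
      Real.norm_eq_abs]
    refine abs_le_sqrt ?_
    rw [clm_apply_eq_sum L v]
    refine (Finset.sum_mul_sq_le_sq_mul_sq _ _ _).trans_eq ?_
    simp only [Real.norm_eq_abs, sq_abs]
    ring
  calc ‖L‖ ^ 2 ≤ √(∑ i, L (EuclideanSpace.single i 1) ^ 2) ^ 2 := by gcongr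
    _ = _ := sq_sqrt (Finset.sum_nonneg fun i _ => sq_nonneg _)

lemma sig_real_univ_pos : 0 < sig.real Set.univ := by
  rw [measureReal_def, ENNReal.toReal_pos_iff]
  refine ⟨pos_iff_ne_zero.2 fun h => ?_, measure_lt_top _ _⟩
  have h1 := lintegral_polar (F := fun _ => 1) measurable_const
  simp [h] at h1

/-- The Cauchy data of `Φ` at `t = 0` have finite potential energy and `H¹` first derivatives. -/
structure HasData (p K : ℝ) (Φ : ℝ × E3 → ℝ) : Prop where
  potential : ∫⁻ x, ENNReal.ofReal (|Φ (0, x)| ^ (p + 1)) ≤ ENNReal.ofReal K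
  spatial : ∀ i : Fin 3, IsHOne K fun x => fderiv ℝ Φ (0, x) (0, EuclideanSpace.single i 1)
  time : IsHOne K fun x => fderiv ℝ Φ (0, x) (1, 0)

section translate
variable {p K : ℝ} {Φ : ℝ × E3 → ℝ}

lemma fderiv_translate (Φ : ℝ × E3 → ℝ) (a : E3) :
    fderiv ℝ (fun q => Φ (q + (0, a))) = fun q => fderiv ℝ Φ (q + (0, a)) := by
  ext1 q
  rw [fderiv_comp_add_right]

lemma HasData.translate (h : HasData p K Φ) (a : E3) :
    HasData p K fun q => Φ (q + (0, a)) where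
  potential := by
    simp only [Prod.mk_add_mk, add_zero]
    exact (lintegral_add_right_eq_self (fun x => ENNReal.ofReal (|Φ (0, x)| ^ (p + 1))) a).trans_le
      h.potential
  spatial i := by
    simp only [fderiv_translate, Prod.mk_add_mk, add_zero]
    exact (h.spatial i).translate a
  time := by
    simp only [fderiv_translate, Prod.mk_add_mk, add_zero]
    exact h.time.translate a

lemma IsSol.translate (h : IsSol p Φ) (a : E3) : IsSol p fun q => Φ (q + (0, a)) where
  smooth := h.smooth.comp (contDiff_id.add contDiff_const)
  eq t ht x := by
    have := h.eq t ht (x + a)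
    simp only [fderiv_translate, fderiv_comp_add_right, Prod.mk_add_mk, add_zero]
    exact this

end translate

section bounds
variable {p K : ℝ} {Φ : ℝ × E3 → ℝ}

lemma HasData.shell_pot_le (hp : 1 < p) (hK : 0 ≤ K) (hΦ : ContDiff ℝ (⊤ : ℕ∞) Φ)
    (h : HasData p K Φ) {R : ℝ} (hR : 0 ≤ R) :
    shell 0 R (fun z => z.1 ^ 2 * |Φ (0, z.1 • z.2)| ^ (p + 1)) ≤ 3 * K := by
  have hp1 : 0 ≤ p + 1 := by linarith
  have hc := hΦ.continuous
  have := shell_le_of_lintegral_le (G := fun x => |Φ (0, x)| ^ (p + 1)) (by fun_prop)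
    (fun x => by positivity) hK h.potential hR
  linarith

lemma HasData.shell_time_le (hK : 0 ≤ K) (h : HasData p K Φ) {R : ℝ} (hR : 0 ≤ R) :
    shell 0 R (fun z => z.1 ^ 2 * fderiv ℝ Φ (0, z.1 • z.2) (1, 0) ^ 2) ≤ 3 * K := by
  have hc := h.time.smooth.continuous
  have := shell_le_of_lintegral_le (G := fun x => fderiv ℝ Φ (0, x) (1, 0) ^ 2) (by fun_prop)
    (fun x => by positivity) hK h.time.sq_le hR
  linarith

lemma HasData.shell_fderiv_le (hK : 0 ≤ K) (hΦ : ContDiff ℝ (⊤ : ℕ∞) Φ)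
    (h : HasData p K Φ) {R : ℝ} (hR : 0 ≤ R) :
    shell 0 R (fun z => z.1 ^ 2 * ‖fderiv ℝ (fun x => Φ (0, x)) (z.1 • z.2)‖ ^ 2) ≤ 3 * K := by
  have h1 : ContDiff ℝ 1 Φ := hΦ.of_le (by exact_mod_cast (le_top : (1 : ℕ∞) ≤ ⊤))
  have hcd := (contDiff_slice h1 0).continuous_fderiv (by norm_num)
  have hs : ∀ i : Fin 3, Continuous fun x => fderiv ℝ Φ (0, x) (0, EuclideanSpace.single i 1) :=
    fun i => (h.spatial i).smooth.continuous
  have hc : ∀ i : Fin 3, Continuous fun z : ℝ × E3 =>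
      z.1 ^ 2 * fderiv ℝ Φ (0, z.1 • z.2) (0, EuclideanSpace.single i 1) ^ 2 := fun i => by
    have : Continuous fun z : ℝ × E3 => fderiv ℝ Φ (0, z.1 • z.2) (0, EuclideanSpace.single i 1) :=
      (hs i).comp (g := fun x => fderiv ℝ Φ (0, x) (0, EuclideanSpace.single i 1))
        (f := fun z : ℝ × E3 => z.1 • z.2) (by fun_prop)
    fun_prop
  have hi : ∀ i : Fin 3, shell 0 R (fun z =>
      z.1 ^ 2 * fderiv ℝ Φ (0, z.1 • z.2) (0, EuclideanSpace.single i 1) ^ 2) ≤ K := fun i => by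
    have := hs i
    exact shell_le_of_lintegral_le
      (G := fun x => fderiv ℝ Φ (0, x) (0, EuclideanSpace.single i 1) ^ 2) (by fun_prop)
      (fun x => by positivity) hK (h.spatial i).sq_le hR
  have hc0 := hc 0
  have hc1 := hc 1
  have hc2 := hc 2
  have hle : shell 0 R (fun z => z.1 ^ 2 * ‖fderiv ℝ (fun x => Φ (0, x)) (z.1 • z.2)‖ ^ 2)
      ≤ shell 0 R (fun z => z.1 ^ 2 * fderiv ℝ Φ (0, z.1 • z.2) (0, EuclideanSpace.single 0 1) ^ 2
        + z.1 ^ 2 * fderiv ℝ Φ (0, z.1 • z.2) (0, EuclideanSpace.single 1 1) ^ 2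
        + z.1 ^ 2 * fderiv ℝ Φ (0, z.1 • z.2) (0, EuclideanSpace.single 2 1) ^ 2) := by
    refine shell_mono hR (by fun_prop) (by fun_prop) fun r _ ω _ => ?_
    have := mul_le_mul_of_nonneg_left
      (sq_norm_clm_le (fderiv ℝ (fun x => Φ (0, x)) (r • ω))) (sq_nonneg r)
    simp only [fderiv_slice h1, Fin.sum_univ_three] at this
    simp only
    linarith
  rw [shell_add (by fun_prop) (by fun_prop), shell_add (by fun_prop) (by fun_prop)] at hle
  linarith [hi 0, hi 1, hi 2]

lemma abs_le_of_sq_le_mul {x S B : ℝ} (h : x ^ 2 ≤ S * B) : |x| ≤ √(S * B) := abs_le_sqrt h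

lemma sq_integral_sig_le {f : E3 → ℝ} (hf : Continuous f) :
    (∫ ω, f ω ∂sig) ^ 2 ≤ sig.real Set.univ * ∫ ω, f ω ^ 2 ∂sig := by
  simpa using sq_integral_sig_mul_le (f := fun _ => 1) continuous_const hf

lemma HasData.radial_trace_le (hK : 0 ≤ K) (hΦ : ContDiff ℝ (⊤ : ℕ∞) Φ) (h : HasData p K Φ)
    {T : ℝ} (hT : 0 ≤ T) :
    T * (∫ ω, fderiv ℝ Φ (0, T • ω) (0, ω) ^ 2 ∂sig) ≤ 3 * K ∧
      T ^ 2 * (∫ ω, fderiv ℝ Φ (0, T • ω) (0, ω) ^ 2 ∂sig) ≤ 6 * K := by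
  have h1 : ContDiff ℝ 1 Φ := hΦ.of_le (by exact_mod_cast (le_top : (1 : ℕ∞) ≤ ⊤))
  have hcd := h1.continuous_fderiv (by norm_num)
  have hc : ∀ i : Fin 3, Continuous fun ω : E3 =>
      fderiv ℝ Φ (0, T • ω) (0, EuclideanSpace.single i 1) ^ 2 := fun i => by fun_prop
  have hle : ∫ ω, fderiv ℝ Φ (0, T • ω) (0, ω) ^ 2 ∂sig
      ≤ ∑ i : Fin 3, ∫ ω, fderiv ℝ Φ (0, T • ω) (0, EuclideanSpace.single i 1) ^ 2 ∂sig := by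
    rw [← integral_finsetSum _ fun i _ => (hc i).integrable_sig]
    refine integral_sig_mono (by fun_prop) (by fun_prop) fun ω hω => ?_
    have h2 := sq_clm_apply_le (fderiv ℝ (fun x => Φ (0, x)) (T • ω)) hω.le
    have h3 := sq_norm_clm_le (fderiv ℝ (fun x => Φ (0, x)) (T • ω))
    simp only [fderiv_slice h1] at h2 h3
    exact h2.trans h3
  have h2 := fun i => (h.spatial i).trace hK hT
  rw [Fin.sum_univ_three] at hle
  constructor
  · have := mul_le_mul_of_nonneg_left hle hT
    linarith [(h2 0).1, (h2 1).1, (h2 2).1]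
  · have := mul_le_mul_of_nonneg_left hle (sq_nonneg T)
    linarith [(h2 0).2, (h2 1).2, (h2 2).2]

lemma HasData.abs_mean_le (hp : 1 < p) (hp5 : p ≤ 5) (hK : 0 ≤ K) (hΦ : ContDiff ℝ (⊤ : ℕ∞) Φ)
    (h : HasData p K Φ) {T : ℝ} (hT : 0 ≤ T) :
    |∫ ω, Φ (0, T • ω) ∂sig| ≤ 3 * √(sig.real Set.univ * (3 * K)) := by
  have h1 : ContDiff ℝ 1 Φ := hΦ.of_le (by exact_mod_cast (le_top : (1 : ℕ∞) ≤ ⊤))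
  have hc := h1.continuous
  have hcd := h1.continuous_fderiv (by norm_num)
  set S := sig.real Set.univ
  have hS : 0 ≤ S := sig_real_univ_pos.le
  set B := √(S * (3 * K))
  have hB : 0 ≤ B := sqrt_nonneg _
  have far : ∀ R : ℝ, 1 ≤ R → |∫ ω, Φ (0, R • ω) ∂sig| ≤ B := fun R hR => by
    refine abs_le_of_sq_le_mul ((sq_integral_sig_le (by fun_prop)).trans ?_)
    refine mul_le_mul_of_nonneg_left ?_ hS
    have h3 := data_trace_le hp hp5 hΦ (fun R hR => h.shell_pot_le hp hK hΦ hR)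
      (fun R hR => h.shell_fderiv_le hK hΦ hR) (R := R) (by linarith)
    have h4 : 0 ≤ ∫ ω, Φ (0, R • ω) ^ 2 ∂sig := integral_nonneg fun ω => sq_nonneg _
    nlinarith
  rcases le_total 1 T with h1T | hT1
  · linarith [far T h1T]
  have hd := sphere_sub_eq_shell (G := fun z => Φ (0, z.1 • z.2))
    (G' := fun z => fderiv ℝ Φ (0, z.1 • z.2) (0, z.2))
    (h1.comp (contDiff_const.prodMk (contDiff_fst.smul contDiff_snd))) (fun r ω => by
      have := hasDerivAt_ray (contDiff_slice h1 0) r ω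
      rwa [fderiv_slice h1] at this) T 1
  have hb : |shell T 1 fun z => fderiv ℝ Φ (0, z.1 • z.2) (0, z.2)| ≤ 2 * B := by
    have hii : IntervalIntegrable (fun r : ℝ => B * r ^ (-(1 / 2) : ℝ)) volume T 1 :=
      (intervalIntegral.intervalIntegrable_rpow' (by norm_num)).const_mul B
    have := intervalIntegral.norm_integral_le_of_norm_le hT1
      (f := fun r => ∫ ω, fderiv ℝ Φ (0, r • ω) (0, ω) ∂sig)
      (Filter.Eventually.of_forall fun r hr => ?_) hii
    · rw [intervalIntegral.integral_const_mul, integral_rpow (Or.inl (by norm_num)), one_rpow] at this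
      refine this.trans ?_
      have h0 := rpow_nonneg hT (-(1 / 2) + 1)
      have h3 : (1 - T ^ (-(1 / 2) + 1 : ℝ)) / (-(1 / 2) + 1) ≤ 2 := by
        rw [div_le_iff₀ (by norm_num)]
        linarith
      nlinarith
    · have hr0 : 0 < r := hT.trans_lt hr.1
      have h3 : |∫ ω, fderiv ℝ Φ (0, r • ω) (0, ω) ∂sig| ≤ √(S * (3 * K / r)) := by
        refine abs_le_of_sq_le_mul ((sq_integral_sig_le (by fun_prop)).trans ?_)
        refine mul_le_mul_of_nonneg_left ?_ hS
        rw [le_div_iff₀ hr0, mul_comm]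
        exact (h.radial_trace_le hK hΦ hr0.le).1
      refine h3.trans_eq ?_
      rw [← mul_div_assoc, sqrt_div (by positivity), rpow_neg hr0.le, ← sqrt_eq_rpow, div_eq_mul_inv]
  rw [← hd] at hb
  have h2 := far 1 le_rfl
  have := abs_sub_abs_le_abs_sub (∫ ω, Φ (0, T • ω) ∂sig) (∫ ω, Φ (0, (1 : ℝ) • ω) ∂sig)
  rw [abs_sub_comm] at this
  linarith

lemma HasData.abs_free_le (hp : 1 < p) (hp5 : p ≤ 5) (hK : 0 ≤ K) (hΦ : ContDiff ℝ (⊤ : ℕ∞) Φ)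
    (h : HasData p K Φ) {T : ℝ} (hT : 0 ≤ T) :
    |∫ ω, (psiT Φ ((0, T), ω) + psiR Φ ((0, T), ω)) ∂sig|
      ≤ 5 * √(sig.real Set.univ * (6 * K)) := by
  have h1 : ContDiff ℝ 1 Φ := hΦ.of_le (by exact_mod_cast (le_top : (1 : ℕ∞) ≤ ⊤))
  have hc := h1.continuous
  have hcd := h1.continuous_fderiv (by norm_num)
  set S := sig.real Set.univ
  have hS : 0 ≤ S := sig_real_univ_pos.le
  have e : ∫ ω, (psiT Φ ((0, T), ω) + psiR Φ ((0, T), ω)) ∂sig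
      = (∫ ω, T * fderiv ℝ Φ (0, T • ω) (1, 0) ∂sig) + ((∫ ω, Φ (0, T • ω) ∂sig)
        + ∫ ω, T * fderiv ℝ Φ (0, T • ω) (0, ω) ∂sig) := by
    rw [← integral_add (Continuous.integrable_sig (by fun_prop))
      (Continuous.integrable_sig (by fun_prop)), ← integral_add (Continuous.integrable_sig (by fun_prop))
      (Continuous.integrable_sig (by fun_prop))]
    rfl
  have a1 : |∫ ω, T * fderiv ℝ Φ (0, T • ω) (1, 0) ∂sig| ≤ √(S * (6 * K)) := by
    refine abs_le_of_sq_le_mul ((sq_integral_sig_le (by fun_prop)).trans ?_)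
    refine mul_le_mul_of_nonneg_left ?_ hS
    simp only [mul_pow, integral_const_mul]
    linarith [(h.time.trace hK hT).2]
  have a2 : |∫ ω, T * fderiv ℝ Φ (0, T • ω) (0, ω) ∂sig| ≤ √(S * (6 * K)) := by
    refine abs_le_of_sq_le_mul ((sq_integral_sig_le (by fun_prop)).trans ?_)
    refine mul_le_mul_of_nonneg_left ?_ hS
    simp only [mul_pow, integral_const_mul]
    exact (h.radial_trace_le hK hΦ hT).2
  have a3 := h.abs_mean_le hp hp5 hK hΦ hT
  have a4 : √(S * (3 * K)) ≤ √(S * (6 * K)) := sqrt_le_sqrt (by nlinarith)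
  rw [e]
  refine (abs_add_le _ _).trans ?_
  have := abs_add_le (∫ ω, Φ (0, T • ω) ∂sig) (∫ ω, T * fderiv ℝ Φ (0, T • ω) (0, ω) ∂sig)
  linarith

/-- Potential energy flux through the backward light cone with vertex `(T, 0)`. -/
lemma HasData.cone_pot_le (hp : 1 < p) (hp5 : p ≤ 5) (hK : 0 ≤ K) (hΦ : IsSol p Φ)
    (h : HasData p K Φ) {T : ℝ} (hT : 0 ≤ T) :
    shell 0 T (fun z => z.1 ^ 2 * |Φ (T - z.1, z.1 • z.2)| ^ (p + 1)) ≤ 63 * K := by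
  have hs := hΦ.smooth
  have hc := hs.continuous
  have hp1 : 0 ≤ p + 1 := by linarith
  have h1 := cone_flux_le hp hΦ hT
  have h2 := energy_data_le hp hp5 hs (fun R hR => h.shell_pot_le hp hK hs hR)
    (fun R hR => h.shell_fderiv_le hK hs hR) (fun R hR => h.shell_time_le hK hR) hT
  have h3 : shell 0 T (fun z => z.1 ^ 2 * |Φ (T - z.1, z.1 • z.2)| ^ (p + 1))
      = shell 0 T (fun z => (T - z.1) ^ 2 * |Φ (z.1, (T - z.1) • z.2)| ^ (p + 1)) := by
    unfold shell
    have := intervalIntegral.integral_comp_sub_left (a := 0) (b := T)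
      (fun r => ∫ ω, r ^ 2 * |Φ (T - r, r • ω)| ^ (p + 1) ∂sig) T
    simp only [sub_sub_cancel, sub_self, sub_zero] at this
    exact this.symm
  have hpot : Continuous (pot p Φ) := (contDiff_pot hs hp).continuous
  have h4 : shell 0 T (fun z => (T - z.1) ^ 2 * |Φ (z.1, (T - z.1) • z.2)| ^ (p + 1))
      ≤ shell 0 T (fun z => 6 * pot p Φ ((z.1, T - z.1), z.2)) := by
    refine shell_mono hT (by fun_prop) (by fun_prop) fun r _ ω _ => ?_
    simp only [pot, pt, mul_add]
    have h5 : 0 ≤ ∑ k, fJ k Φ ((r, T - r), ω) ^ 2 / 2 := Finset.sum_nonneg fun k _ => by positivity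
    have h6 : |Φ (r, (T - r) • ω)| ^ (p + 1) ≤ 6 * (|Φ (r, (T - r) • ω)| ^ (p + 1) / (p + 1)) := by
      rw [← mul_div_assoc, le_div_iff₀ (by linarith)]
      have := rpow_nonneg (abs_nonneg (Φ (r, (T - r) • ω))) (p + 1)
      nlinarith
    have := mul_le_mul_of_nonneg_left h6 (sq_nonneg (T - r))
    have := mul_nonneg (sq_nonneg (T - r)) h5
    linarith
  rw [shell_const_mul] at h4
  linarith

/-- Solutions with `H¹` first derivatives initially are bounded when `3 < p < 5`. -/
theorem HasData.exists_abs_le (hp : 3 < p) (hp5 : p < 5) (hK : 0 ≤ K) (hΦ : IsSol p Φ)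
    (h : HasData p K Φ) : ∃ M, 0 ≤ M ∧ ∀ t, 0 ≤ t → ∀ x, |Φ (t, x)| ≤ M := by
  set S := sig.real Set.univ with hSdef
  have hS : 0 < S := sig_real_univ_pos
  obtain ⟨C, hC, hCb⟩ := exists_shell_mul_rpow_le hp hp5 (E := 63 * K) (ε := S / 2) (by linarith)
    (by linarith)
  set D := 5 * √(S * (6 * K))
  have hD : 0 ≤ D := by positivity
  refine ⟨2 * (D + C) / S, by positivity, fun T hT x₀ => ?_⟩
  have hc := hΦ.smooth.continuous
  set Q : Set (ℝ × E3) := {q | 0 ≤ q.1 ∧ ‖q.2 - x₀‖ + q.1 ≤ T} with hQ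
  have hQc : IsCompact Q := by
    refine ((isCompact_Icc (a := (0 : ℝ)) (b := T)).prod
      (isCompact_closedBall x₀ T)).of_isClosed_subset ?_ fun q hq => ?_
    · exact (isClosed_le continuous_const continuous_fst).inter
        (isClosed_le (f := fun q : ℝ × E3 => ‖q.2 - x₀‖ + q.1) (by fun_prop) continuous_const)
    · have := norm_nonneg (q.2 - x₀)
      obtain ⟨h1, h2⟩ := hq
      exact ⟨⟨h1, by linarith⟩, by rw [Metric.mem_closedBall, dist_eq_norm]; linarith⟩
  have hmem : (T, x₀) ∈ Q := ⟨hT, by simp⟩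
  obtain ⟨⟨t₁, x₁⟩, hq, hmax⟩ := hQc.exists_isMaxOn ⟨_, hmem⟩ (f := fun q => |Φ q|)
    hc.abs.continuousOn
  obtain ⟨ht₁, hx₁⟩ := hq
  simp only at ht₁ hx₁
  refine (hmax hmem).trans ?_
  simp only
  set M := |Φ (t₁, x₁)| with hM
  set Ψ : ℝ × E3 → ℝ := fun q => Φ (q + (0, x₁)) with hΨ
  have hsol : IsSol p Ψ := hΦ.translate x₁
  have hdat : HasData p K Ψ := h.translate x₁
  have hΨc := hsol.smooth.continuous
  have hp0 : 0 ≤ p := by linarith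
  have hp1 : 0 ≤ p - 1 := by linarith
  have hk := kirchhoff (by linarith) hsol ht₁
  have hfree := hdat.abs_free_le (by linarith) hp5.le hK hsol.smooth ht₁
  have hsrc := hCb (fun z => Ψ (t₁ - z.1, z.1 • z.2)) t₁ M (hΨc.comp (by fun_prop)) ht₁ (fun r hr ω hω => ?_)
    (abs_nonneg _) (hdat.cone_pot_le (by linarith) hp5.le hK hsol ht₁)
  · have hle : |shell 0 t₁ (fun z => z.1 * (|Ψ (t₁ - z.1, z.1 • z.2)| ^ (p - 1)
        * Ψ (t₁ - z.1, z.1 • z.2)))| ≤ shell 0 t₁ (fun z => z.1 * |Ψ (t₁ - z.1, z.1 • z.2)| ^ p) := by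
      have hpow : ∀ a : ℝ, |a| ^ p = |a| ^ (p - 1) * |a| := fun a => by
        rcases eq_or_ne a 0 with rfl | ha
        · simp [zero_rpow (by linarith : p ≠ 0)]
        · rw [← rpow_add_one (abs_ne_zero.2 ha)]; ring_nf
      rw [abs_le, ← neg_one_mul, ← shell_const_mul]
      constructor <;> refine shell_mono ht₁ (by fun_prop) (by fun_prop) fun r hr ω hω => ?_ <;>
        simp only [hpow]
      · have := mul_le_mul_of_nonneg_left (mul_le_mul_of_nonneg_left
          (neg_abs_le (Ψ (t₁ - r, r • ω))) (rpow_nonneg (abs_nonneg (Ψ (t₁ - r, r • ω))) (p - 1))) hr.1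
        linarith
      · exact mul_le_mul_of_nonneg_left (mul_le_mul_of_nonneg_left
          (le_abs_self (Ψ (t₁ - r, r • ω))) (rpow_nonneg (abs_nonneg (Ψ (t₁ - r, r • ω))) (p - 1))) hr.1
    have hv : Ψ (t₁, 0) = Φ (t₁, x₁) := by simp [hΨ]
    have hSM : S * M = |S * Ψ (t₁, 0)| := by rw [abs_mul, abs_of_pos hS, hv]
    rw [hk] at hSM
    have := abs_sub (∫ ω, (psiT Ψ ((0, t₁), ω) + psiR Ψ ((0, t₁), ω)) ∂sig)
      (shell 0 t₁ (fun z => z.1 * (|Ψ (t₁ - z.1, z.1 • z.2)| ^ (p - 1) * Ψ (t₁ - z.1, z.1 • z.2))))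
    rw [le_div_iff₀ hS]
    linarith
  · have : (t₁ - r, r • ω + x₁) ∈ Q := by
      refine ⟨by simpa using hr.2, ?_⟩
      have h3 : ‖r • ω + x₁ - x₀‖ ≤ r + ‖x₁ - x₀‖ := by
        rw [add_sub_assoc]
        refine (norm_add_le _ _).trans_eq ?_
        rw [norm_smul, hω, mul_one, Real.norm_eq_abs, abs_of_nonneg hr.1]
      simp only
      linarith
    simpa [hΨ] using hmax this

end bounds

lemma shell_weight_le {G : E3 → ℝ} (hG : Continuous G) (h0 : ∀ x, 0 ≤ G x) {K q γ : ℝ} (hK : 0 ≤ K)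
    (hγ : 0 ≤ γ) (hq : γ ≤ q)
    (h : ∫⁻ x, ENNReal.ofReal ((1 + ‖x‖) ^ q * G x) ≤ ENNReal.ofReal K) {R : ℝ} (hR : 0 ≤ R) :
    shell 0 R (fun z => z.1 ^ 2 * (1 + z.1) ^ γ * G (z.1 • z.2)) ≤ K := by
  have hq0 : 0 ≤ q := hγ.trans hq
  refine le_trans ?_ (shell_le_of_lintegral_le (G := fun x => (1 + ‖x‖) ^ q * G x) (by fun_prop)
    (fun x => mul_nonneg (rpow_nonneg (by positivity) _) (h0 x)) hK h hR)
  refine shell_mono hR (by fun_prop) (by fun_prop) fun r hr ω hω => ?_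
  simp only
  rw [norm_smul, hω, mul_one, Real.norm_eq_abs, abs_of_nonneg hr.1, mul_assoc]
  have h1 : (1 + r) ^ γ ≤ (1 + r) ^ q := rpow_le_rpow_of_exponent_le (by linarith [hr.1]) hq
  exact mul_le_mul_of_nonneg_left (mul_le_mul_of_nonneg_right h1 (h0 _)) (sq_nonneg r)

lemma le_mul_rpow_neg_of_mul_le {a τ γ x K : ℝ} (ha : 0 < a) (hτ : 0 < τ)
    (h : (τ / a) ^ γ * x ≤ K) : x ≤ K * a ^ γ * τ ^ (-γ) := by
  rw [div_rpow hτ.le ha.le, div_mul_eq_mul_div, div_le_iff₀ (by positivity)] at h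
  rw [rpow_neg hτ.le, ← div_eq_mul_inv, le_div_iff₀ (by positivity)]
  linarith

lemma exists_weight_parameter {p γ : ℝ} (hγ0 : 0 < γ) (hγ2 : γ < 2) (hγp : γ < p - 1) :
    ∃ c, 0 < c ∧ c ≤ 1 ∧ γ * (1 + c) ≤ 2 ∧ γ * (1 + c) ≤ p - 1 := by
  have h1 : 0 < 2 / γ - 1 := by rw [sub_pos, lt_div_iff₀ hγ0]; linarith
  have h2 : 0 < (p - 1) / γ - 1 := by rw [sub_pos, lt_div_iff₀ hγ0]; linarith
  refine ⟨min 1 (min (2 / γ - 1) ((p - 1) / γ - 1)), by positivity, min_le_left _ _, ?_, ?_⟩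
  · rw [mul_comm, ← le_div_iff₀ hγ0]
    linarith [(min_le_right 1 (min (2 / γ - 1) ((p - 1) / γ - 1))).trans (min_le_left _ _)]
  · rw [mul_comm, ← le_div_iff₀ hγ0]
    linarith [(min_le_right 1 (min (2 / γ - 1) ((p - 1) / γ - 1))).trans (min_le_right _ _)]

/-- The Cauchy data of `Φ` at `t = 0` have finite energy with weight `(1 + |x|) ^ q`. -/
structure HasWeightedData (p q K : ℝ) (Φ : ℝ × E3 → ℝ) : Prop where
  potential : ∫⁻ x, ENNReal.ofReal ((1 + ‖x‖) ^ q * |Φ (0, x)| ^ (p + 1)) ≤ ENNReal.ofReal K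
  spatial : ∫⁻ x, ENNReal.ofReal ((1 + ‖x‖) ^ q * ‖fderiv ℝ (fun x => Φ (0, x)) x‖ ^ 2)
    ≤ ENNReal.ofReal K
  time : ∫⁻ x, ENNReal.ofReal ((1 + ‖x‖) ^ q * fderiv ℝ Φ (0, x) (1, 0) ^ 2) ≤ ENNReal.ofReal K

section decay
variable {p q K : ℝ} {Φ : ℝ × E3 → ℝ}

theorem HasWeightedData.exists_decay (hp : 1 < p) (hp5 : p ≤ 5) (hK : 0 ≤ K) (hΦ : IsSol p Φ)
    (h : HasWeightedData p q K Φ) {γ : ℝ} (hγ : 1 ≤ γ) (hγ2 : γ < 2) (hγp : γ < p - 1)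
    (hγq : γ ≤ q) : ∃ K₁, 0 < K₁ ∧ ∀ t, 0 ≤ t →
      (∀ R, 0 ≤ R → shell 0 R (fun z => (Φ (t, z.1 • z.2)
        + z.1 * fderiv ℝ (fun x => Φ (t, x)) (z.1 • z.2) z.2) ^ 2) ≤ K₁) ∧
      (∀ R, 0 ≤ R → shell 0 R (fun z => ∑ k,
        (z.1 * fderiv ℝ (fun x => Φ (t, x)) (z.1 • z.2) (rotGen k z.2)) ^ 2) ≤ K₁ * (1 + t) ^ (-γ)) ∧
      (∀ R, 0 ≤ R → shell 0 R (fun z => z.1 ^ 2 * |Φ (t, z.1 • z.2)| ^ (p + 1))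
        ≤ K₁ * (1 + t) ^ (-γ)) ∧
      shell 0 ((1 + t) / 4) (fun z => Φ (t, z.1 • z.2) ^ 2) ≤ K₁ * (1 + t) ^ (-γ) := by
  have hs := hΦ.smooth
  have h1 : ContDiff ℝ 1 Φ := hs.of_le (by exact_mod_cast (le_top : (1 : ℕ∞) ≤ ⊤))
  have hc := h1.continuous
  have hcd := h1.continuous_fderiv (by norm_num)
  have hf0d := (contDiff_slice h1 0).continuous_fderiv (by norm_num)
  have hp1 : 0 ≤ p + 1 := by linarith
  obtain ⟨c, hc0, hc1, hc2, hcp⟩ := exists_weight_parameter (by linarith) hγ2 hγp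
  set B := 2 * 3 ^ γ * (17 * K + K) with hB
  have hB0 : 0 ≤ B := by positivity
  have hdata : ∀ R, 0 ≤ R → shell 0 R
      (fun z => dens p (wtA γ) (wtB c γ) Φ ((0, z.1), z.2)) ≤ B := fun R hR =>
    weighted_data_le hp hs (by linarith) hp5
      (fun R hR => shell_weight_le (G := fun x => |Φ (0, x)| ^ (p + 1)) (by fun_prop)
        (fun x => by positivity) hK (by linarith) hγq h.potential hR)
      (fun R hR => shell_weight_le (G := fun x => ‖fderiv ℝ (fun x => Φ (0, x)) x‖ ^ 2) (by fun_prop)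
        (fun x => by positivity) hK (by linarith) hγq h.spatial hR)
      (fun R hR => shell_weight_le (G := fun x => fderiv ℝ Φ (0, x) (1, 0) ^ 2) (by fun_prop)
        (fun x => by positivity) hK (by linarith) hγq h.time hR) hγ hc0.le hc1 hR
  have hBc : B ≤ B / c := le_div_self hB0 hc0 hc1
  have h4γ : 1 ≤ (4 : ℝ) ^ γ := one_le_rpow (by norm_num) (by linarith)
  have h2γ : (2 : ℝ) ^ γ ≤ 4 ^ γ := rpow_le_rpow (by norm_num) (by norm_num) (by linarith)
  set K₁ := 6 * (B / c) * 4 ^ γ + 1 with hK₁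
  have hBc0 : 0 ≤ B / c := by positivity
  refine ⟨K₁, by positivity, fun t ht => ?_⟩
  obtain ⟨d1, d2, d3⟩ := weighted_decay hp hγ hc0 hc1 hc2 hcp hΦ hdata ht
  have hτ : 0 < 1 + t := by linarith
  have hτγ : 0 ≤ (1 + t) ^ (-γ) := by positivity
  have hpot : Continuous (pot p Φ) := (contDiff_pot hs hp).continuous
  have hpotR : ∀ R, 0 ≤ R → 6 * shell 0 R (fun z => pot p Φ ((t, z.1), z.2))
      ≤ K₁ * (1 + t) ^ (-γ) := fun R hR => by
    have h3 := le_mul_rpow_neg_of_mul_le (by norm_num) hτ (d1 R hR)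
    have h4 : B * 2 ^ γ * (1 + t) ^ (-γ) ≤ (B / c) * 4 ^ γ * (1 + t) ^ (-γ) := by gcongr
    rw [hK₁, add_mul]
    linarith
  have hrot : ∀ k (r : ℝ) (ω : E3), r * fderiv ℝ (fun x => Φ (t, x)) (r • ω) (rotGen k ω)
      = r * fJ k Φ ((t, r), ω) := fun k r ω => by rw [fderiv_slice h1]; rfl
  have hrad : ∀ (r : ℝ) (ω : E3), Φ (t, r • ω) + r * fderiv ℝ (fun x => Φ (t, x)) (r • ω) ω
      = psiR Φ ((t, r), ω) := fun r ω => by rw [fderiv_slice h1]; rfl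
  have hJ : ∀ k, Continuous (fJ k Φ) := fun k => (contDiff_fJ hs k).continuous
  simp only [hrot, hrad]
  refine ⟨fun R hR => ?_, fun R hR => ?_, fun R hR => ?_, ?_⟩
  · have := d2 R hR
    rw [mul_comm, ← le_div_iff₀ hc0] at this
    nlinarith
  · refine le_trans ?_ (hpotR R hR)
    rw [← shell_const_mul]
    refine shell_mono hR (by fun_prop) (by fun_prop) fun r _ ω _ => ?_
    simp only [pot, pt]
    have h3 : 0 ≤ |Φ (t, r • ω)| ^ (p + 1) / (p + 1) := by positivity
    have h4 : ∑ k, (r * fJ k Φ ((t, r), ω)) ^ 2 = 2 * (r ^ 2 * ∑ k, fJ k Φ ((t, r), ω) ^ 2 / 2) := by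
      simp only [mul_pow, Finset.mul_sum]
      refine Finset.sum_congr rfl fun k _ => ?_
      ring
    rw [h4]
    have h5 : 0 ≤ ∑ k, fJ k Φ ((t, r), ω) ^ 2 / 2 := Finset.sum_nonneg fun k _ => by positivity
    have := mul_nonneg (sq_nonneg r) h3
    have := mul_nonneg (sq_nonneg r) h5
    linarith
  · refine le_trans ?_ (hpotR R hR)
    rw [← shell_const_mul]
    refine shell_mono hR (by fun_prop) (by fun_prop) fun r _ ω _ => ?_
    simp only [pot, pt]
    have h5 : 0 ≤ ∑ k, fJ k Φ ((t, r), ω) ^ 2 / 2 := Finset.sum_nonneg fun k _ => by positivity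
    have h6 : |Φ (t, r • ω)| ^ (p + 1) ≤ 6 * (|Φ (t, r • ω)| ^ (p + 1) / (p + 1)) := by
      rw [← mul_div_assoc, le_div_iff₀ (by linarith)]
      have := rpow_nonneg (abs_nonneg (Φ (t, r • ω))) (p + 1)
      nlinarith
    have := mul_le_mul_of_nonneg_left h6 (sq_nonneg r)
    have := mul_nonneg (sq_nonneg r) h5
    linarith
  · have h3 := hardy_le (contDiff_slice h1 t) (R := (1 + t) / 4) (by positivity)
    simp only [hrad] at h3
    have h4 : ((1 + t) / 4) ^ γ * shell 0 ((1 + t) / 4) (fun z => psiR Φ ((t, z.1), z.2) ^ 2)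
        ≤ B / c := by
      rw [le_div_iff₀ hc0]
      linarith
    have h5 := le_mul_rpow_neg_of_mul_le (by norm_num) hτ h4
    have h6 : 0 ≤ B / c * 4 ^ γ * (1 + t) ^ (-γ) := by positivity
    rw [hK₁, add_mul]
    linarith

lemma rpow_two_mul_le {p a h : ℝ} (hp : 1 < p) (hp3 : p ≤ 3) (ha : 0 ≤ a) (hh : 0 < h) :
    a ^ (2 * p) ≤ h ^ (p - 1) * a ^ (p + 1) + h ^ (2 * p - 6) * a ^ 6 := by
  rcases ha.eq_or_lt with rfl | ha0
  · rw [zero_rpow (by linarith), zero_rpow (by linarith)]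
    simp
  rcases le_total a h with hah | hah
  · have h1 : a ^ (2 * p) = a ^ (p - 1) * a ^ (p + 1) := by rw [← rpow_add ha0]; ring_nf
    have h2 : a ^ (p - 1) ≤ h ^ (p - 1) := rpow_le_rpow ha hah (by linarith)
    have h3 : 0 ≤ h ^ (2 * p - 6) * a ^ 6 := by positivity
    have h4 := mul_le_mul_of_nonneg_right h2 (rpow_nonneg ha (p + 1))
    linarith
  · have h1 : a ^ (2 * p) = a ^ (2 * p - 6) * a ^ 6 := by
      rw [← rpow_natCast, ← rpow_add ha0]; congr 1; push_cast; ring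
    have h2 : a ^ (2 * p - 6) ≤ h ^ (2 * p - 6) := rpow_le_rpow_of_nonpos hh hah (by linarith)
    have h3 : 0 ≤ h ^ (p - 1) * a ^ (p + 1) := by positivity
    have h4 := mul_le_mul_of_nonneg_right h2 (pow_nonneg ha 6)
    linarith

/-- The `L^{2p}` moments of the solution decay at an integrable rate. -/
theorem exists_moment_decay (hp : 7 / 3 < p) (hp5 : p < 5) (hK : 0 ≤ K) (hΦ : IsSol p Φ)
    (hd : HasData p K Φ) (hw : HasWeightedData p (p - 1) K Φ) :
    ∃ N κ : ℝ, 0 ≤ N ∧ 1 < κ ∧ ∀ t, 0 ≤ t → ∀ R, 0 ≤ R →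
      shell 0 R (fun z => z.1 ^ 2 * |Φ (t, z.1 • z.2)| ^ (2 * p)) ≤ N * (1 + t) ^ (-(2 * κ)) := by
  have hs := hΦ.smooth
  have h1 : ContDiff ℝ 1 Φ := hs.of_le (by exact_mod_cast (le_top : (1 : ℕ∞) ≤ ⊤))
  have hc := h1.continuous
  have hp1 : 0 ≤ p + 1 := by linarith
  have h2p : 0 ≤ 2 * p := by linarith
  rcases le_or_gt p 3 with hp3 | hp3
  · set γ := (p + 3) / 4 with hγ
    obtain ⟨K₁, hK₁, hdec⟩ := hw.exists_decay (by linarith) hp5.le hK hΦ (γ := γ) (by linarith)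
      (by linarith) (by linarith) (by linarith)
    obtain ⟨M, hM, hmom⟩ := exists_moment_six_bound (p := p) (K := K₁) (γ := γ) (δ := γ)
      (by linarith) hp5 hK₁ le_rfl (by rw [hγ]; nlinarith)
    have h5p : 0 < 5 - p := by linarith
    refine ⟨K₁ + M ^ 2, 2 * γ / (5 - p), by positivity, by rw [lt_div_iff₀ h5p]; linarith,
      fun t ht R hR => ?_⟩
    obtain ⟨e1, e2, e3, e4⟩ := hdec t ht
    have hτ : 0 < 1 + t := by linarith
    have e6 := hmom (fun x => Φ (t, x)) (1 + t) (contDiff_slice h1 t) (by linarith) e1 e2 e3 e4 R hR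
    have e5 := e3 R hR
    set h := (1 + t) ^ (-(γ / (5 - p))) with hh
    have hh0 : 0 < h := by positivity
    have hle : shell 0 R (fun z => z.1 ^ 2 * |Φ (t, z.1 • z.2)| ^ (2 * p))
        ≤ shell 0 R (fun z => h ^ (p - 1) * (z.1 ^ 2 * |Φ (t, z.1 • z.2)| ^ (p + 1))
          + h ^ (2 * p - 6) * (z.1 ^ 2 * Φ (t, z.1 • z.2) ^ 6)) := by
      refine shell_mono hR (by fun_prop) (by fun_prop) fun r _ ω _ => ?_
      have h3 := mul_le_mul_of_nonneg_left
        (rpow_two_mul_le (by linarith) hp3 (abs_nonneg (Φ (t, r • ω))) hh0) (sq_nonneg r)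
      rw [Even.pow_abs (by decide)] at h3
      simp only
      linarith
    rw [shell_add (by fun_prop) (by fun_prop), shell_const_mul, shell_const_mul] at hle
    have f1 := mul_le_mul_of_nonneg_left e5 (rpow_nonneg hh0.le (p - 1))
    have f2 := mul_le_mul_of_nonneg_left e6 (rpow_nonneg hh0.le (2 * p - 6))
    have g1 : h ^ (p - 1) * (K₁ * (1 + t) ^ (-γ)) = K₁ * (1 + t) ^ (-(2 * (2 * γ / (5 - p)))) := by
      rw [hh, ← rpow_mul hτ.le, mul_left_comm, ← rpow_add hτ]
      congr 2
      field_simp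
      ring
    have g2 : h ^ (2 * p - 6) * (M * (1 + t) ^ (-γ)) ^ 2
        = M ^ 2 * (1 + t) ^ (-(2 * (2 * γ / (5 - p)))) := by
      rw [hh, ← rpow_mul hτ.le, mul_pow, mul_left_comm, ← rpow_natCast ((1 + t) ^ (-γ)),
        ← rpow_mul hτ.le, ← rpow_add hτ]
      congr 2
      push_cast
      field_simp
      ring
    rw [g1] at f1
    rw [g2] at f2
    linarith
  · set γ := (p - 1) / 2 with hγ
    obtain ⟨K₁, hK₁, hdec⟩ := hw.exists_decay (by linarith) hp5.le hK hΦ (γ := γ) (by linarith)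
      (by linarith) (by linarith) (by linarith)
    set b := (5 - p) / 4 with hb
    have hb2 : 0 < 2 - b := by linarith
    set δ := min γ ((γ + 2 * b) / (2 - b)) with hδ
    have hδ1 : 1 < δ := lt_min (by linarith) (by rw [lt_div_iff₀ hb2]; linarith)
    obtain ⟨M, hM, hmom⟩ := exists_moment_six_bound (p := p) (K := K₁) (γ := γ) (δ := δ)
      (by linarith) hp5 hK₁ (min_le_left _ _) (by
        rw [← le_div_iff₀ hb2]; exact min_le_right _ _)
    obtain ⟨L, hL, hbd⟩ := hd.exists_abs_le hp3 hp5 hK hΦ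
    refine ⟨L ^ (2 * p - 6) * M ^ 2, δ, by positivity, hδ1, fun t ht R hR => ?_⟩
    obtain ⟨e1, e2, e3, e4⟩ := hdec t ht
    have hτ : 0 < 1 + t := by linarith
    have e6 := hmom (fun x => Φ (t, x)) (1 + t) (contDiff_slice h1 t) (by linarith) e1 e2 e3 e4 R hR
    have hle : shell 0 R (fun z => z.1 ^ 2 * |Φ (t, z.1 • z.2)| ^ (2 * p))
        ≤ shell 0 R (fun z => L ^ (2 * p - 6) * (z.1 ^ 2 * Φ (t, z.1 • z.2) ^ 6)) := by
      refine shell_mono hR (by fun_prop) (by fun_prop) fun r _ ω _ => ?_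
      have h2 := rpow_le_rpow (abs_nonneg _) (hbd t ht (r • ω)) (z := 2 * p - 6) (by linarith)
      have h3 : |Φ (t, r • ω)| ^ (2 * p) = |Φ (t, r • ω)| ^ (2 * p - 6) * Φ (t, r • ω) ^ 6 := by
        have he : Φ (t, r • ω) ^ 6 = |Φ (t, r • ω)| ^ (6 : ℝ) := by
          rw [← Even.pow_abs (by decide : Even 6), ← rpow_natCast]; norm_num
        rw [he, ← rpow_add_of_nonneg (abs_nonneg _) (by linarith) (by norm_num)]
        ring_nf
      simp only
      rw [h3]
      have := mul_le_mul_of_nonneg_left h2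
        (by positivity : 0 ≤ r ^ 2 * Φ (t, r • ω) ^ 6)
      linarith
    rw [shell_const_mul] at hle
    have f2 := mul_le_mul_of_nonneg_left e6 (rpow_nonneg hL (2 * p - 6))
    have g2 : (M * (1 + t) ^ (-δ)) ^ 2 = M ^ 2 * (1 + t) ^ (-(2 * δ)) := by
      rw [mul_pow, ← rpow_natCast ((1 + t) ^ (-δ)), ← rpow_mul hτ.le]
      congr 2
      push_cast
      ring
    rw [g2] at f2
    linarith

end decay

section conversion
variable {φ : ℝ → E3 → ℝ}

lemma dt1_eq_fderiv (hφ : ContDiff ℝ 1 fun q : ℝ × E3 => φ q.1 q.2) (t : ℝ) (x : E3) :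
    dt1 φ t x = fderiv ℝ (fun q : ℝ × E3 => φ q.1 q.2) (t, x) (1, 0) :=
  (hφ.hasDerivAt_curve ((hasDerivAt_id t).prodMk (hasDerivAt_const t x))).deriv

lemma IsNLWSolution.isSol {p : ℝ} (h : IsNLWSolution p φ) :
    IsSol p fun q : ℝ × E3 => φ q.1 q.2 where
  smooth := h.1
  eq t ht x := by
    have h1 : ContDiff ℝ 1 fun q : ℝ × E3 => φ q.1 q.2 :=
      h.1.of_le (by exact_mod_cast (le_top : (1 : ℕ∞) ≤ ⊤))
    have hd := contDiff_fderiv_one h.1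
    have e1 : dtt φ t x = fderiv ℝ (fderiv ℝ fun q : ℝ × E3 => φ q.1 q.2) (t, x) (1, 0) (1, 0) := by
      simp only [dtt, dt1_eq_fderiv h1]
      have := (hasDerivAt_fderiv_apply h.1 ((hasDerivAt_id t).prodMk (hasDerivAt_const t x))
        (hasDerivAt_const t ((1, 0) : ℝ × E3))).deriv
      simpa using this
    have e2 : lap3 (φ t) x = ∑ i, fderiv ℝ (fderiv ℝ fun q : ℝ × E3 => φ q.1 q.2) (t, x)
        (0, EuclideanSpace.single i 1) (0, EuclideanSpace.single i 1) := by
      refine Finset.sum_congr rfl fun i _ => ?_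
      have h2 : ∀ y, fderiv ℝ (φ t) y (EuclideanSpace.single i 1)
          = fderiv ℝ (fun q : ℝ × E3 => φ q.1 q.2) (t, y) (0, EuclideanSpace.single i 1) :=
        fun y => fderiv_slice h1 t y _
      simp only [der2, h2]
      rw [fderiv_slice (Φ := fun q => fderiv ℝ (fun q : ℝ × E3 => φ q.1 q.2) q
        (0, EuclideanSpace.single i 1)) (hd.clm_apply contDiff_const),
        fderiv_clm_apply (hd.differentiable (by norm_num) _) (differentiableAt_const _)]
      simp
    rw [← e1, ← e2]
    exact h.2 t ht x

lemma wEnergy_term_le {p γ₀ : ℝ} {k l : ℕ} (hl : l ≤ k) :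
    ∫⁻ x : E3, ENNReal.ofReal ((1 + ‖x‖) ^ (γ₀ + 2 * (l : ℝ)) *
      (‖iteratedFDeriv ℝ (l + 1) (φ 0) x‖ ^ 2 + ‖iteratedFDeriv ℝ l (dt1 φ 0) x‖ ^ 2))
      ≤ wEnergy p k γ₀ φ :=
  (Finset.single_le_sum (f := fun l : ℕ => ∫⁻ x : E3, ENNReal.ofReal ((1 + ‖x‖) ^ (γ₀ + 2 * (l : ℝ)) *
      (‖iteratedFDeriv ℝ (l + 1) (φ 0) x‖ ^ 2 + ‖iteratedFDeriv ℝ l (dt1 φ 0) x‖ ^ 2)))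
    (fun _ _ => zero_le) (Finset.mem_range.2 (by omega))).trans le_self_add

lemma one_le_weight {q : ℝ} (hq : 0 ≤ q) (x : E3) : 1 ≤ (1 + ‖x‖) ^ q :=
  one_le_rpow (by linarith [norm_nonneg x]) hq

variable {p K : ℝ} (hE : wEnergy p 1 (p - 1) φ ≤ ENNReal.ofReal K)
include hE

lemma lintegral_zero_le {g : E3 → ℝ} (hg : ∀ x, g x ≤ (1 + ‖x‖) ^ (p - 1) *
      (‖fderiv ℝ (φ 0) x‖ ^ 2 + dt1 φ 0 x ^ 2)) :
    ∫⁻ x, ENNReal.ofReal (g x) ≤ ENNReal.ofReal K := by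
  refine le_trans (lintegral_mono fun x => ENNReal.ofReal_le_ofReal ?_)
    ((wEnergy_term_le (p := p) (γ₀ := p - 1) (zero_le : 0 ≤ 1)).trans hE)
  refine (hg x).trans_eq ?_
  simp [norm_iteratedFDeriv_one, norm_iteratedFDeriv_zero]

lemma lintegral_one_le (hp : 1 < p) {g : E3 → ℝ} (hg : ∀ x, g x ≤
      ‖fderiv ℝ (fderiv ℝ (φ 0)) x‖ ^ 2 + ‖fderiv ℝ (dt1 φ 0) x‖ ^ 2) :
    ∫⁻ x, ENNReal.ofReal (g x) ≤ ENNReal.ofReal K := by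
  refine le_trans (lintegral_mono fun x => ENNReal.ofReal_le_ofReal ?_)
    ((wEnergy_term_le (p := p) (γ₀ := p - 1) (le_refl 1)).trans hE)
  refine (hg x).trans ?_
  rw [← norm_iteratedFDeriv_fderiv, norm_iteratedFDeriv_one, norm_iteratedFDeriv_one]
  refine le_mul_of_one_le_left (by positivity) (one_le_weight ?_ x)
  push_cast
  linarith

lemma hasWeightedData_of_wEnergy (hφ : ContDiff ℝ 1 fun q : ℝ × E3 => φ q.1 q.2) :
    HasWeightedData p (p - 1) K fun q : ℝ × E3 => φ q.1 q.2 where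
  potential := le_add_self.trans hE
  spatial := lintegral_zero_le hE fun x => by
    have : 0 ≤ (1 + ‖x‖) ^ (p - 1) := by positivity
    exact mul_le_mul_of_nonneg_left (by linarith [sq_nonneg (dt1 φ 0 x)]) this
  time := by
    simp only [← dt1_eq_fderiv hφ]
    exact lintegral_zero_le hE fun x => by
      have : 0 ≤ (1 + ‖x‖) ^ (p - 1) := by positivity
      exact mul_le_mul_of_nonneg_left (by linarith [sq_nonneg ‖fderiv ℝ (φ 0) x‖]) this

lemma hasData_of_wEnergy (hp : 1 < p) (hφ : ContDiff ℝ (⊤ : ℕ∞) fun q : ℝ × E3 => φ q.1 q.2) :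
    HasData p K fun q : ℝ × E3 => φ q.1 q.2 := by
  have h1 : ContDiff ℝ 1 fun q : ℝ × E3 => φ q.1 q.2 :=
    hφ.of_le (by exact_mod_cast (le_top : (1 : ℕ∞) ≤ ⊤))
  have hd := contDiff_fderiv_one hφ
  have hs : ContDiff ℝ (⊤ : ℕ∞) (φ 0) :=
    hφ.comp (f := fun x : E3 => ((0 : ℝ), x)) (contDiff_const.prodMk contDiff_id)
  have hsd : ContDiff ℝ 1 (fderiv ℝ (φ 0)) :=
    hs.fderiv_right (m := 1) (WithTop.coe_le_coe.2 (le_top : (1 + 1 : ℕ∞) ≤ ⊤))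
  have hw := fun x : E3 => one_le_weight (q := p - 1) (by linarith) x
  have hle : ∀ {a b : ℝ} (x : E3), 0 ≤ b → a ≤ b → a ≤ (1 + ‖x‖) ^ (p - 1) * b :=
    fun x hb hab => hab.trans (le_mul_of_one_le_left hb (hw x))
  have hsl : ∀ x v, fderiv ℝ (fun q : ℝ × E3 => φ q.1 q.2) (0, x) (0, v) = fderiv ℝ (φ 0) x v :=
    fun x v => (fderiv_slice h1 0 x v).symm
  refine ⟨?_, fun i => ⟨?_, ?_, ?_⟩, ⟨?_, ?_, ?_⟩⟩
  · refine le_trans (lintegral_mono fun x => ENNReal.ofReal_le_ofReal ?_)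
      ((le_add_self : _ ≤ wEnergy p 1 (p - 1) φ).trans hE)
    exact hle x (by positivity) le_rfl
  · exact (hd.comp (contDiff_const.prodMk contDiff_id)).clm_apply contDiff_const
  · simp only [hsl]
    refine lintegral_zero_le hE fun x => hle x (by positivity) ?_
    have := sq_clm_apply_le (fderiv ℝ (φ 0) x) (v := EuclideanSpace.single i 1) (by simp)
    linarith [sq_nonneg (dt1 φ 0 x)]
  · simp only [hsl]
    refine lintegral_one_le hE hp fun x => ?_
    have h2 : ‖fderiv ℝ (fun x => fderiv ℝ (φ 0) x (EuclideanSpace.single i 1)) x‖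
        ≤ ‖fderiv ℝ (fderiv ℝ (φ 0)) x‖ := by
      refine ContinuousLinearMap.opNorm_le_bound _ (by positivity) fun w => ?_
      rw [fderiv_clm_apply (hsd.differentiable (by norm_num) _) (differentiableAt_const _)]
      simp only [fderiv_fun_const, Pi.zero_apply, ContinuousLinearMap.comp_zero, zero_add,
        ContinuousLinearMap.flip_apply]
      refine (ContinuousLinearMap.le_opNorm₂ _ _ _).trans ?_
      simp
    have := pow_le_pow_left₀ (norm_nonneg _) h2 2
    linarith [sq_nonneg ‖fderiv ℝ (dt1 φ 0) x‖]
  · exact (hd.comp (contDiff_const.prodMk contDiff_id)).clm_apply contDiff_const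
  · simp only [← dt1_eq_fderiv h1]
    exact lintegral_zero_le hE fun x => hle x (by positivity)
      (by linarith [sq_nonneg ‖fderiv ℝ (φ 0) x‖])
  · simp only [← dt1_eq_fderiv h1]
    exact lintegral_one_le hE hp fun x =>
      le_add_of_nonneg_left (sq_nonneg ‖fderiv ℝ (fderiv ℝ (φ 0)) x‖)

end conversion

theorem nlw_mixed_norm_bound (p : ℝ) (hp : (2.3542 : ℝ) ≤ p) (hp5 : p < 5) :
    ∀ φ : ℝ → E3 → ℝ, IsNLWSolution p φ → wEnergy p 1 (p - 1) φ < ⊤ →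
      (∫⁻ t in Set.Ioi (0 : ℝ),
        (∫⁻ x : E3, ENNReal.ofReal (|φ t x| ^ (2 * p))) ^ ((1 : ℝ) / 2)) < ⊤ := by
  intro φ hφ hE
  have hp1 : 1 < p := by linarith
  have hEK := (ENNReal.ofReal_toReal hE.ne).ge
  have h1 : ContDiff ℝ 1 fun q : ℝ × E3 => φ q.1 q.2 :=
    hφ.1.of_le (by exact_mod_cast (le_top : (1 : ℕ∞) ≤ ⊤))
  obtain ⟨N, κ, hN, hκ, hdec⟩ := exists_moment_decay (by norm_num at hp ⊢; linarith) hp5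
    ENNReal.toReal_nonneg hφ.isSol (hasData_of_wEnergy hEK hp1 hφ.1)
    (hasWeightedData_of_wEnergy hEK h1)
  have h2p : 0 ≤ 2 * p := by linarith
  have hc := h1.continuous
  calc ∫⁻ t in Set.Ioi (0 : ℝ), (∫⁻ x : E3, ENNReal.ofReal (|φ t x| ^ (2 * p))) ^ ((1 : ℝ) / 2)
      ≤ ∫⁻ t in Set.Ioi (0 : ℝ), ENNReal.ofReal (√N) * ENNReal.ofReal ((1 + ‖t‖) ^ (-κ)) := by
        refine setLIntegral_mono' measurableSet_Ioi fun t ht => ?_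
        have ht0 : 0 ≤ t := le_of_lt ht
        have hφt : Continuous (φ t) := hc.comp (f := fun x : E3 => (t, x)) (by fun_prop)
        have h2 := lintegral_le_of_shell_le (G := fun x => |φ t x| ^ (2 * p)) (by fun_prop)
          (fun x => by positivity) (hdec t ht0)
        have h3 := ENNReal.rpow_le_rpow h2 (z := (1 : ℝ) / 2) (by norm_num)
        rw [ENNReal.ofReal_rpow_of_nonneg (by positivity) (by norm_num),
          mul_rpow hN (by positivity), ← rpow_mul (by positivity), ← sqrt_eq_rpow,
          ENNReal.ofReal_mul (sqrt_nonneg _)] at h3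
        rw [Real.norm_eq_abs, abs_of_nonneg ht0]
        convert h3 using 4
        ring
    _ ≤ ENNReal.ofReal (√N) * ∫⁻ t : ℝ, ENNReal.ofReal ((1 + ‖t‖) ^ (-κ)) := by
        rw [lintegral_const_mul' _ _ ENNReal.ofReal_ne_top]
        gcongr
        exact Measure.restrict_le_self
    _ < ⊤ := ENNReal.mul_lt_top ENNReal.ofReal_lt_top
        (finite_integral_one_add_norm (by simpa using hκ))
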